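/- Let A_0, ..., A_n be nonempty finite subsets of a lattice M of rank n, with convex hulls Delta_0, ..., Delta_n. Then the height of the sparse resultant Res_{A_0,...,A_n} (the logarithm of the maximum absolute value of its integer coefficients) is bounded by the sum over i from 0 to n of MV_M(Delta_0, ..., Delta_{i-1}, Delta_{i+1}, ..., Delta_n) * log(#A_i). -/

import Mathlib

open Pointwise MeasureTheory

noncomputable section

variable {n : ℕ}

/-- Evaluation of the character `χ^a` at a point `ξ` of the torus `(ℂˣ)^n`. -/
def chEval (ξ : Fin n → ℂˣ) (a : Fin n → ℤ) : ℂ :=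
  ∏ j, ((ξ j ^ (a j) : ℂˣ) : ℂ)

/-- `ξ` is a common root of the Laurent polynomials with supports `A i` and
coefficients `c i`. -/
def IsRootOf (A : Fin (n + 1) → Finset (Fin n → ℤ))
    (c : Fin (n + 1) → (Fin n → ℤ) → ℂ) (ξ : Fin n → ℂˣ) : Prop :=
  ∀ i, ∑ a ∈ A i, c i a * chEval ξ a = 0

/-- The family with supports `A` and coefficients `c` has a common root in the torus. -/
def HasRoot (A : Fin (n + 1) → Finset (Fin n → ℤ))
    (c : Fin (n + 1) → (Fin n → ℤ) → ℂ) : Prop :=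
  ∃ ξ, IsRootOf A c ξ

/-- Evaluation of an integer polynomial in the coefficient variables `u_{i,a}` at a
family of complex coefficients. -/
def evalCoeff (R : MvPolynomial (Fin (n + 1) × (Fin n → ℤ)) ℤ)
    (c : Fin (n + 1) → (Fin n → ℤ) → ℂ) : ℂ :=
  MvPolynomial.aeval (fun p => c p.1 p.2) R

/-- `E` is the sparse eliminant of the family of supports `A`. -/
def IsEliminant (A : Fin (n + 1) → Finset (Fin n → ℤ))
    (E : MvPolynomial (Fin (n + 1) × (Fin n → ℤ)) ℤ) : Prop :=
  (Irreducible E ∧ {c | evalCoeff E c = 0} = closure {c | HasRoot A c})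
  ∨ (E = 1 ∧ ∀ E' : MvPolynomial (Fin (n + 1) × (Fin n → ℤ)) ℤ,
      ¬ (Irreducible E' ∧ {c | evalCoeff E' c = 0} = closure {c | HasRoot A c}))

/-- `R` is the sparse resultant of the family of supports `A`: up to sign the power
`E^d` of the sparse eliminant, where `d` is the degree of the projection from the
incidence variety (the number of common roots of a generic coefficient family in the
vanishing locus). -/
def IsResultant (A : Fin (n + 1) → Finset (Fin n → ℤ))
    (R : MvPolynomial (Fin (n + 1) × (Fin n → ℤ)) ℤ) : Prop :=
  ∃ E d, IsEliminant A E ∧ (R = E ^ d ∨ R = -E ^ d) ∧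
    ∃ U : Set (Fin (n + 1) → (Fin n → ℤ) → ℂ), IsOpen U ∧
      closure (U ∩ {c | HasRoot A c}) = closure {c | HasRoot A c} ∧
      ∀ c ∈ U ∩ {c | HasRoot A c}, Nat.card {ξ // IsRootOf A c ξ} = d

/-- The partial degree of `R` in the group of variables `u_i = (u_{i,a})_a`. -/
def groupDeg (i : Fin (n + 1)) (R : MvPolynomial (Fin (n + 1) × (Fin n → ℤ)) ℤ) : ℕ :=
  R.support.sup fun m => ∑ p ∈ m.support.filter (fun p => p.1 = i), m p

/-- Mixed volume (inclusion-exclusion formula, normalized by `MV(Q,…,Q) = k! vol Q`),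
with the convention `MV = 1` for `k = 0`. -/
def mixedVolume (k : ℕ) {ι : Type*} [Fintype ι] (Q : ι → Set (Fin k → ℝ)) : ℝ :=
  if k = 0 then 1 else
    ∑ s ∈ (Finset.univ : Finset ι).powerset,
      if s.Nonempty then
        (-1 : ℝ) ^ (Fintype.card ι - s.card) * (volume (∑ i ∈ s, Q i)).toReal
      else 0

/-- The coordinatewise cast `ℤ^n → ℝ^n`. -/
def castR (n : ℕ) (x : Fin n → ℤ) : Fin n → ℝ := fun j => (x j : ℝ)


theorem mahlerMeasure_le_of_norm_eval_le (p : Polynomial ℂ) {B : ℝ} (hB : 0 < B)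
    (h : ∀ s : ℂ, ‖s‖ = 1 → ‖p.eval s‖ ≤ B) : p.mahlerMeasure ≤ B := by
  rcases eq_or_ne p 0 with rfl | hp
  · simpa using hB.le
  have hB' : ((B : ℂ))⁻¹ ≠ 0 := by
    simpa using hB.ne'
  have hq : Polynomial.C ((B : ℂ))⁻¹ * p ≠ 0 := mul_ne_zero (by simpa using hB.ne') hp
  have h1 : (Polynomial.C ((B : ℂ))⁻¹ * p).mahlerMeasure ≤ 1 := by
    rw [Polynomial.mahlerMeasure_def_of_ne_zero hq, Real.exp_le_one_iff]
    change Real.circleAverage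
      (fun x => Real.log ‖(Polynomial.C ((B : ℂ))⁻¹ * p).eval x‖) 0 1 ≤ 0
    apply Real.circleAverage_mono_on_of_le_circle
    · exact Polynomial.intervalIntegrable_mahlerMeasure _
    · intro x hx
      apply Real.log_nonpos (norm_nonneg _)
      have hx1 : ‖x‖ = 1 := by simpa using hx
      rw [Polynomial.eval_mul, Polynomial.eval_C, norm_mul, norm_inv, Complex.norm_real,
        Real.norm_of_nonneg hB.le, inv_mul_le_iff₀ hB, mul_one]
      exact h x hx1
  rw [Polynomial.mahlerMeasure_mul, Polynomial.mahlerMeasure_const, norm_inv, Complex.norm_real,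
    Real.norm_of_nonneg hB.le, inv_mul_le_iff₀ hB, mul_one] at h1
  exact h1

theorem exists_circle_mahlerMeasure_le (p : Polynomial ℂ) :
    ∃ s : ℂ, ‖s‖ = 1 ∧ p.mahlerMeasure ≤ ‖p.eval s‖ := by
  obtain ⟨s, hs, hmax⟩ := (isCompact_sphere (0 : ℂ) 1).exists_isMaxOn
    ⟨1, by simp⟩ (f := fun s => ‖p.eval s‖) (by fun_prop)
  have hs1 : ‖s‖ = 1 := by simpa using hs
  refine ⟨s, hs1, ?_⟩
  refine le_of_forall_pos_le_add fun ε hε => ?_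
  apply mahlerMeasure_le_of_norm_eval_le _ (by positivity)
  intro t ht
  have := hmax (show t ∈ Metric.sphere (0 : ℂ) 1 by simpa using ht)
  have h2 : ‖p.eval t‖ ≤ ‖p.eval s‖ := this
  linarith

/-- The maximum of the norms of the coordinates. -/
noncomputable def maxNorm {α : Type*} [Fintype α] [Nonempty α] (z : α → ℂ) : ℝ :=
  Finset.univ.sup' Finset.univ_nonempty fun a => ‖z a‖

theorem norm_le_maxNorm {α : Type*} [Fintype α] [Nonempty α] (z : α → ℂ) (a : α) :
    ‖z a‖ ≤ maxNorm z :=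
  Finset.le_sup' (fun a => ‖z a‖) (Finset.mem_univ a)

theorem exists_maxNorm_eq {α : Type*} [Fintype α] [Nonempty α] (z : α → ℂ) :
    ∃ a, maxNorm z = ‖z a‖ := by
  obtain ⟨a, -, ha⟩ := Finset.exists_mem_eq_sup' Finset.univ_nonempty fun a => ‖z a‖
  exact ⟨a, ha⟩

theorem maxNorm_nonneg {α : Type*} [Fintype α] [Nonempty α] (z : α → ℂ) : 0 ≤ maxNorm z := by
  obtain ⟨a, ha⟩ := exists_maxNorm_eq z
  rw [ha]; positivity

theorem maxNorm_pow {α : Type*} [Fintype α] [Nonempty α] (z : α → ℂ) (K : ℕ) :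
    maxNorm (z ^ K) = maxNorm z ^ K := by
  apply le_antisymm
  · obtain ⟨a, ha⟩ := exists_maxNorm_eq (z ^ K)
    rw [ha, Pi.pow_apply, norm_pow]
    exact pow_le_pow_left₀ (norm_nonneg _) (norm_le_maxNorm z a) K
  · obtain ⟨a, ha⟩ := exists_maxNorm_eq z
    rw [ha, ← norm_pow]
    exact norm_le_maxNorm (z ^ K) a

theorem exists_prod_maxNorm_le {α κ : Type*} [Fintype α] [Nonempty α] (s : Finset κ)
    (z : κ → α → ℂ) :
    ∃ u : α → ℂ, (∀ a, ‖u a‖ ≤ 1) ∧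
      ∏ k ∈ s, maxNorm (z k) ≤
        ((2 : ℝ) ^ Fintype.card α) ^ s.card * ‖∏ k ∈ s, ∑ a, z k a * u a‖ := by
  classical
  let idx := Fintype.equivFin α
  let p : κ → Polynomial ℂ := fun k => ∑ a, Polynomial.C (z k a) * Polynomial.X ^ (idx a : ℕ)
  have hcoeff : ∀ k a, (p k).coeff (idx a) = z k a := by
    intro k a
    simp only [p, Polynomial.finsetSum_coeff, Polynomial.coeff_C_mul, Polynomial.coeff_X_pow]
    rw [Finset.sum_eq_single a]
    · simp
    · intro b _ hb
      rw [if_neg, mul_zero]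
      intro h
      exact hb (idx.injective (Fin.ext h.symm))
    · simp
  have hdeg : ∀ k, (p k).natDegree ≤ Fintype.card α := by
    intro k
    apply Polynomial.natDegree_sum_le_of_forall_le
    intro a _
    exact (Polynomial.natDegree_C_mul_X_pow_le _ _).trans (idx a).2.le
  have hmax : ∀ k, maxNorm (z k) ≤ (2 : ℝ) ^ Fintype.card α * (p k).mahlerMeasure := by
    intro k
    obtain ⟨a, ha⟩ := exists_maxNorm_eq (z k)
    rw [ha, ← hcoeff]
    refine (Polynomial.norm_coeff_le_choose_mul_mahlerMeasure _ _).trans ?_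
    gcongr
    · exact Polynomial.mahlerMeasure_nonneg _
    · have : ((p k).natDegree.choose (idx a) : ℝ) ≤ (2 : ℝ) ^ (p k).natDegree := by
        exact_mod_cast Nat.choose_le_two_pow _ _
      exact this.trans (pow_le_pow_right₀ (by norm_num) (hdeg k))
  have hprod : (∏ k ∈ s, p k).mahlerMeasure = ∏ k ∈ s, (p k).mahlerMeasure := by
    clear hmax hdeg hcoeff
    induction s using Finset.cons_induction with
    | empty => simp
    | cons k s hk ih => rw [Finset.prod_cons, Polynomial.mahlerMeasure_mul, ih, Finset.prod_cons]
  obtain ⟨t, ht, hle⟩ := exists_circle_mahlerMeasure_le (∏ k ∈ s, p k)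
  refine ⟨fun a => t ^ (idx a : ℕ), fun a => by simp [ht], ?_⟩
  have heval : ∀ k, (p k).eval t = ∑ a, z k a * t ^ (idx a : ℕ) := by
    intro k
    simp [p, Polynomial.eval_finsetSum]
  calc ∏ k ∈ s, maxNorm (z k)
      ≤ ∏ k ∈ s, ((2 : ℝ) ^ Fintype.card α * (p k).mahlerMeasure) :=
        Finset.prod_le_prod (fun k _ => maxNorm_nonneg _) fun k _ => hmax k
    _ = ((2 : ℝ) ^ Fintype.card α) ^ s.card * (∏ k ∈ s, p k).mahlerMeasure := by
        rw [Finset.prod_mul_distrib, Finset.prod_const, hprod]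
    _ ≤ _ := by
        gcongr
        simpa [Polynomial.eval_prod, heval] using hle

theorem norm_prod_linear_le {α κ : Type*} [Fintype α] [Nonempty α] (s : Finset κ)
    (z : κ → α → ℂ) (u : α → ℂ) (hu : ∀ a, ‖u a‖ ≤ 1) :
    ‖∏ k ∈ s, ∑ a, z k a * u a‖ ≤ (Fintype.card α : ℝ) ^ s.card * ∏ k ∈ s, maxNorm (z k) := by
  rw [norm_prod, ← Finset.prod_const, ← Finset.prod_mul_distrib]
  refine Finset.prod_le_prod (fun _ _ => norm_nonneg _) fun k _ => ?_
  calc ‖∑ a, z k a * u a‖ ≤ ∑ a, ‖z k a * u a‖ := norm_sum_le _ _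
    _ ≤ ∑ _a : α, maxNorm (z k) := by
        refine Finset.sum_le_sum fun a _ => ?_
        rw [norm_mul]
        calc ‖z k a‖ * ‖u a‖ ≤ maxNorm (z k) * 1 :=
              mul_le_mul (norm_le_maxNorm _ _) (hu a) (norm_nonneg _) (maxNorm_nonneg _)
          _ = _ := mul_one _
    _ = _ := by simp

section

open MvPolynomial in
/-- The linear form with coefficients `z`. -/
noncomputable def linForm {α L : Type*} [Fintype α] [CommSemiring L] (z : α → L) :
    MvPolynomial α L :=
  ∑ a, C (z a) * X a

section LinForm

open MvPolynomial

variable {α L : Type*} [Fintype α] [Field L]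

@[simp]
theorem eval_linForm (z u : α → L) : eval u (linForm z) = ∑ a, z a * u a := by
  simp [linForm]

theorem eval₂_linForm {S : Type*} [CommSemiring S] (f : L →+* S) (z : α → L) (u : α → S) :
    eval₂ f u (linForm z) = ∑ a, f (z a) * u a := by
  simp [linForm, eval₂_sum]

theorem map_linForm {S : Type*} [CommSemiring S] (f : L →+* S) (z : α → L) :
    map f (linForm z) = linForm (fun a => f (z a)) := by
  simp [linForm]

/-- Elimination of the variable `a₀` by means of the linear form `z`. -/
noncomputable def linSubst [DecidableEq α] (z : α → L) (a₀ : α) : MvPolynomial α L →ₐ[L] MvPolynomial α L :=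
  aeval fun a => if a = a₀ then -∑ b ∈ Finset.univ.erase a₀, C (z b) * X b else X a

theorem linForm_dvd_iff [DecidableEq α] {z : α → L} {a₀ : α} (hz : z a₀ = 1) (P : MvPolynomial α L) :
    linForm z ∣ P ↔ linSubst z a₀ P = 0 := by
  have hlin : linForm z = X a₀ + ∑ b ∈ Finset.univ.erase a₀, C (z b) * X b := by
    rw [linForm, ← Finset.add_sum_erase _ _ (Finset.mem_univ a₀), hz, C_1, one_mul]
  constructor
  · rintro ⟨Q, rfl⟩
    have h0 : linSubst z a₀ (linForm z) = 0 := by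
      rw [hlin, map_add, map_sum]
      have : ∀ b ∈ Finset.univ.erase a₀, linSubst z a₀ (C (z b) * X b) = C (z b) * X b := by
        intro b hb
        rw [map_mul, ← algebraMap_eq, AlgHom.commutes]
        simp [linSubst, Finset.ne_of_mem_erase hb]
      rw [Finset.sum_congr rfl this]
      simp [linSubst]
    rw [map_mul, h0, zero_mul]
  · intro h
    rw [← Ideal.mem_span_singleton, ← Ideal.Quotient.eq_zero_iff_mem]
    have : (Ideal.Quotient.mkₐ L (Ideal.span {linForm z})).comp (linSubst z a₀) =
        Ideal.Quotient.mkₐ L (Ideal.span {linForm z}) := by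
      ext a
      simp only [AlgHom.comp_apply, linSubst, aeval_X]
      split_ifs with ha
      · subst ha
        rw [Ideal.Quotient.mkₐ_eq_mk, Ideal.Quotient.eq, Ideal.mem_span_singleton]
        refine ⟨-1, ?_⟩
        rw [hlin]; ring
      · rfl
    have h2 := DFunLike.congr_fun this P
    rw [AlgHom.comp_apply, h, map_zero] at h2
    exact h2.symm

theorem prime_linForm {z : α → L} {a₀ : α} (hz : z a₀ = 1) : Prime (linForm z) := by
  classical
  refine ⟨?_, ?_, ?_⟩
  · intro h
    have := congrArg (eval (Pi.single a₀ 1)) h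
    simp [Pi.single_apply, hz] at this
  · intro h
    have h0 := (linForm_dvd_iff hz (linForm z)).1 dvd_rfl
    exact (h.map (linSubst z a₀)).ne_zero h0
  · intro P Q
    simp only [linForm_dvd_iff hz, map_mul, mul_eq_zero, imp_self]

theorem eq_of_linForm_dvd {z z' : α → L} {a₀ : α} (hz : z a₀ = 1) (hz' : z' a₀ = 1)
    (h : linForm z ∣ linForm z') : z = z' := by
  classical
  funext b
  by_cases hb : b = a₀
  · rw [hb, hz, hz']
  have hsum : ∀ w : α → L, w a₀ = 1 →
      ∑ a, w a * (Pi.single b (1 : L) - Pi.single a₀ (z b) : α → L) a = w b - z b := by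
    intro w hw
    simp [mul_sub, Finset.sum_sub_distrib, Pi.single_apply, hw]
  have := map_dvd (eval (Pi.single b (1 : L) - Pi.single a₀ (z b))) h
  rw [eval_linForm, eval_linForm, hsum z hz, hsum z' hz', sub_self, zero_dvd_iff, sub_eq_zero]
    at this
  exact this.symm

end LinForm

section Galois

open MvPolynomial

variable {α B F L : Type*} [Fintype α] [CommRing B] [IsDomain B]
  [Field F] [Field L] [Algebra B F] [IsFractionRing B F]
  [Algebra F L] [Algebra B L] [IsScalarTower B F L] [IsGalois F L]

variable (F) in
/-- The Galois orbit of a tuple. -/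
def galOrbit (z : α → L) : Set (α → L) := Set.range fun g : L ≃ₐ[F] L => fun a => g (z a)

theorem finite_galOrbit (z : α → L) : (galOrbit F z).Finite := by
  have : galOrbit F z ⊆ Set.pi Set.univ fun a => {x | x ∈ (minpoly F (z a)).rootSet L} := by
    rintro _ ⟨g, rfl⟩ a -
    have hzint : IsIntegral F (z a) := Algebra.IsIntegral.isIntegral (z a)
    simp only [Set.mem_ofPred_eq]
    rw [Polynomial.mem_rootSet_of_ne (minpoly.ne_zero hzint), ← AlgEquiv.coe_toAlgHom,
      Polynomial.aeval_algHom_apply, minpoly.aeval, map_zero]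
  refine Set.Finite.subset (Set.Finite.pi fun a => ?_) this
  exact Polynomial.rootSet_finite _ _

variable (F) in
/-- The Galois orbit of a tuple, as a finite set. -/
noncomputable def galFinset (z : α → L) : Finset (α → L) := (finite_galOrbit (F := F) z).toFinset

theorem mem_galFinset {z w : α → L} :
    w ∈ galFinset F z ↔ ∃ g : L ≃ₐ[F] L, (fun a => g (z a)) = w := by
  simp [galFinset, galOrbit]

theorem self_mem_galFinset (z : α → L) : z ∈ galFinset F z :=
  mem_galFinset.2 ⟨AlgEquiv.refl, rfl⟩

theorem galFinset_apply_eq_one {z : α → L} {a₀ : α} (hz : z a₀ = 1) {w : α → L}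
    (hw : w ∈ galFinset F z) : w a₀ = 1 := by
  obtain ⟨g, rfl⟩ := mem_galFinset.1 hw
  simp [hz]

variable (F) in
theorem map_prod_galFinset (z : α → L) (g : L ≃ₐ[F] L) :
    map (g : L →+* L) (∏ w ∈ galFinset F z, linForm w) = ∏ w ∈ galFinset F z, linForm w := by
  rw [map_prod]
  simp only [map_linForm]
  refine Finset.prod_bij (fun w _ a => g (w a)) ?_ ?_ ?_ ?_
  · intro w hw
    obtain ⟨h, rfl⟩ := mem_galFinset.1 hw
    exact mem_galFinset.2 ⟨h.trans g, rfl⟩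
  · intro w _ w' _ h
    funext a
    exact g.injective (congrFun h a)
  · intro w hw
    obtain ⟨h, rfl⟩ := mem_galFinset.1 hw
    exact ⟨fun a => g.symm (h (z a)), mem_galFinset.2 ⟨h.trans g.symm, rfl⟩, by simp⟩
  · intro w _
    rfl

/-- Galois-invariant polynomials have coefficients in the base field, hence descend to the
integral domain `B` after clearing denominators. -/
theorem exists_map_eq_C_mul_of_invariant (P : MvPolynomial α L)
    (hP : ∀ g : L ≃ₐ[F] L, map (g : L →+* L) P = P) :
    ∃ b : B, b ≠ 0 ∧ ∃ Q : MvPolynomial α B,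
      map (algebraMap B L) Q = C (algebraMap B L b) * P := by
  obtain ⟨PF, rfl⟩ : P ∈ Set.range (map (σ := α) (algebraMap F L)) := by
    rw [mem_range_map_iff_coeffs_subset]
    intro x hx
    rw [Finset.mem_coe, mem_coeffs_iff] at hx
    obtain ⟨m, -, rfl⟩ := hx
    have := (InfiniteGalois.mem_bot_iff_fixed (k := F) (coeff m P)).2 fun g => by
      conv_rhs => rw [← hP g]
      rw [coeff_map]; rfl
    exact IntermediateField.mem_bot.1 this
  let _ : Algebra (MvPolynomial α B) (MvPolynomial α F) := algebraMvPolynomial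
  obtain ⟨⟨Q, ⟨_, b, hb, rfl⟩⟩, h⟩ := IsLocalization.surj
    (M := (nonZeroDivisors B).map (C (σ := α))) (S := MvPolynomial α F) PF
  refine ⟨b, nonZeroDivisors.ne_zero hb, Q, ?_⟩
  have h2 : PF * map (algebraMap B F) (C b) = map (algebraMap B F) Q := h
  rw [map_C] at h2
  have h3 := congrArg (map (algebraMap F L)) h2
  rw [map_mul, map_C, map_map, ← IsScalarTower.algebraMap_eq, ← IsScalarTower.algebraMap_apply]
    at h3
  rw [← h3, mul_comm]

end Galois

end

section

section Galois

open MvPolynomial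

variable {α B F L : Type*} [Fintype α] [CommRing B] [IsDomain B]
  [Field F] [Field L] [Algebra B F] [IsFractionRing B F]
  [Algebra F L] [Algebra B L] [IsScalarTower B F L] [IsGalois F L]

theorem linForm_not_dvd_C {z : α → L} {a₀ : α} (hz : z a₀ = 1) {x : L} (hx : x ≠ 0) :
    ¬ linForm z ∣ C x := by
  classical
  intro h
  rw [linForm_dvd_iff hz] at h
  have : linSubst z a₀ (C x) = C x := by
    rw [← algebraMap_eq, AlgHom.commutes]
  rw [this, C_eq_zero] at h
  exact hx h

variable (F) in
theorem eval_single_prod_galFinset [DecidableEq α] {z : α → L} {a₀ : α} (hz : z a₀ = 1) :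
    eval (Pi.single a₀ 1) (∏ w ∈ galFinset F z, linForm w) = 1 := by
  rw [map_prod]
  refine Finset.prod_eq_one fun w hw => ?_
  rw [eval_linForm]
  simp [Pi.single_apply, galFinset_apply_eq_one hz hw]

variable (B F) in
theorem prod_galFinset_dvd_of_linForm_dvd {z : α → L} {a₀ : α} (hz : z a₀ = 1)
    {P : MvPolynomial α B} (h : linForm z ∣ map (algebraMap B L) P) :
    ∏ w ∈ galFinset F z, linForm w ∣ map (algebraMap B L) P := by
  apply Finset.prod_dvd_of_isRelPrime
  · intro w hw w' hw' hne
    have h1 := galFinset_apply_eq_one hz hw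
    have h2 := galFinset_apply_eq_one hz hw'
    exact (prime_linForm h1).irreducible.isRelPrime_iff_not_dvd.2
      fun hd => hne (eq_of_linForm_dvd h1 h2 hd)
  · intro w hw
    obtain ⟨g, rfl⟩ := mem_galFinset.1 hw
    have h2 := map_dvd (map (σ := α) (g : L →+* L)) h
    rw [map_linForm, map_map] at h2
    have : (g : L →+* L).comp (algebraMap B L) = algebraMap B L := by
      ext b
      simp [IsScalarTower.algebraMap_apply B F L]
    rwa [this] at h2

variable [UniqueFactorizationMonoid B]

variable (B F) in
/-- The polynomials over `B` vanishing on the hyperplane `z` are the multiples of a prime, which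
over `L` is a constant times the product of the conjugates of the linear form. -/
theorem exists_prime_dvd_iff_linForm_dvd {z : α → L} {a₀ : α} (hz : z a₀ = 1) :
    ∃ E : MvPolynomial α B, ∃ c : B, c ≠ 0 ∧ Prime E ∧
      (∀ P, E ∣ P ↔ linForm z ∣ map (algebraMap B L) P) ∧
      map (algebraMap B L) E = C (algebraMap B L c) * ∏ w ∈ galFinset F z, linForm w := by
  classical
  have hinj : Function.Injective (algebraMap B L) := by
    rw [IsScalarTower.algebraMap_eq B F L]
    exact (algebraMap F L).injective.comp (IsFractionRing.injective B F)
  have hmapinj := map_injective (σ := α) _ hinj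
  set Q := ∏ w ∈ galFinset F z, linForm w with hQ
  have hQ0 : Q ≠ 0 := Finset.prod_ne_zero_iff.2 fun w hw =>
    (prime_linForm (galFinset_apply_eq_one hz hw)).ne_zero
  obtain ⟨b, hb, P₀, hP₀⟩ := exists_map_eq_C_mul_of_invariant (B := B) (F := F) Q
    (map_prod_galFinset F z)
  have hb' : algebraMap B L b ≠ 0 := by
    rwa [Ne, map_eq_zero_iff _ hinj]
  have hzQ : linForm z ∣ Q := Finset.dvd_prod_of_mem _ (self_mem_galFinset z)
  have hP₀0 : P₀ ≠ 0 := by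
    rintro rfl
    rw [map_zero] at hP₀
    exact mul_ne_zero (by rwa [Ne, C_eq_zero]) hQ0 hP₀.symm
  have key : ∀ P : MvPolynomial α B, P ≠ 0 → linForm z ∣ map (algebraMap B L) P →
      ∃ E, Prime E ∧ E ∣ P ∧ linForm z ∣ map (algebraMap B L) E := by
    intro P
    refine UniqueFactorizationMonoid.induction_on_prime P ?_ ?_ ?_
    · intro h; exact absurd rfl h
    · intro x hx _ hd
      exact absurd (isUnit_of_dvd_unit hd (hx.map _)) (prime_linForm hz).not_isUnit
    · intro a p ha hp ih _ hd
      rw [map_mul] at hd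
      rcases (prime_linForm hz).dvd_or_dvd hd with h | h
      · exact ⟨p, hp, dvd_mul_right _ _, h⟩
      · obtain ⟨E, h1, h2, h3⟩ := ih ha h
        exact ⟨E, h1, h2.mul_left _, h3⟩
  obtain ⟨E, hE, ⟨R, hR⟩, hzE⟩ := key P₀ hP₀0 (hP₀ ▸ hzQ.mul_left _)
  obtain ⟨S, hS⟩ := prod_galFinset_dvd_of_linForm_dvd B F hz hzE
  have hSR : S * map (algebraMap B L) R = C (algebraMap B L b) := by
    apply mul_left_cancel₀ hQ0
    rw [← mul_assoc, ← hS, ← map_mul, ← hR, hP₀, mul_comm]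
  have hS0 : S ≠ 0 := by
    rintro rfl
    rw [zero_mul] at hSR
    exact (C_eq_zero.not.2 hb') hSR.symm
  have hR0 : map (algebraMap B L) R ≠ 0 := by
    intro h
    rw [h, mul_zero] at hSR
    exact (C_eq_zero.not.2 hb') hSR.symm
  have hSdeg : S.totalDegree = 0 := by
    have := congrArg totalDegree hSR
    rw [totalDegree_mul_of_isDomain hS0 hR0, totalDegree_C] at this
    omega
  rw [totalDegree_eq_zero_iff_eq_C] at hSdeg
  have hs : coeff 0 S = algebraMap B L (eval (Pi.single a₀ 1) E) := by
    have h1 := congrArg (eval (Pi.single a₀ (1 : L))) hS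
    rw [map_mul, eval_single_prod_galFinset F hz, one_mul, hSdeg, eval_C] at h1
    have h2 : (fun a => algebraMap B L ((Pi.single a₀ 1 : α → B) a)) = Pi.single a₀ 1 := by
      funext a
      by_cases h : a = a₀ <;> simp [h]
    rw [← h1, eval_map, ← h2]
    exact (eval₂_comp (algebraMap B L) (Pi.single a₀ 1) E).symm
  set c := eval (Pi.single a₀ 1) E with hc
  have hcS : C (algebraMap B L c) = S := by rw [← hs, ← hSdeg]
  have hc0 : c ≠ 0 := by
    intro h
    rw [h, map_zero, C_0] at hcS
    exact hS0 hcS.symm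
  refine ⟨E, c, hc0, hE, fun P => ⟨fun h => hzE.trans (map_dvd _ h), fun h => ?_⟩, ?_⟩
  · obtain ⟨SP, hSP⟩ := prod_galFinset_dvd_of_linForm_dvd B F hz h
    obtain ⟨b', hb'0, S', hS'⟩ := exists_map_eq_C_mul_of_invariant (B := B) (F := F) SP (by
      intro g
      apply mul_left_cancel₀ hQ0
      conv_lhs => rw [hQ, ← map_prod_galFinset F z g, ← map_mul, ← hSP, map_map]
      have : (g : L →+* L).comp (algebraMap B L) = algebraMap B L := by
        ext b
        simp [IsScalarTower.algebraMap_apply B F L]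
      rw [this, hSP])
    have heq : C (b' * c) * P = E * S' := by
      apply hmapinj
      rw [C_mul, map_mul, map_mul, map_C, map_C, map_mul, hS', hSP, hS, ← hcS]
      ring
    rcases hE.dvd_or_dvd (Dvd.intro _ heq.symm) with h1 | h1
    · have h2 := hzE.trans (map_dvd (map (algebraMap B L)) h1)
      rw [map_C] at h2
      refine absurd h2 (linForm_not_dvd_C hz ?_)
      rw [Ne, map_eq_zero_iff _ hinj]
      exact mul_ne_zero hb'0 hc0
    · exact h1
  · rw [hS, hcS, mul_comm]

variable (F) in
theorem map_eq_C_mul_prod_of_dvd_iff {z : α → L} {a₀ : α} (hz : z a₀ = 1)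
    {E : MvPolynomial α B} (hE : ∀ P, E ∣ P ↔ linForm z ∣ map (algebraMap B L) P) :
    ∃ c : B, c ≠ 0 ∧
      map (algebraMap B L) E = C (algebraMap B L c) * ∏ w ∈ galFinset F z, linForm w := by
  obtain ⟨E₀, c, hc, -, hE₀, hmap⟩ := exists_prime_dvd_iff_linForm_dvd B F hz
  have h : Associated E₀ E := associated_of_dvd_dvd
    ((hE₀ E).2 ((hE E).1 dvd_rfl)) ((hE E₀).2 ((hE₀ E₀).1 dvd_rfl))
  obtain ⟨u, hu⟩ := h
  obtain ⟨r, hr, hru⟩ := isUnit_iff_eq_C_of_isReduced.1 u.isUnit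
  refine ⟨c * r, mul_ne_zero hc hr.ne_zero, ?_⟩
  rw [← hu, map_mul, hmap, hru, map_C, map_mul, C_mul]
  ring

end Galois

section Fiber

variable {α F L : Type*} [Field F] [Field L] [Fintype α] [Algebra F L] [IsGalois F L]

variable (F) in
theorem pow_mem_galFinset {z w : α → L} (K : ℕ) (hw : w ∈ galFinset F z) :
    w ^ K ∈ galFinset F (z ^ K) := by
  obtain ⟨g, rfl⟩ := mem_galFinset.1 hw
  exact mem_galFinset.2 ⟨g, by funext a; simp⟩

variable (F) in
open Classical in
/-- The fibres of the power map between Galois orbits have constant cardinality. -/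
theorem exists_card_fiber_pow (z : α → L) (K : ℕ) :
    ∃ δ : ℕ, 0 < δ ∧ ∀ w' ∈ galFinset F (z ^ K),
      ((galFinset F z).filter fun w => w ^ K = w').card = δ := by
  refine ⟨((galFinset F z).filter fun w => w ^ K = z ^ K).card, ?_, ?_⟩
  · rw [Finset.card_pos]
    exact ⟨z, Finset.mem_filter.2 ⟨self_mem_galFinset z, rfl⟩⟩
  · intro w' hw'
    obtain ⟨g, rfl⟩ := mem_galFinset.1 hw'
    symm
    refine Finset.card_bij (fun w _ a => g (w a)) ?_ ?_ ?_
    · intro w hw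
      rw [Finset.mem_filter] at hw ⊢
      obtain ⟨hw1, hw2⟩ := hw
      obtain ⟨h, rfl⟩ := mem_galFinset.1 hw1
      refine ⟨mem_galFinset.2 ⟨h.trans g, rfl⟩, ?_⟩
      funext a
      rw [← hw2]
      simp
    · intro w _ w' _ h
      funext a
      exact g.injective (congrFun h a)
    · intro w hw
      rw [Finset.mem_filter] at hw
      obtain ⟨hw1, hw2⟩ := hw
      obtain ⟨h, rfl⟩ := mem_galFinset.1 hw1
      refine ⟨fun a => g.symm (h (z a)), ?_, by simp⟩
      rw [Finset.mem_filter]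
      refine ⟨mem_galFinset.2 ⟨h.trans g.symm, rfl⟩, ?_⟩
      funext a
      have := congrFun hw2 a
      simp only [Pi.pow_apply] at this ⊢
      rw [← map_pow, this, g.symm_apply_apply]

theorem prod_pow_galFinset {z : α → L} {K δ : ℕ} {M : Type*} [CommMonoid M] [DecidableEq (α → L)]
    (hδ : ∀ w' ∈ galFinset F (z ^ K),
      ((galFinset F z).filter fun w => w ^ K = w').card = δ) (h : (α → L) → M) :
    ∏ w ∈ galFinset F z, h (w ^ K) = (∏ w' ∈ galFinset F (z ^ K), h w') ^ δ := by
  rw [← Finset.prod_fiberwise_of_maps_to (t := galFinset F (z ^ K)) (g := fun w => w ^ K)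
    fun w hw => pow_mem_galFinset F K hw, ← Finset.prod_pow]
  refine Finset.prod_congr rfl fun w' hw' => ?_
  rw [← hδ w' hw', ← Finset.prod_const]
  refine Finset.prod_congr rfl fun w hw => ?_
  rw [(Finset.mem_filter.1 hw).2]

theorem card_galFinset_eq {z : α → L} {K δ : ℕ} [DecidableEq (α → L)]
    (hδ : ∀ w' ∈ galFinset F (z ^ K),
      ((galFinset F z).filter fun w => w ^ K = w').card = δ) :
    (galFinset F z).card = δ * (galFinset F (z ^ K)).card := by
  rw [Finset.card_eq_sum_card_fiberwise (t := galFinset F (z ^ K)) (f := fun w => w ^ K)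
    fun w hw => pow_mem_galFinset F K hw, Finset.sum_congr rfl hδ, Finset.sum_const, smul_eq_mul,
    mul_comm]

end Fiber

end

section

section PrimeValuation

/-- A prime of a domain is detected by a valuation ring of any field containing the domain. -/
theorem exists_valuationSubring_of_prime {B L : Type*} [CommRing B] [IsDomain B] [Field L]
    (f : B →+* L) (hf : Function.Injective f) {π : B} (hπ : Prime π) :
    ∃ O : ValuationSubring L, (∀ b, O.valuation (f b) ≤ 1) ∧
      ∀ b, O.valuation (f b) < 1 ↔ π ∣ b := by
  have hP : (Ideal.span {π}).IsPrime := (Ideal.span_singleton_prime hπ.ne_zero).2 hπ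
  let R := Localization.AtPrime (Ideal.span {π})
  have hu : ∀ y : (Ideal.span {π}).primeCompl, IsUnit (f y) := fun y => by
    rw [isUnit_iff_ne_zero, Ne, map_eq_zero_iff _ hf]
    intro h
    exact y.2 (by rw [h]; exact Ideal.zero_mem _)
  let g : R →+* L := IsLocalization.lift hu
  have hg : ∀ b, g (algebraMap B R b) = f b := fun b => IsLocalization.lift_eq hu b
  obtain ⟨O, h, hloc⟩ := IsLocalRing.exists_factor_valuationRing g
  have hO : ∀ b, f b ∈ O := fun b => by rw [← hg]; exact h _
  refine ⟨O, fun b => (O.valuation_le_one_iff _).2 (hO b), fun b => ?_⟩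
  have h1 : O.valuation (f b) < 1 ↔ ¬ IsUnit (⟨f b, hO b⟩ : O) := by
    have := O.valuation_lt_one_iff ⟨f b, hO b⟩
    rw [← this, IsLocalRing.mem_maximalIdeal, mem_nonunits_iff]
  have h2 : IsUnit (⟨f b, hO b⟩ : O) ↔ IsUnit (algebraMap B R b) := by
    constructor
    · intro hb
      apply hloc.map_nonunit
      have he : g.codRestrict O.toSubring h (algebraMap B R b) = (⟨f b, hO b⟩ : O) :=
        Subtype.ext (hg b)
      rwa [he]
    · intro hb
      have := hb.map (g.codRestrict O.toSubring h)
      have he : g.codRestrict O.toSubring h (algebraMap B R b) = (⟨f b, hO b⟩ : O) :=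
        Subtype.ext (hg b)
      rwa [he] at this
  rw [h1, h2, IsLocalization.AtPrime.isUnit_to_map_iff R (Ideal.span {π})]
  simp [Ideal.primeCompl, Ideal.mem_span_singleton]

theorem associated_of_valuation_eq {B : Type*} [CommRing B] [IsDomain B]
    [UniqueFactorizationMonoid B] {L : Type*} [Field L] (f : B →+* L)
    (hf : Function.Injective f) {x y : B} (hx : x ≠ 0) (hy : y ≠ 0)
    (h : ∀ (O : ValuationSubring L) (π : B), Prime π → (∀ b, O.valuation (f b) ≤ 1) →
      (∀ b, O.valuation (f b) < 1 ↔ π ∣ b) → O.valuation (f x) = O.valuation (f y)) :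
    Associated x y := by
  obtain ⟨x', y', c', hrel, hx', hy'⟩ := UniqueFactorizationMonoid.exists_reduced_factors x hx y
  have hc : c' ≠ 0 := by rintro rfl; simp at hx'; exact hx hx'.symm
  have key : ∀ π, Prime π → (π ∣ x' ↔ π ∣ y') := by
    intro π hπ
    obtain ⟨O, h1, h2⟩ := exists_valuationSubring_of_prime f hf hπ
    have h3 := h O π hπ h1 h2
    rw [← hx', ← hy', map_mul, map_mul, map_mul, map_mul] at h3
    have hc0 : O.valuation (f c') ≠ 0 := by
      rw [Ne, map_eq_zero, map_eq_zero_iff _ hf]; exact hc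
    have h4 := mul_left_cancel₀ hc0 h3
    rw [← h2, ← h2, h4]
  have hx0 : x' ≠ 0 := by rintro rfl; simp at hx'; exact hx hx'.symm
  have hy0 : y' ≠ 0 := by rintro rfl; simp at hy'; exact hy hy'.symm
  have unit_of : ∀ t : B, t ≠ 0 → (∀ π, Prime π → π ∣ t → π ∣ x' ∧ π ∣ y') → IsUnit t := by
    intro t ht hh
    by_contra hnu
    obtain ⟨π, hπ, hd⟩ := WfDvdMonoid.exists_irreducible_factor hnu ht
    have hp := UniqueFactorizationMonoid.irreducible_iff_prime.1 hπ
    obtain ⟨ha, hb⟩ := hh π hp hd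
    exact hπ.not_isUnit (hrel ha hb)
  have hxu : IsUnit x' := unit_of x' hx0 fun π hπ hd => ⟨hd, (key π hπ).1 hd⟩
  have hyu : IsUnit y' := unit_of y' hy0 fun π hπ hd => ⟨(key π hπ).2 hd, hd⟩
  rw [← hx', ← hy']
  exact (associated_mul_unit_left c' x' hxu).trans (associated_mul_unit_left c' y' hyu).symm

end PrimeValuation

section Gauss

open MvPolynomial

variable {α L : Type*} [Field L]

/-- A polynomial is primitive at a valuation ring if its coefficients are integral and one of them
is a unit. -/
def PrimitiveAt (O : ValuationSubring L) (P : MvPolynomial α L) : Prop :=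
  (∀ m, O.valuation (coeff m P) ≤ 1) ∧ ∃ m, O.valuation (coeff m P) = 1

theorem primitiveAt_iff (O : ValuationSubring L) (P : MvPolynomial α L) :
    PrimitiveAt O P ↔ ∃ Q : MvPolynomial α O, map O.subtype Q = P ∧
      map (IsLocalRing.residue O) Q ≠ 0 := by
  have key : ∀ x : O, O.valuation (x : L) = 1 ↔ IsLocalRing.residue O x ≠ 0 := by
    intro x
    rw [IsLocalRing.residue_ne_zero_iff_isUnit, O.valuation_eq_one_iff]
  constructor
  · rintro ⟨h1, m, hm⟩
    obtain ⟨Q, rfl⟩ : P ∈ Set.range (map (σ := α) O.subtype) := by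
      rw [mem_range_map_iff_coeffs_subset]
      intro x hx
      rw [Finset.mem_coe, mem_coeffs_iff] at hx
      obtain ⟨m, -, rfl⟩ := hx
      exact ⟨⟨_, (O.valuation_le_one_iff _).1 (h1 m)⟩, rfl⟩
    refine ⟨Q, rfl, fun h => ?_⟩
    rw [coeff_map] at hm
    apply (key _).1 hm
    rw [← coeff_map, h, coeff_zero]
  · rintro ⟨Q, rfl, h⟩
    obtain ⟨m, hm⟩ := ne_zero_iff.1 h
    rw [coeff_map] at hm
    refine ⟨fun m => ?_, m, ?_⟩
    · rw [coeff_map]; exact O.valuation_le_one _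
    · rw [coeff_map]; exact (key _).2 hm

theorem PrimitiveAt.mul {O : ValuationSubring L} {P P' : MvPolynomial α L}
    (h : PrimitiveAt O P) (h' : PrimitiveAt O P') : PrimitiveAt O (P * P') := by
  rw [primitiveAt_iff] at *
  obtain ⟨Q, rfl, hQ⟩ := h
  obtain ⟨Q', rfl, hQ'⟩ := h'
  exact ⟨Q * Q', by rw [map_mul], by rw [map_mul]; exact mul_ne_zero hQ hQ'⟩

theorem PrimitiveAt.one (O : ValuationSubring L) : PrimitiveAt O (1 : MvPolynomial α L) :=
  (primitiveAt_iff _ _).2 ⟨1, by simp, by simp⟩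

theorem PrimitiveAt.prod {O : ValuationSubring L} {κ : Type*} (s : Finset κ)
    (P : κ → MvPolynomial α L) (h : ∀ k ∈ s, PrimitiveAt O (P k)) :
    PrimitiveAt O (∏ k ∈ s, P k) := by
  classical
  induction s using Finset.induction_on with
  | empty => simpa using PrimitiveAt.one O
  | insert k s hk ih =>
    rw [Finset.prod_insert hk]
    exact (h k (by simp)).mul (ih fun k hk => h k (by simp [hk]))

theorem PrimitiveAt.valuation_eq_one {O : ValuationSubring L} {P : MvPolynomial α L} {x : L}
    (h : PrimitiveAt O P) (h' : PrimitiveAt O (C x * P)) : O.valuation x = 1 := by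
  obtain ⟨h1, m, hm⟩ := h
  obtain ⟨h2, m', hm'⟩ := h'
  simp only [coeff_C_mul, map_mul] at h2 hm'
  apply le_antisymm
  · have := h2 m
    rwa [hm, mul_one] at this
  · rw [← hm']
    exact mul_le_of_le_one_right' (h1 m')

variable [Fintype α]

theorem primitiveAt_linForm {O : ValuationSubring L} {w : α → L} {a : α} (ha : w a ≠ 0)
    (hmax : ∀ b, O.valuation (w b) ≤ O.valuation (w a)) :
    ∃ P, PrimitiveAt O P ∧ linForm w = C (w a) * P := by
  classical
  have hcoeff : ∀ (z : α → L) m, coeff m (linForm z) = ∑ b, if Finsupp.single b 1 = m then z b else 0 := by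
    intro z m
    simp [linForm, coeff_sum, coeff_C_mul, coeff_X]
  have hcs : ∀ (z : α → L) b, coeff (Finsupp.single b 1) (linForm z) = z b := by
    intro z b
    rw [hcoeff]
    simp [Finsupp.single_left_inj]
  refine ⟨linForm fun b => w b / w a, ⟨fun m => ?_, Finsupp.single a 1, ?_⟩, ?_⟩
  · by_cases hm : ∃ b, Finsupp.single b 1 = m
    · obtain ⟨b, rfl⟩ := hm
      rw [hcs, map_div₀]
      exact div_le_one_of_le₀ (hmax b) zero_le
    · push Not at hm
      rw [hcoeff]
      simp [hm]
  · rw [hcs, div_self ha, map_one]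
  · rw [linForm, linForm, Finset.mul_sum]
    refine Finset.sum_congr rfl fun b _ => ?_
    rw [← mul_assoc, ← C_mul, mul_div_cancel₀ _ ha]

end Gauss

section Main

open MvPolynomial

variable {α B F L : Type*} [Fintype α] [CommRing B] [IsDomain B]
  [Field F] [Field L] [Algebra B F] [IsFractionRing B F]
  [Algebra F L] [Algebra B L] [IsScalarTower B F L] [IsGalois F L] [UniqueFactorizationMonoid B]

variable (F) in
/-- Comparison of the leading coefficients of the eliminants of `z` and `z ^ K`. -/
theorem associated_pow_of_map_eq [DecidableEq (α → L)] {z : α → L} {a₀ : α} (hz : z a₀ = 1) {K δ : ℕ}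
    (hδ : ∀ w' ∈ galFinset F (z ^ K),
      ((galFinset F z).filter fun w => w ^ K = w').card = δ)
    {E E' : MvPolynomial α B} (hE : Irreducible E) (hE' : Irreducible E') {c c' : B}
    (hc : c ≠ 0) (hc' : c' ≠ 0)
    (h : map (algebraMap B L) E = C (algebraMap B L c) * ∏ w ∈ galFinset F z, linForm w)
    (h' : map (algebraMap B L) E' =
      C (algebraMap B L c') * ∏ w ∈ galFinset F (z ^ K), linForm w) :
    Associated (c ^ K) (c' ^ δ) := by
  have hinj : Function.Injective (algebraMap B L) := by
    rw [IsScalarTower.algebraMap_eq B F L]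
    exact (algebraMap F L).injective.comp (IsFractionRing.injective B F)
  have hzK : (z ^ K) a₀ = 1 := by simp [hz]
  refine associated_of_valuation_eq (algebraMap B L) hinj (pow_ne_zero _ hc) (pow_ne_zero _ hc')
    fun O π hπ hO hOπ => ?_
  have : Nonempty α := ⟨a₀⟩
  choose s hs using fun w : α → L => Finite.exists_max fun a => O.valuation (w a)
  have hs0 : ∀ w : α → L, w a₀ = 1 → w (s w) ≠ 0 := by
    intro w hw h0
    have := hs w a₀
    rw [h0, hw, map_zero, map_one] at this
    exact not_lt_of_ge this zero_lt_one
  have key : ∀ (y : α → L) (G : MvPolynomial α B) (x : B), y a₀ = 1 → Irreducible G →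
      map (algebraMap B L) G = C (algebraMap B L x) * ∏ w ∈ galFinset F y, linForm w →
      O.valuation (algebraMap B L x) * ∏ w ∈ galFinset F y, O.valuation (w (s w)) = 1 := by
    intro y G x hy hG hGx
    choose! P hP hlin using fun (w : α → L) (hw : w a₀ = 1) =>
      primitiveAt_linForm (hs0 w hw) (hs w)
    have hprim : PrimitiveAt O (∏ w ∈ galFinset F y, P w) :=
      PrimitiveAt.prod _ _ fun w hw => hP w (galFinset_apply_eq_one hy hw)
    have hGe : map (algebraMap B L) G =
        C (algebraMap B L x * ∏ w ∈ galFinset F y, w (s w)) * ∏ w ∈ galFinset F y, P w := by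
      rw [hGx, C_mul, map_prod, mul_assoc, ← Finset.prod_mul_distrib]
      congr 1
      exact Finset.prod_congr rfl fun w hw => hlin w (galFinset_apply_eq_one hy hw)
    have hGprim : PrimitiveAt O (map (algebraMap B L) G) := by
      refine ⟨fun m => by rw [coeff_map]; exact hO _, ?_⟩
      by_contra hcon
      push Not at hcon
      have hdvd : C π ∣ G := by
        rw [C_dvd_iff_dvd_coeff]
        intro m
        rw [← hOπ]
        have := hcon m
        rw [coeff_map] at this
        exact lt_of_le_of_ne (hO _) this
      obtain ⟨G', rfl⟩ := hdvd
      rcases hG.isUnit_or_isUnit rfl with hu | hu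
      · refine hπ.not_isUnit ?_
        obtain ⟨r, hr, hru⟩ := isUnit_iff_eq_C_of_isReduced.1 hu
        rwa [C_injective _ _ hru]
      · obtain ⟨r, hr, rfl⟩ := isUnit_iff_eq_C_of_isReduced.1 hu
        rw [← C_mul, map_C] at hGx
        have hne : algebraMap B L (π * r) ≠ 0 := by
          rw [Ne, map_eq_zero_iff _ hinj]
          exact mul_ne_zero hπ.ne_zero hr.ne_zero
        refine linForm_not_dvd_C hy hne ?_
        rw [hGx]
        exact (Finset.dvd_prod_of_mem _ (self_mem_galFinset y)).mul_left _
    have := hprim.valuation_eq_one (hGe ▸ hGprim)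
    rwa [map_mul, map_prod] at this
  have k1 := key z E c hz hE h
  have k2 := key (z ^ K) E' c' hzK hE' h'
  have hpow : ∀ w : α → L, O.valuation (w (s w)) ^ K = O.valuation ((w ^ K) (s (w ^ K))) := by
    intro w
    apply le_antisymm
    · have := hs (w ^ K) (s w)
      simpa using this
    · rw [Pi.pow_apply, map_pow]
      exact pow_le_pow_left' (hs w _) K
  have hM : (∏ w ∈ galFinset F z, O.valuation (w (s w))) ^ K =
      (∏ w ∈ galFinset F (z ^ K), O.valuation (w (s w))) ^ δ := by
    rw [← prod_pow_galFinset hδ fun w => O.valuation (w (s w)), ← Finset.prod_pow]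
    exact Finset.prod_congr rfl fun w _ => hpow w
  have e1 := congrArg (· ^ K) k1
  have e2 := congrArg (· ^ δ) k2
  simp only [mul_pow, one_pow] at e1 e2
  rw [hM] at e1
  have hM0 : (∏ w ∈ galFinset F (z ^ K), O.valuation (w (s w))) ^ δ ≠ 0 := right_ne_zero_of_mul_eq_one e1
  rw [map_pow, map_pow, map_pow, map_pow]
  exact mul_right_cancel₀ hM0 (e1.trans e2.symm)

end Main

end

section

section Slot

open MvPolynomial

variable {α B F L : Type*} [Fintype α] [CommRing B] [IsDomain B]
  [Field F] [Field L] [Algebra B F] [IsFractionRing B F]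
  [Algebra F L] [Algebra B L] [IsScalarTower B F L] [IsGalois F L]

theorem eval₂_eq_of_map_eq {E : MvPolynomial α B} {c : B} {Z : Finset (α → L)}
    (h : map (algebraMap B L) E = C (algebraMap B L c) * ∏ w ∈ Z, linForm w)
    (φ : L →+* ℂ) (u : α → ℂ) :
    eval₂ (φ.comp (algebraMap B L)) u E =
      φ (algebraMap B L c) * ∏ w ∈ Z, ∑ a, φ (w a) * u a := by
  rw [← eval₂_map, h, eval₂_mul, eval₂_C, eval₂_prod]
  simp only [eval₂_linForm]

theorem eval₂_smul_of_map_eq {E : MvPolynomial α B} {c : B} {Z : Finset (α → L)}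
    (h : map (algebraMap B L) E = C (algebraMap B L c) * ∏ w ∈ Z, linForm w)
    (φ : L →+* ℂ) (u : α → ℂ) (r : ℂ) :
    eval₂ (φ.comp (algebraMap B L)) (r • u) E =
      r ^ Z.card * eval₂ (φ.comp (algebraMap B L)) u E := by
  rw [eval₂_eq_of_map_eq h, eval₂_eq_of_map_eq h]
  have : ∀ w : α → L, ∑ a, φ (w a) * (r • u) a = r * ∑ a, φ (w a) * u a := by
    intro w
    rw [Finset.mul_sum]
    refine Finset.sum_congr rfl fun a _ => ?_
    simp only [Pi.smul_apply, smul_eq_mul]; ring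
  simp only [this, Finset.prod_mul_distrib, Finset.prod_const]
  ring

variable [Nonempty α]

theorem norm_eval₂_le_of_map_eq {E : MvPolynomial α B} {c : B} {Z : Finset (α → L)}
    (h : map (algebraMap B L) E = C (algebraMap B L c) * ∏ w ∈ Z, linForm w)
    (φ : L →+* ℂ) (u : α → ℂ) (hu : ∀ a, ‖u a‖ ≤ 1) :
    ‖eval₂ (φ.comp (algebraMap B L)) u E‖ ≤ (Fintype.card α : ℝ) ^ Z.card *
      (‖φ (algebraMap B L c)‖ * ∏ w ∈ Z, maxNorm fun a => φ (w a)) := by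
  rw [eval₂_eq_of_map_eq h, norm_mul, mul_left_comm]
  gcongr
  exact norm_prod_linear_le _ _ _ hu

theorem exists_le_norm_eval₂_of_map_eq {E : MvPolynomial α B} {c : B} {Z : Finset (α → L)}
    (h : map (algebraMap B L) E = C (algebraMap B L c) * ∏ w ∈ Z, linForm w)
    (φ : L →+* ℂ) : ∃ u : α → ℂ, (∀ a, ‖u a‖ ≤ 1) ∧
      ‖φ (algebraMap B L c)‖ * ∏ w ∈ Z, maxNorm (fun a => φ (w a)) ≤
        ((2 : ℝ) ^ Fintype.card α) ^ Z.card * ‖eval₂ (φ.comp (algebraMap B L)) u E‖ := by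
  obtain ⟨u, hu, hle⟩ := exists_prod_maxNorm_le Z fun w a => φ (w a)
  refine ⟨u, hu, ?_⟩
  rw [eval₂_eq_of_map_eq h, norm_mul, mul_left_comm]
  gcongr

end Slot

open MvPolynomial in
/-- Comparison of the eliminants of the hyperplanes `z` and `z ^ K` on polydiscs. -/
theorem exists_norm_eval₂_comparison {α B : Type*} (F : Type*) {L : Type*} [Fintype α] [Nonempty α]
    [CommRing B] [IsDomain B] [UniqueFactorizationMonoid B]
    [Field F] [Field L] [Algebra B F] [IsFractionRing B F]
    [Algebra F L] [Algebra B L] [IsScalarTower B F L] [IsGalois F L] {z : α → L} {a₀ : α} (hz : z a₀ = 1) (K : ℕ)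
    {E E' : MvPolynomial α B} (hE : Irreducible E) (hE' : Irreducible E')
    (h : ∀ P, E ∣ P ↔ linForm z ∣ map (algebraMap B L) P)
    (h' : ∀ P, E' ∣ P ↔ linForm (z ^ K) ∣ map (algebraMap B L) P) :
    ∃ δ D D' : ℕ, 0 < δ ∧ D = δ * D' ∧
      ∀ φ : L →+* ℂ, (∀ b : B, IsUnit b → ‖φ (algebraMap B L b)‖ = 1) →
        (∀ u r, eval₂ (φ.comp (algebraMap B L)) (r • u) E =
          r ^ D * eval₂ (φ.comp (algebraMap B L)) u E) ∧
        (∀ u r, eval₂ (φ.comp (algebraMap B L)) (r • u) E' =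
          r ^ D' * eval₂ (φ.comp (algebraMap B L)) u E') ∧
        (∀ u : α → ℂ, (∀ a, ‖u a‖ ≤ 1) → ∃ u' : α → ℂ, (∀ a, ‖u' a‖ ≤ 1) ∧
          ‖eval₂ (φ.comp (algebraMap B L)) u E‖ ^ K ≤
            (Fintype.card α : ℝ) ^ (K * D) * (2 ^ Fintype.card α) ^ D *
              ‖eval₂ (φ.comp (algebraMap B L)) u' E'‖ ^ δ) ∧
        (∀ u : α → ℂ, (∀ a, ‖u a‖ ≤ 1) → ∃ u' : α → ℂ, (∀ a, ‖u' a‖ ≤ 1) ∧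
          ‖eval₂ (φ.comp (algebraMap B L)) u E'‖ ^ δ ≤
            (Fintype.card α : ℝ) ^ D * (2 ^ Fintype.card α) ^ (K * D) *
              ‖eval₂ (φ.comp (algebraMap B L)) u' E‖ ^ K) := by
  classical
  have hzK : (z ^ K) a₀ = 1 := by simp [hz]
  obtain ⟨δ, hδ0, hδ⟩ := exists_card_fiber_pow F z K
  have hδ' : ∀ w' ∈ galFinset F (z ^ K),
      ((galFinset F z).filter fun w => w ^ K = w').card = δ := by
    intro w' hw'
    rw [← hδ w' hw']
  obtain ⟨c, hc, hcE⟩ := map_eq_C_mul_prod_of_dvd_iff F hz h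
  obtain ⟨c', hc', hcE'⟩ := map_eq_C_mul_prod_of_dvd_iff F hzK h'
  have hD := card_galFinset_eq hδ'
  refine ⟨δ, _, _, hδ0, hD, fun φ hφ => ?_⟩
  obtain ⟨v, hv⟩ := associated_pow_of_map_eq F hz hδ' hE hE' hc hc' hcE hcE'
  have hN : (‖φ (algebraMap B L c)‖ * ∏ w ∈ galFinset F z, maxNorm fun a => φ (w a)) ^ K =
      (‖φ (algebraMap B L c')‖ * ∏ w ∈ galFinset F (z ^ K), maxNorm fun a => φ (w a)) ^ δ := by
    rw [mul_pow, mul_pow, ← prod_pow_galFinset hδ' fun w => maxNorm fun a => φ (w a),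
      ← Finset.prod_pow, ← norm_pow, ← norm_pow, ← map_pow, ← map_pow, ← map_pow, ← map_pow, ← hv,
      map_mul, map_mul, norm_mul, hφ _ v.isUnit, mul_one]
    congr 1
    refine Finset.prod_congr rfl fun w _ => ?_
    rw [← maxNorm_pow]
    congr 1
    funext a
    simp
  refine ⟨fun u r => eval₂_smul_of_map_eq hcE φ u r, fun u r => eval₂_smul_of_map_eq hcE' φ u r,
    fun u hu => ?_, fun u hu => ?_⟩
  · obtain ⟨u', hu', hle⟩ := exists_le_norm_eval₂_of_map_eq hcE' φ
    refine ⟨u', hu', ?_⟩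
    calc _ ≤ _ := pow_le_pow_left₀ (norm_nonneg _) (norm_eval₂_le_of_map_eq hcE φ u hu) K
      _ = _ := by rw [mul_pow, hN]
      _ ≤ _ := mul_le_mul_of_nonneg_left (pow_le_pow_left₀ (mul_nonneg (norm_nonneg _)
            (Finset.prod_nonneg fun _ _ => maxNorm_nonneg _)) hle δ) (by positivity)
      _ = _ := by rw [hD]; ring
  · obtain ⟨u', hu', hle⟩ := exists_le_norm_eval₂_of_map_eq hcE φ
    refine ⟨u', hu', ?_⟩
    calc _ ≤ _ := pow_le_pow_left₀ (norm_nonneg _) (norm_eval₂_le_of_map_eq hcE' φ u hu) δ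
      _ = _ := by rw [mul_pow, ← hN]
      _ ≤ _ := mul_le_mul_of_nonneg_left (pow_le_pow_left₀ (mul_nonneg (norm_nonneg _)
            (Finset.prod_nonneg fun _ _ => maxNorm_nonneg _)) hle K) (by positivity)
      _ = _ := by rw [hD]; ring

end

section

section Generic

open MvPolynomial

/-- A tuple of elements of a field of characteristic zero is generic if no nonzero polynomial
with integer coefficients vanishes at it. -/
def IsGeneric {τ 𝕜 : Type*} [CommRing 𝕜] (w : τ → 𝕜) : Prop :=
  ∀ P : MvPolynomial τ ℤ, aeval w P = 0 → P = 0

theorem exists_mem_eval_ne_zero {τ 𝕜 : Type*} [Finite τ] [NontriviallyNormedField 𝕜]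
    {P : MvPolynomial τ 𝕜} (hP : P ≠ 0) {U : Set (τ → 𝕜)} (hU : IsOpen U) (hne : U.Nonempty) :
    ∃ w ∈ U, eval w P ≠ 0 := by
  have := Fintype.ofFinite τ
  obtain ⟨w, hw⟩ := hne
  obtain ⟨ε, hε, hball⟩ := Metric.isOpen_iff.1 hU w hw
  by_contra! hcon
  refine hP (MvPolynomial.funext_set (fun s => Metric.ball (w s) ε) (fun s => ?_) fun x hx => ?_)
  · exact infinite_of_mem_nhds (w s) (Metric.ball_mem_nhds _ hε)
  · rw [map_zero]
    refine hcon x (hball ?_)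
    rw [← ball_pi _ hε] at hx
    exact hx

theorem dense_isGeneric (τ 𝕜 : Type*) [Finite τ] [NontriviallyNormedField 𝕜] [CompleteSpace 𝕜]
    [CharZero 𝕜] : Dense {w : τ → 𝕜 | IsGeneric w} := by
  have := Fintype.ofFinite τ
  have hc : Countable (MvPolynomial τ ℤ) := by
    rw [← Cardinal.mk_le_aleph0_iff]
    exact MvPolynomial.cardinalMk_le_max_lift.trans (by simp)
  have heq : {w : τ → 𝕜 | IsGeneric w} =
      ⋂ P : {P : MvPolynomial τ ℤ // P ≠ 0}, {w : τ → 𝕜 | aeval w P.1 ≠ 0} := by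
    ext w
    simp only [Set.mem_ofPred_eq, IsGeneric, Set.mem_iInter, Subtype.forall]
    exact forall_congr' fun P => ⟨fun h h' h'' => h' (h h''), fun h h' => by_contra fun h'' => h h'' h'⟩
  rw [heq]
  have haeval : ∀ (P : MvPolynomial τ ℤ) (w : τ → 𝕜),
      aeval w P = eval w (map (Int.castRingHom 𝕜) P) := by
    intro P w
    rw [eval_map, aeval_def]; rfl
  refine dense_iInter_of_isOpen (fun P => ?_) fun P => ?_
  · apply IsOpen.preimage _ isOpen_compl_singleton
    simp only [haeval]
    exact MvPolynomial.continuous_eval _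
  · rw [dense_iff_inter_open]
    intro U hU hne
    have : map (Int.castRingHom 𝕜) P.1 ≠ 0 := by
      rw [Ne, map_eq_zero_iff _ (map_injective _ (RingHom.injective_int _))]
      exact P.2
    obtain ⟨w, hw, h⟩ := exists_mem_eval_ne_zero this hU hne
    exact ⟨w, hw, by simpa [haeval] using h⟩

end Generic

section Polydisc

open MvPolynomial

variable {σ : Type*} [Fintype σ]

theorem continuous_aeval_int {σ : Type*} (P : MvPolynomial σ ℤ) : Continuous fun u : σ → ℂ => aeval u P := by
  have : (fun u : σ → ℂ => aeval u P) = fun u => eval u (map (Int.castRingHom ℂ) P) := by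
    funext u
    rw [eval_map, aeval_def]; rfl
  rw [this]
  exact MvPolynomial.continuous_eval _

/-- The supremum of `‖P‖` on the polydisc of polyradius `r`. -/
noncomputable def polydiscNorm (r : σ → ℝ) (P : MvPolynomial σ ℤ) : ℝ :=
  sSup ((fun u : σ → ℂ => ‖aeval u P‖) '' {u | ∀ s, ‖u s‖ ≤ r s})

theorem isCompact_polydisc (r : σ → ℝ) : IsCompact {u : σ → ℂ | ∀ s, ‖u s‖ ≤ r s} := by
  have : {u : σ → ℂ | ∀ s, ‖u s‖ ≤ r s} = Set.pi Set.univ fun s => Metric.closedBall 0 (r s) := by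
    ext u; simp
  rw [this]
  exact isCompact_univ_pi fun s => isCompact_closedBall _ _

theorem norm_aeval_le_polydiscNorm {r : σ → ℝ} (P : MvPolynomial σ ℤ) {u : σ → ℂ}
    (hu : ∀ s, ‖u s‖ ≤ r s) : ‖aeval u P‖ ≤ polydiscNorm r P :=
  le_csSup ((isCompact_polydisc r).image (continuous_aeval_int P).norm).bddAbove ⟨u, hu, rfl⟩

theorem exists_polydiscNorm_eq {r : σ → ℝ} (hr : ∀ s, 0 ≤ r s) (P : MvPolynomial σ ℤ) :
    ∃ u : σ → ℂ, (∀ s, ‖u s‖ ≤ r s) ∧ polydiscNorm r P = ‖aeval u P‖ := by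
  have hne : ((fun u : σ → ℂ => ‖aeval u P‖) '' {u | ∀ s, ‖u s‖ ≤ r s}).Nonempty :=
    ⟨_, 0, by simpa using hr, rfl⟩
  obtain ⟨u, hu, h⟩ := ((isCompact_polydisc r).image (continuous_aeval_int P).norm).sSup_mem hne
  exact ⟨u, hu, h.symm⟩

theorem polydiscNorm_nonneg (r : σ → ℝ) (P : MvPolynomial σ ℤ) : 0 ≤ polydiscNorm r P :=
  Real.sSup_nonneg (by rintro _ ⟨u, -, rfl⟩; positivity)

theorem polydiscNorm_le {r : σ → ℝ} (hr : ∀ s, 0 ≤ r s) {P : MvPolynomial σ ℤ} {C : ℝ}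
    (h : ∀ u : σ → ℂ, (∀ s, ‖u s‖ ≤ r s) → ‖aeval u P‖ ≤ C) : polydiscNorm r P ≤ C := by
  obtain ⟨u, hu, he⟩ := exists_polydiscNorm_eq hr P
  rw [he]; exact h u hu

/-- Cauchy's inequality. -/
theorem natAbs_coeff_mul_le_polydiscNorm {r : σ → ℝ} (hr : ∀ s, 0 ≤ r s) (P : MvPolynomial σ ℤ)
    (m : σ →₀ ℕ) : ((coeff m P).natAbs : ℝ) * ∏ s, r s ^ m s ≤ polydiscNorm r P := by
  classical
  let N : ℕ := P.totalDegree + ∑ s, m s + 1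
  have hN : N ≠ 0 := by omega
  have hNC : (N : ℂ) ≠ 0 := by exact_mod_cast hN
  obtain ⟨ζ, hζ⟩ : ∃ ζ : ℂ, IsPrimitiveRoot ζ N := ⟨_, Complex.isPrimitiveRoot_exp N hN⟩
  have hζ0 : ζ ≠ 0 := hζ.ne_zero hN
  have hζn : ‖ζ‖ = 1 := hζ.norm'_eq_one hN
  have horth : ∀ a b : ℕ, a < N → b < N →
      ∑ k ∈ Finset.range N, (ζ ^ k) ^ a * (ζ⁻¹ ^ k) ^ b = if a = b then (N : ℂ) else 0 := by
    intro a b ha hb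
    have h1 : ∀ k, (ζ ^ k) ^ a * (ζ⁻¹ ^ k) ^ b = (ζ ^ a * ζ⁻¹ ^ b) ^ k := by
      intro k; rw [mul_pow]; ring
    simp only [h1]
    split_ifs with hab
    · subst hab
      rw [← mul_pow, mul_inv_cancel₀ hζ0]; simp
    · have hne : ζ ^ a * ζ⁻¹ ^ b ≠ 1 := by
        intro h
        rw [inv_pow, mul_inv_eq_one₀ (pow_ne_zero _ hζ0)] at h
        exact hab (hζ.pow_inj ha hb h)
      have h2 : (ζ ^ a * ζ⁻¹ ^ b) ^ N = 1 := by
        rw [mul_pow, ← pow_mul, ← pow_mul, mul_comm a, mul_comm b, pow_mul, pow_mul, hζ.pow_eq_one,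
          inv_pow, hζ.pow_eq_one]; simp
      have := geom_sum_mul (ζ ^ a * ζ⁻¹ ^ b) N
      rw [h2, sub_self] at this
      exact (mul_eq_zero.1 this).resolve_right (sub_ne_zero.2 hne)
  let J := Fintype.piFinset fun _ : σ => Finset.range N
  let u : (σ → ℕ) → σ → ℂ := fun k s => r s * ζ ^ k s
  have hsum : ∑ k ∈ J, aeval (u k) P * ∏ s, (ζ⁻¹ ^ k s) ^ m s =
      (N : ℂ) ^ Fintype.card σ * (((coeff m P : ℤ) : ℂ) * ∏ s, (r s : ℂ) ^ m s) := by
    have h1 : ∀ k, aeval (u k) P * ∏ s, (ζ⁻¹ ^ k s) ^ m s = ∑ m' ∈ P.support,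
        ((coeff m' P : ℤ) : ℂ) * (∏ s, (r s : ℂ) ^ m' s) *
          ∏ s, ((ζ ^ k s) ^ m' s * (ζ⁻¹ ^ k s) ^ m s) := by
      intro k
      rw [aeval_def, eval₂_eq', Finset.sum_mul]
      refine Finset.sum_congr rfl fun m' _ => ?_
      simp only [u, mul_pow, Finset.prod_mul_distrib]
      simp only [algebraMap_int_eq, eq_intCast]
      ring
    simp only [h1]
    rw [Finset.sum_comm]
    have h2 : ∀ m' ∈ P.support, ∑ k ∈ J, ((coeff m' P : ℤ) : ℂ) * (∏ s, (r s : ℂ) ^ m' s) *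
          ∏ s, ((ζ ^ k s) ^ m' s * (ζ⁻¹ ^ k s) ^ m s) =
        if m' = m then (N : ℂ) ^ Fintype.card σ * (((coeff m P : ℤ) : ℂ) * ∏ s, (r s : ℂ) ^ m s)
          else 0 := by
      intro m' hm'
      rw [← Finset.mul_sum]
      have h3 : ∑ k ∈ J, ∏ s, ((ζ ^ k s) ^ m' s * (ζ⁻¹ ^ k s) ^ m s) =
          ∏ s, if m' s = m s then (N : ℂ) else 0 := by
        rw [← Finset.prod_univ_sum (fun _ => Finset.range N)
          fun s k => ((ζ ^ k) ^ m' s * (ζ⁻¹ ^ k) ^ m s)]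
        refine Finset.prod_congr rfl fun s _ => horth _ _ ?_ ?_
        · have := le_totalDegree hm'
          have h4 : m' s ≤ m'.sum fun _ => id := by
            rw [Finsupp.sum_fintype _ _ (by simp)]
            exact Finset.single_le_sum (f := fun s => id (m' s)) (by simp) (Finset.mem_univ s)
          simp only [N]
          have h5 : (m'.sum fun _ => id) = m'.sum fun _ e => e := rfl
          omega
        · have h4 : m s ≤ ∑ s, m s := Finset.single_le_sum (f := fun s => m s) (by simp) (Finset.mem_univ s)
          simp only [N]; omega
      rw [h3]
      split_ifs with h
      · subst h
        simp; ring
      · obtain ⟨s, hs⟩ := DFunLike.ne_iff.1 h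
        have h4 : (∏ s, if m' s = m s then (N : ℂ) else 0) = 0 :=
          Finset.prod_eq_zero (Finset.mem_univ s) (by simp [hs])
        rw [h4, mul_zero]
    rw [Finset.sum_congr rfl h2, Finset.sum_ite_eq']
    split_ifs with h
    · rfl
    · rw [notMem_support_iff.1 h]; simp
  have hle : ‖∑ k ∈ J, aeval (u k) P * ∏ s, (ζ⁻¹ ^ k s) ^ m s‖ ≤
      (N : ℝ) ^ Fintype.card σ * polydiscNorm r P := by
    calc _ ≤ ∑ k ∈ J, ‖aeval (u k) P * ∏ s, (ζ⁻¹ ^ k s) ^ m s‖ := norm_sum_le _ _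
      _ ≤ ∑ k ∈ J, polydiscNorm r P := by
        refine Finset.sum_le_sum fun k _ => ?_
        rw [norm_mul, norm_prod]
        simp only [norm_pow, norm_inv, hζn, inv_one, one_pow, Finset.prod_const_one, mul_one]
        apply norm_aeval_le_polydiscNorm
        intro s
        simp only [u, norm_mul, norm_pow, hζn, one_pow, mul_one, Complex.norm_real]
        exact (abs_of_nonneg (hr s)).le
      _ = _ := by
        simp [J, Fintype.card_piFinset]
  rw [hsum, norm_mul] at hle
  have hNp : (0 : ℝ) < (N : ℝ) ^ Fintype.card σ := by positivity
  have hn1 : ‖(N : ℂ) ^ Fintype.card σ‖ = (N : ℝ) ^ Fintype.card σ := by simp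
  rw [hn1] at hle
  have := le_of_mul_le_mul_left hle hNp
  refine le_trans (le_of_eq ?_) this
  rw [norm_mul, norm_prod, Complex.norm_intCast, Nat.cast_natAbs, Int.cast_abs]
  congr 1
  refine Finset.prod_congr rfl fun s _ => ?_
  rw [norm_pow, Complex.norm_real, Real.norm_of_nonneg (hr s)]

end Polydisc

end

section

section Transcendence

open MvPolynomial

variable {τ Y 𝕂 : Type*} [Field 𝕂] [CharZero 𝕂]

theorem IsGeneric.algebraicIndependent {x : τ → 𝕂} (hx : IsGeneric x) :
    AlgebraicIndependent ℤ x :=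
  algebraicIndependent_iff.2 hx

/-- If `card τ` generic elements are algebraic over at most `card τ` elements, then both families
have the same algebraic closure. -/
theorem IsGeneric.isAlgebraic_adjoin_iff [Fintype τ] [Fintype Y] {x : τ → 𝕂} {y : Y → 𝕂}
    (hx : IsGeneric x) (hcard : Fintype.card Y ≤ Fintype.card τ)
    (h : ∀ s, IsAlgebraic (Algebra.adjoin ℤ (Set.range y)) (x s)) (t : 𝕂) :
    IsAlgebraic (Algebra.adjoin ℤ (Set.range x)) t ↔
      IsAlgebraic (Algebra.adjoin ℤ (Set.range y)) t := by
  let M := AlgebraicIndependent.matroid ℤ 𝕂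
  have hcl : ∀ (S : Set 𝕂) (t : 𝕂), t ∈ M.closure S ↔ IsAlgebraic (Algebra.adjoin ℤ S) t := by
    intro S t
    rw [AlgebraicIndependent.matroid_closure_eq]
    rfl
  have hI : M.Indep (Set.range x) :=
    AlgebraicIndependent.matroid_indep_iff.2 hx.algebraicIndependent.to_subtype_range
  have hsub : Set.range x ⊆ M.closure (Set.range y) := by
    rintro _ ⟨s, rfl⟩
    exact (hcl _ _).2 (h s)
  have hinj : Function.Injective x := hx.algebraicIndependent.injective
  have hrk : M.eRk (M.closure (Set.range y)) ≤ (Set.range x).encard := by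
    rw [M.eRk_closure_eq]
    refine (M.eRk_le_encard _).trans ?_
    rw [← Set.image_univ, ← Set.image_univ, hinj.encard_image]
    refine (Set.encard_image_le _ _).trans ?_
    rw [Set.encard_univ, Set.encard_univ, ENat.card_eq_coe_fintype_card, ENat.card_eq_coe_fintype_card]
    exact_mod_cast hcard
  have hB : M.IsBasis (Set.range x) (M.closure (Set.range y)) :=
    hI.isBasis_of_eRk_ge (Set.finite_range x) hsub (hrk.trans hI.eRk_eq_encard.ge)
  rw [← hcl, ← hcl, hB.closure_eq_closure, M.closure_closure]

theorem isAlgebraic_adjoin_zpow {S : Set 𝕂} {t : 𝕂} (h : IsAlgebraic (Algebra.adjoin ℤ S) t)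
    (k : ℤ) : IsAlgebraic (Algebra.adjoin ℤ S) (t ^ k) := by
  cases k with
  | ofNat k => simpa using h.pow k
  | negSucc k => rw [zpow_negSucc]; exact (h.pow _).inv

/-- A generic point of affine space extends to an embedding of the algebraic closure of the field of
rational functions. -/
theorem IsGeneric.exists_lift [IsAlgClosed 𝕂] {w : τ → 𝕂} (hw : IsGeneric w) :
    ∃ φ : AlgebraicClosure (FractionRing (MvPolynomial τ ℤ)) →+* 𝕂,
      (∀ b : MvPolynomial τ ℤ, φ (algebraMap _ _ b) = aeval w b) ∧
      ∀ t, IsAlgebraic (Algebra.adjoin ℤ (Set.range w)) t ↔ t ∈ Set.range φ := by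
  let B := MvPolynomial τ ℤ
  let F := FractionRing B
  let L := AlgebraicClosure F
  have hinj : Function.Injective (aeval (R := ℤ) w : B →ₐ[ℤ] 𝕂) :=
    (injective_iff_map_eq_zero _).2 hw
  let _ : Algebra B 𝕂 := (aeval (R := ℤ) w : B →ₐ[ℤ] 𝕂).toRingHom.toAlgebra
  let f : F →+* 𝕂 := IsFractionRing.lift (A := B) (g := (aeval (R := ℤ) w : B →ₐ[ℤ] 𝕂).toRingHom) hinj
  let _ : Algebra F 𝕂 := f.toAlgebra
  have hBF : ∀ b : B, algebraMap F 𝕂 (algebraMap B F b) = aeval w b := fun b =>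
    IsFractionRing.lift_algebraMap hinj b
  have : IsScalarTower B F 𝕂 := IsScalarTower.of_algebraMap_eq fun b => (hBF b).symm
  let φ : L →ₐ[F] 𝕂 := IsAlgClosed.lift
  have hφ : ∀ b : B, φ (algebraMap B L b) = aeval w b := by
    intro b
    rw [IsScalarTower.algebraMap_apply B F L, φ.commutes, hBF]
  refine ⟨φ, hφ, fun t => ?_⟩
  have hB : IsAlgebraic (Algebra.adjoin ℤ (Set.range w)) t ↔ IsAlgebraic B t := by
    have hmem : ∀ b : B, aeval w b ∈ Algebra.adjoin ℤ (Set.range w) := by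
      intro b
      rw [Algebra.adjoin_range_eq_range_aeval]
      exact ⟨b, rfl⟩
    let g : B →+* Algebra.adjoin ℤ (Set.range w) :=
      (aeval (R := ℤ) w : B →ₐ[ℤ] 𝕂).toRingHom.codRestrict _ hmem
    constructor
    · intro h
      refine IsAlgebraic.of_ringHom_of_comp_eq g (RingHom.id 𝕂) (a := t) h ?_ Function.injective_id ?_
      · rintro ⟨x, hx⟩
        rw [Algebra.adjoin_range_eq_range_aeval] at hx
        obtain ⟨b, hb⟩ := hx
        exact ⟨b, Subtype.ext hb⟩
      · ext <;> rfl
    · intro h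
      refine IsAlgebraic.ringHom_of_comp_eq g (RingHom.id 𝕂) h ?_ ?_
      · intro b b' hbb
        exact hinj (congrArg Subtype.val hbb)
      · ext <;> rfl
  rw [hB, IsFractionRing.isAlgebraic_iff B F 𝕂]
  constructor
  · intro h
    have hm := minpoly.ne_zero h.isIntegral
    have hsplit : ((minpoly F t).map (algebraMap F L)).Splits := IsAlgClosed.splits _
    have h1 : t ∈ ((minpoly F t).map (algebraMap F 𝕂)).roots := by
      rw [Polynomial.mem_roots (by simpa using hm), Polynomial.IsRoot, Polynomial.eval_map_algebraMap,
        minpoly.aeval]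
    have h2 : (minpoly F t).map (algebraMap F 𝕂) =
        ((minpoly F t).map (algebraMap F L)).map (φ : L →+* 𝕂) := by
      rw [Polynomial.map_map]
      congr 1
      ext b
      exact (φ.commutes b).symm
    rw [h2, hsplit.roots_map, Multiset.mem_map] at h1
    obtain ⟨y, -, hy⟩ := h1
    exact ⟨y, hy⟩
  · rintro ⟨y, rfl⟩
    exact (Algebra.IsAlgebraic.isAlgebraic (R := F) y).algHom φ

/-- Elements which are generic over a family stay generic over its algebraic closure. -/
theorem IsGeneric.eq_zero_of_eval₂ {α L : Type*} [Field L] {u : α → 𝕂} {y : Y → 𝕂}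
    (h : IsGeneric (Sum.elim u y)) (φ : L →+* 𝕂)
    (hφ : ∀ t, IsAlgebraic (Algebra.adjoin ℤ (Set.range y)) (φ t)) {Q : MvPolynomial α L}
    (hQ : eval₂ φ u Q = 0) : Q = 0 := by
  have h1 := (AlgebraicIndependent.sumElim_iff.1 h.algebraicIndependent).2
  let S := Subalgebra.algebraicClosure (Algebra.adjoin ℤ (Set.range y)) 𝕂
  have : Algebra.IsAlgebraic (Algebra.adjoin ℤ (Set.range y)) S := inferInstance
  have h2 : AlgebraicIndependent S u := h1.extendScalars S
  let ψ : L →+* S := φ.codRestrict S hφ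
  have h3 : aeval u (map ψ Q) = 0 := by
    rw [← hQ, aeval_def, eval₂_map]
    rfl
  have h4 := algebraicIndependent_iff.1 h2 _ h3
  exact (map_eq_zero_iff _ (map_injective _ ψ.injective)).1 h4

end Transcendence

end

section

section Characters

variable {κ K : Type*} [Fintype κ] [Field K]

/-- The character `χ^a` of the torus. -/
def torusChar (ξ : κ → Kˣ) (a : κ → ℤ) : Kˣ := ∏ l, ξ l ^ a l

theorem torusChar_add (ξ : κ → Kˣ) (a b : κ → ℤ) :
    torusChar ξ (a + b) = torusChar ξ a * torusChar ξ b := by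
  simp [torusChar, zpow_add, Finset.prod_mul_distrib]

theorem torusChar_zero (ξ : κ → Kˣ) : torusChar ξ 0 = 1 := by
  simp [torusChar]

theorem torusChar_sub (ξ : κ → Kˣ) (a b : κ → ℤ) :
    torusChar ξ (a - b) = torusChar ξ a / torusChar ξ b := by
  simp [torusChar, zpow_sub, Finset.prod_mul_distrib, div_eq_mul_inv]

theorem torusChar_nsmul (ξ : κ → Kˣ) (k : ℕ) (a : κ → ℤ) :
    torusChar ξ (k • a) = torusChar ξ a ^ k := by
  rw [torusChar, torusChar, ← Finset.prod_pow]
  refine Finset.prod_congr rfl fun l _ => ?_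
  rw [Pi.smul_apply, nsmul_eq_mul, mul_comm, zpow_mul, zpow_natCast]

theorem torusChar_pow (ξ : κ → Kˣ) (k : ℕ) (a : κ → ℤ) :
    torusChar (ξ ^ k) a = torusChar ξ a ^ k := by
  rw [torusChar, torusChar, ← Finset.prod_pow]
  refine Finset.prod_congr rfl fun l _ => ?_
  rw [Pi.pow_apply, ← zpow_natCast, ← zpow_mul, ← zpow_natCast, ← zpow_mul, mul_comm]

theorem torusChar_mul (ξ ξ' : κ → Kˣ) (a : κ → ℤ) :
    torusChar (ξ * ξ') a = torusChar ξ a * torusChar ξ' a := by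
  simp [torusChar, mul_zpow, Finset.prod_mul_distrib]

theorem torusChar_map {K' : Type*} [Field K'] (φ : K →+* K') (ξ : κ → Kˣ) (a : κ → ℤ) :
    torusChar (fun l => Units.map (φ : K →* K') (ξ l)) a = Units.map (φ : K →* K') (torusChar ξ a) := by
  simp [torusChar]

end Characters

section Systems

variable {ι κ : Type*} [Fintype κ] {α : ι → Type*} [∀ j, Fintype (α j)]

/-- `ξ` is a common root of the Laurent polynomials `∑ a, c_{j,a} χ^{e_{j,a}}` for `j ∈ J`. -/
def IsSystemRoot {K : Type*} [Field K] (e : ∀ j, α j → κ → ℤ) (J : Set ι) (c : (Σ j, α j) → K)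
    (ξ : κ → Kˣ) : Prop :=
  ∀ j ∈ J, ∑ a, c ⟨j, a⟩ * (torusChar ξ (e j a) : K) = 0

open MvPolynomial in
/-- `P` vanishes at all complex coefficient families having a common root. -/
def VanishesOnRoots (e : ∀ j, α j → κ → ℤ) (P : MvPolynomial (Σ j, α j) ℤ) : Prop :=
  ∀ (c : (Σ j, α j) → ℂ) (ξ : κ → ℂˣ), IsSystemRoot e Set.univ c ξ → aeval c P = 0

open Classical in
/-- The coefficient family obtained from `u` by changing the coefficients at the pivots `p` so that
`ξ` becomes a common root. -/
noncomputable def rootParam (p : ∀ j, α j) (e : ∀ j, α j → κ → ℤ) (u : (Σ j, α j) → ℂ)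
    (ξ : κ → ℂˣ) (s : Σ j, α j) : ℂ :=
  if s.2 = p s.1 then
    -∑ a ∈ Finset.univ.erase (p s.1), u ⟨s.1, a⟩ * (torusChar ξ (e s.1 a - e s.1 (p s.1)) : ℂ)
  else u s

theorem rootParam_of_ne (p : ∀ j, α j) (e : ∀ j, α j → κ → ℤ) (u : (Σ j, α j) → ℂ)
    (ξ : κ → ℂˣ) {s : Σ j, α j} (h : s.2 ≠ p s.1) : rootParam p e u ξ s = u s := by
  rw [rootParam, if_neg h]

open Classical in
theorem rootParam_pivot (p : ∀ j, α j) (e : ∀ j, α j → κ → ℤ) (u : (Σ j, α j) → ℂ)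
    (ξ : κ → ℂˣ) (j : ι) : rootParam p e u ξ ⟨j, p j⟩ =
      -∑ a ∈ Finset.univ.erase (p j), u ⟨j, a⟩ * (torusChar ξ (e j a - e j (p j)) : ℂ) := by
  rw [rootParam, if_pos rfl]

theorem isSystemRoot_rootParam (p : ∀ j, α j) (e : ∀ j, α j → κ → ℤ) (u : (Σ j, α j) → ℂ)
    (ξ : κ → ℂˣ) (J : Set ι) : IsSystemRoot e J (rootParam p e u ξ) ξ := by
  classical
  intro j _
  rw [← Finset.add_sum_erase _ _ (Finset.mem_univ (p j)), rootParam_pivot, neg_mul, Finset.sum_mul,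
    neg_add_eq_zero]
  refine Finset.sum_congr (by congr!) fun a ha => ?_
  rw [rootParam_of_ne p e u ξ (s := ⟨j, a⟩) (Finset.ne_of_mem_erase ha), torusChar_sub]
  rw [Units.val_div_eq_div_val, mul_assoc, div_mul_cancel₀ _ (Units.ne_zero _)]

theorem rootParam_eq_of_isSystemRoot (p : ∀ j, α j) (e : ∀ j, α j → κ → ℤ) {c : (Σ j, α j) → ℂ}
    {ξ : κ → ℂˣ} (h : IsSystemRoot e Set.univ c ξ) : rootParam p e c ξ = c := by
  classical
  funext s
  obtain ⟨j, a⟩ := s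
  by_cases ha : a = p j
  · subst ha
    rw [rootParam_pivot]
    have h1 := h j (Set.mem_univ _)
    rw [← Finset.add_sum_erase _ _ (Finset.mem_univ (p j))] at h1
    have h2 : (torusChar ξ (e j (p j)) : ℂ) ≠ 0 := Units.ne_zero _
    apply mul_right_cancel₀ h2
    rw [eq_neg_of_add_eq_zero_left h1, neg_mul, Finset.sum_mul]
    congr 1
    refine Finset.sum_congr (by congr!) fun a ha => ?_
    rw [torusChar_sub]
    rw [Units.val_div_eq_div_val, mul_assoc, div_mul_cancel₀ _ (Units.ne_zero _)]
  · exact rootParam_of_ne p e c ξ (s := ⟨j, a⟩) ha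

end Systems

section Laurent

open MvPolynomial

variable {σ κ : Type*} [Fintype κ]

/-- A function on affine space times a torus which is a Laurent polynomial with integer
coefficients. -/
def IsLaurent (f : (σ → ℂ) → (κ → ℂˣ) → ℂ) : Prop :=
  ∃ (N : ℕ) (P : MvPolynomial (σ ⊕ κ) ℤ), ∀ u ξ,
    f u ξ * (∏ l, (ξ l : ℂ)) ^ N = aeval (Sum.elim u fun l => (ξ l : ℂ)) P

theorem aeval_prod_X_inr (u : σ → ℂ) (ξ : κ → ℂˣ) :
    aeval (Sum.elim u fun l => (ξ l : ℂ)) (∏ l : κ, X (R := ℤ) (Sum.inr (α := σ) l)) =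
      ∏ l, (ξ l : ℂ) := by
  simp

theorem IsLaurent.mul {f g : (σ → ℂ) → (κ → ℂˣ) → ℂ} (hf : IsLaurent f) (hg : IsLaurent g) :
    IsLaurent fun u ξ => f u ξ * g u ξ := by
  obtain ⟨N, P, hP⟩ := hf
  obtain ⟨M, Q, hQ⟩ := hg
  refine ⟨N + M, P * Q, fun u ξ => ?_⟩
  rw [map_mul, ← hP, ← hQ]; ring

theorem IsLaurent.add {f g : (σ → ℂ) → (κ → ℂˣ) → ℂ} (hf : IsLaurent f) (hg : IsLaurent g) :
    IsLaurent fun u ξ => f u ξ + g u ξ := by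
  obtain ⟨N, P, hP⟩ := hf
  obtain ⟨M, Q, hQ⟩ := hg
  refine ⟨N + M, P * (∏ l : κ, X (Sum.inr l)) ^ M + Q * (∏ l : κ, X (Sum.inr l)) ^ N,
    fun u ξ => ?_⟩
  rw [map_add, map_mul, map_mul, map_pow, map_pow, aeval_prod_X_inr, ← hP, ← hQ]; ring

theorem isLaurent_int (k : ℤ) : IsLaurent fun (_ : σ → ℂ) (_ : κ → ℂˣ) => (k : ℂ) :=
  ⟨0, C k, fun u ξ => by simp⟩

theorem isLaurent_coord (s : σ) : IsLaurent fun (u : σ → ℂ) (_ : κ → ℂˣ) => u s :=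
  ⟨0, X (Sum.inl s), fun u ξ => by simp⟩

theorem IsLaurent.sum {β : Type*} (t : Finset β) {f : β → (σ → ℂ) → (κ → ℂˣ) → ℂ}
    (h : ∀ b ∈ t, IsLaurent (f b)) : IsLaurent fun u ξ => ∑ b ∈ t, f b u ξ := by
  classical
  induction t using Finset.induction_on with
  | empty => simpa using isLaurent_int 0
  | insert b t hb ih =>
    simp only [Finset.sum_insert hb]
    exact (h b (by simp)).add (ih fun b hb => h b (by simp [hb]))

theorem IsLaurent.prod {β : Type*} (t : Finset β) {f : β → (σ → ℂ) → (κ → ℂˣ) → ℂ}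
    (h : ∀ b ∈ t, IsLaurent (f b)) : IsLaurent fun u ξ => ∏ b ∈ t, f b u ξ := by
  classical
  induction t using Finset.induction_on with
  | empty => simpa using isLaurent_int 1
  | insert b t hb ih =>
    simp only [Finset.prod_insert hb]
    exact (h b (by simp)).mul (ih fun b hb => h b (by simp [hb]))

theorem isLaurent_torusChar (a : κ → ℤ) :
    IsLaurent fun (_ : σ → ℂ) (ξ : κ → ℂˣ) => (torusChar ξ a : ℂ) := by
  classical
  have h : ∀ (l : κ) (k : ℤ), IsLaurent fun (_ : σ → ℂ) (ξ : κ → ℂˣ) => (ξ l : ℂ) ^ k := by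
    intro l k
    cases k with
    | ofNat k => exact ⟨0, X (Sum.inr l) ^ k, fun u ξ => by simp⟩
    | negSucc k =>
      refine ⟨k + 1, (∏ l' ∈ Finset.univ.erase l, X (Sum.inr l')) ^ (k + 1), fun u ξ => ?_⟩
      beta_reduce
      rw [← Finset.mul_prod_erase _ _ (Finset.mem_univ l), zpow_negSucc, mul_pow, ← mul_assoc,
        inv_mul_cancel₀ (pow_ne_zero _ (ξ l).ne_zero), one_mul]
      simp
  have := IsLaurent.prod (σ := σ) Finset.univ fun l _ => h l (a l)
  simpa [torusChar] using this

theorem IsLaurent.aeval {ρ : Type*} {f : (σ → ℂ) → (κ → ℂˣ) → ρ → ℂ}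
    (h : ∀ s, IsLaurent fun u ξ => f u ξ s) (P : MvPolynomial ρ ℤ) :
    IsLaurent fun u ξ => MvPolynomial.aeval (f u ξ) P := by
  induction P using MvPolynomial.induction_on with
  | C k => simpa using isLaurent_int k
  | add P Q hP hQ => simpa using hP.add hQ
  | mul_X P s hP => simpa using hP.mul (h s)

/-- A Laurent polynomial vanishing at a generic point vanishes identically. -/
theorem IsLaurent.eq_zero_of_isGeneric {f : (σ → ℂ) → (κ → ℂˣ) → ℂ} (hf : IsLaurent f)
    {u : σ → ℂ} {ξ : κ → ℂˣ} (hθ : IsGeneric (Sum.elim u fun l => (ξ l : ℂ)))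
    (h0 : f u ξ = 0) (u' : σ → ℂ) (ξ' : κ → ℂˣ) : f u' ξ' = 0 := by
  obtain ⟨N, P, hP⟩ := hf
  have h1 := hP u ξ
  rw [h0, zero_mul] at h1
  have h2 := hP u' ξ'
  rw [hθ P h1.symm, map_zero] at h2
  refine (mul_eq_zero.1 h2).resolve_right (pow_ne_zero _ ?_)
  exact Finset.prod_ne_zero_iff.2 fun l _ => (ξ' l).ne_zero

variable {ι : Type*} {α : ι → Type*} [∀ j, Fintype (α j)]

theorem vanishesOnRoots_iff_aeval_rootParam (p : ∀ j, α j) (e : ∀ j, α j → κ → ℤ)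
    {u : (Σ j, α j) → ℂ} {ξ : κ → ℂˣ} (hθ : IsGeneric (Sum.elim u fun l => (ξ l : ℂ)))
    (P : MvPolynomial (Σ j, α j) ℤ) :
    VanishesOnRoots e P ↔ MvPolynomial.aeval (rootParam p e u ξ) P = 0 := by
  classical
  constructor
  · intro h
    exact h _ ξ (isSystemRoot_rootParam p e u ξ _)
  · intro h c ξ' hc
    have hL : IsLaurent fun u ξ => MvPolynomial.aeval (rootParam (κ := κ) p e u ξ) P := by
      refine IsLaurent.aeval (fun s => ?_) P
      by_cases hs : s.2 = p s.1
      · simp only [rootParam, if_pos hs]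
        have h1 := (isLaurent_int (σ := Σ j, α j) (κ := κ) (-1)).mul
          (IsLaurent.sum (Finset.univ.erase (p s.1)) fun a _ =>
            (isLaurent_coord (κ := κ) (⟨s.1, a⟩ : Σ j, α j)).mul
              (isLaurent_torusChar (σ := Σ j, α j) (e s.1 a - e s.1 (p s.1))))
        convert! h1 using 3
        simp
      · simp only [rootParam, if_neg hs]
        exact isLaurent_coord s
    have := hL.eq_zero_of_isGeneric hθ h c ξ'
    rwa [rootParam_eq_of_isSystemRoot p e hc] at this

end Laurent

end

section

open MvPolynomial

section Slots

variable {ι : Type*} {α : ι → Type*}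

/-- The coefficient variables outside the slot `i`. -/
abbrev Off (α : ι → Type*) (i : ι) : Type _ := {s : Σ j, α j // s.1 ≠ i}

/-- Coefficient variables are in the slot `i` or outside it. -/
noncomputable def slotEquiv (α : ι → Type*) (i : ι) : α i ⊕ Off α i ≃ Σ j, α j :=
  Equiv.ofBijective (Sum.elim (fun a => ⟨i, a⟩) Subtype.val) (by
    constructor
    · rintro (a | ⟨s, hs⟩) (b | ⟨t, ht⟩) h
      · simpa using h
      · simp at h; exact absurd (by rw [← h]) ht
      · simp at h; exact absurd (by rw [h]) hs
      · simpa using h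
    · rintro ⟨j, a⟩
      by_cases h : j = i
      · subst h; exact ⟨Sum.inl a, rfl⟩
      · exact ⟨Sum.inr ⟨⟨j, a⟩, h⟩, rfl⟩)

theorem slotEquiv_inl (i : ι) (a : α i) : slotEquiv α i (Sum.inl a) = ⟨i, a⟩ := rfl

theorem slotEquiv_inr (i : ι) (s : Off α i) : slotEquiv α i (Sum.inr s) = s.1 := rfl

/-- Glue families in the slot `i` and outside it. -/
noncomputable def slotJoin {K : Type*} (i : ι) (u : α i → K) (w : Off α i → K) (s : Σ j, α j) : K :=
  Sum.elim u w ((slotEquiv α i).symm s)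

theorem slotJoin_slot {K : Type*} (i : ι) (u : α i → K) (w : Off α i → K) (a : α i) :
    slotJoin i u w ⟨i, a⟩ = u a := by
  rw [slotJoin, ← slotEquiv_inl, Equiv.symm_apply_apply, Sum.elim_inl]

theorem slotJoin_off {K : Type*} (i : ι) (u : α i → K) (w : Off α i → K) (s : Off α i) :
    slotJoin i u w s.1 = w s := by
  rw [slotJoin, ← slotEquiv_inr, Equiv.symm_apply_apply, Sum.elim_inr]

theorem slotJoin_self {K : Type*} (i : ι) (x : (Σ j, α j) → K) :
    slotJoin i (fun a => x ⟨i, a⟩) (fun s => x s.1) = x := by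
  funext s
  obtain ⟨t, rfl⟩ := (slotEquiv α i).surjective s
  cases t with
  | inl a => exact slotJoin_slot i _ _ a
  | inr s => exact slotJoin_off i _ _ s

/-- View a polynomial as a polynomial in the variables of the slot `i`. -/
noncomputable def slotSplit (i : ι) :
    MvPolynomial (Σ j, α j) ℤ ≃ₐ[ℤ] MvPolynomial (α i) (MvPolynomial (Off α i) ℤ) :=
  (renameEquiv ℤ (slotEquiv α i).symm).trans (sumAlgEquiv ℤ (α i) (Off α i))

theorem slotSplit_X_slot (i : ι) (a : α i) :
    slotSplit i (X ⟨i, a⟩ : MvPolynomial (Σ j, α j) ℤ) = X a := by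
  rw [slotSplit, ← slotEquiv_inl]
  simp

theorem slotSplit_X_off (i : ι) (s : Off α i) :
    slotSplit i (X s.1 : MvPolynomial (Σ j, α j) ℤ) = C (X s) := by
  rw [slotSplit, ← slotEquiv_inr]
  simp

theorem eval₂_slotSplit {K : Type*} [CommRing K] (i : ι) (g : MvPolynomial (Off α i) ℤ →+* K)
    (u : α i → K) (P : MvPolynomial (Σ j, α j) ℤ) :
    eval₂ g u (slotSplit i P) = aeval (slotJoin i u fun s => g (X s)) P := by
  have : (eval₂Hom g u).comp (slotSplit i).toRingHom =
      (aeval (R := ℤ) (slotJoin i u fun s => g (X s)) : _ →ₐ[ℤ] K).toRingHom := by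
    refine MvPolynomial.ringHom_ext (fun k => by simp) fun s => ?_
    obtain ⟨t, rfl⟩ := (slotEquiv α i).surjective s
    cases t with
    | inl a =>
      rw [slotEquiv_inl]
      simp [slotSplit_X_slot, slotJoin_slot]
    | inr s =>
      rw [slotEquiv_inr]
      simp [slotSplit_X_off, slotJoin_off]
  exact congrArg (fun f => f P) this

end Slots

theorem IsGeneric.comp_injective {τ τ' 𝕂 : Type*} [CommRing 𝕂] {x : τ → 𝕂} (hx : IsGeneric x)
    {f : τ' → τ} (hf : Function.Injective f) : IsGeneric (x ∘ f) := by
  intro P hP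
  rw [← aeval_rename] at hP
  exact (rename_injective f hf) (by rw [hx _ hP, map_zero])

section GenericRoots

variable {ι κ : Type*} [Fintype κ] [Fintype ι] {α : ι → Type*} [∀ j, Fintype (α j)]

/-- The field of algebraic functions of the coefficients outside the slot `i`. -/
abbrev OffField (α : ι → Type*) (i : ι) : Type _ :=
  AlgebraicClosure (FractionRing (MvPolynomial (Off α i) ℤ))

theorem isAlgebraic_torusChar {K : Type*} [Field K] [CharZero K] {S : Set K} {ξ : κ → Kˣ}
    (h : ∀ l, IsAlgebraic (Algebra.adjoin ℤ S) (ξ l : K)) (a : κ → ℤ) :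
    IsAlgebraic (Algebra.adjoin ℤ S) (torusChar ξ a : K) := by
  rw [torusChar, Units.coe_prod]
  simp only [Units.val_zpow_eq_zpow_val]
  exact Finset.prod_induction _ (fun t => IsAlgebraic (Algebra.adjoin ℤ S) t)
    (fun _ _ => IsAlgebraic.mul) isAlgebraic_one fun l _ => isAlgebraic_adjoin_zpow (h l) _

theorem pivot_eq_of_isSystemRoot {K : Type*} [Field K] [DecidableEq ι] (p : ∀ j, α j) {e : ∀ j, α j → κ → ℤ}
    [∀ j, DecidableEq (α j)] {J : Set ι} {c : (Σ j, α j) → K} {ξ : κ → Kˣ} (h : IsSystemRoot e J c ξ) {j : ι} (hj : j ∈ J) :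
    c ⟨j, p j⟩ = -∑ a ∈ Finset.univ.erase (p j), c ⟨j, a⟩ * (torusChar ξ (e j a - e j (p j)) : K) := by
  have h1 := h j hj
  rw [← Finset.add_sum_erase _ _ (Finset.mem_univ (p j))] at h1
  have h2 : (torusChar ξ (e j (p j)) : K) ≠ 0 := Units.ne_zero _
  apply mul_right_cancel₀ h2
  rw [eq_neg_of_add_eq_zero_left h1, neg_mul, Finset.sum_mul]
  congr 1
  refine Finset.sum_congr rfl fun a ha => ?_
  rw [torusChar_sub, Units.val_div_eq_div_val, mul_assoc, div_mul_cancel₀ _ (Units.ne_zero _)]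

/-- Coefficients outside the pivots and the slot `i`, together with the coordinates of a point. -/
def freeCoords {K : Type*} [Monoid K] (p : ∀ j, α j) (i : ι) (c : (Σ j, α j) → K) (ξ : κ → Kˣ) :
    {s : Off α i // s.1.2 ≠ p s.1.1} ⊕ κ → K :=
  Sum.elim (fun s => c s.1.1) fun l => ξ l

/-- The roots of a generic subsystem are algebraic over its coefficients. -/
theorem isAlgebraic_off_iff {K : Type*} [Field K] [CharZero K] (hcard : Fintype.card ι = Fintype.card κ + 1)
    (p : ∀ j, α j) {e : ∀ j, α j → κ → ℤ} {i : ι} {c : (Σ j, α j) → K}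
    (hc : IsGeneric fun s : Off α i => c s.1) {ξ : κ → Kˣ} (hξ : IsSystemRoot e {i}ᶜ c ξ) (t : K) :
    IsAlgebraic (Algebra.adjoin ℤ (Set.range fun s : Off α i => c s.1)) t ↔
      IsAlgebraic (Algebra.adjoin ℤ (Set.range (freeCoords p i c ξ))) t := by
  classical
  refine hc.isAlgebraic_adjoin_iff ?_ (fun s => ?_) t
  · have h1 := Fintype.card_subtype_compl fun s : Off α i => s.1.2 = p s.1.1
    have h2 : Fintype.card {s : Off α i // s.1.2 = p s.1.1} = Fintype.card {j // j ≠ i} := by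
      refine Fintype.card_congr
        ⟨fun s => ⟨s.1.1.1, s.1.2⟩, fun j => ⟨⟨⟨j.1, p j.1⟩, j.2⟩, rfl⟩, ?_, fun _ => rfl⟩
      rintro ⟨⟨⟨j, a⟩, hj⟩, ha⟩
      obtain rfl : a = p j := ha
      rfl
    have h3 : Fintype.card {j // j ≠ i} = Fintype.card κ := by
      rw [Fintype.card_subtype_compl]; simp [hcard]
    have h4 := Fintype.card_subtype_le fun s : Off α i => s.1.2 = p s.1.1
    rw [Fintype.card_sum, h1, h2, h3]
    rw [h2, h3] at h4
    omega
  · have hξa : ∀ l, IsAlgebraic (Algebra.adjoin ℤ (Set.range (freeCoords p i c ξ))) (ξ l : K) :=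
      fun l => isAlgebraic_algebraMap
        (⟨_, Algebra.subset_adjoin ⟨Sum.inr l, rfl⟩⟩ : Algebra.adjoin ℤ (Set.range (freeCoords p i c ξ)))
    have hca : ∀ s : Off α i, s.1.2 ≠ p s.1.1 →
        IsAlgebraic (Algebra.adjoin ℤ (Set.range (freeCoords p i c ξ))) (c s.1) :=
      fun s hs => isAlgebraic_algebraMap
        (⟨_, Algebra.subset_adjoin ⟨Sum.inl ⟨s, hs⟩, rfl⟩⟩ :
          Algebra.adjoin ℤ (Set.range (freeCoords p i c ξ)))
    by_cases hs : s.1.2 = p s.1.1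
    · obtain ⟨⟨j, a⟩, hj⟩ := s
      obtain rfl : a = p j := hs
      beta_reduce
      rw [pivot_eq_of_isSystemRoot p hξ (j := j) hj]
      refine IsAlgebraic.neg (Finset.sum_induction _ (fun t => IsAlgebraic _ t)
        (fun _ _ => IsAlgebraic.add) isAlgebraic_zero fun a ha => IsAlgebraic.mul ?_ ?_)
      · exact hca ⟨⟨j, a⟩, hj⟩ (Finset.ne_of_mem_erase ha)
      · exact isAlgebraic_torusChar hξa _
    · exact hca s hs

theorem isAlgebraic_of_isSystemRoot {K : Type*} [Field K] [CharZero K]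
    (hcard : Fintype.card ι = Fintype.card κ + 1)
    (p : ∀ j, α j) {e : ∀ j, α j → κ → ℤ} {i : ι} {c : (Σ j, α j) → K}
    (hc : IsGeneric fun s : Off α i => c s.1) {ξ : κ → Kˣ} (hξ : IsSystemRoot e {i}ᶜ c ξ) (l : κ) :
    IsAlgebraic (Algebra.adjoin ℤ (Set.range fun s : Off α i => c s.1)) (ξ l : K) := by
  rw [isAlgebraic_off_iff hcard p hc hξ]
  exact isAlgebraic_algebraMap
    (⟨_, Algebra.subset_adjoin ⟨Sum.inr l, rfl⟩⟩ : Algebra.adjoin ℤ (Set.range (freeCoords p i c ξ)))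

end GenericRoots

end

section

open MvPolynomial

section GenericPoint

variable {ι κ : Type*} [Fintype κ] [Fintype ι] {α : ι → Type*} [∀ j, Fintype (α j)]

theorem isSystemRoot_map_iff {K K' : Type*} [Field K] [Field K'] (φ : K →+* K')
    (e : ∀ j, α j → κ → ℤ) (J : Set ι) (c : (Σ j, α j) → K) (ξ : κ → Kˣ) :
    IsSystemRoot e J (fun s => φ (c s)) (fun l => Units.map (φ : K →* K') (ξ l)) ↔
      IsSystemRoot e J c ξ := by
  refine forall₂_congr fun j _ => ?_
  rw [← map_eq_zero_iff φ φ.injective, map_sum]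
  simp [torusChar_map]

theorem isSystemRoot_congr {K : Type*} [Field K] {e : ∀ j, α j → κ → ℤ} {J : Set ι}
    {c c' : (Σ j, α j) → K} (h : ∀ s, s.1 ∈ J → c s = c' s) (ξ : κ → Kˣ) :
    IsSystemRoot e J c ξ ↔ IsSystemRoot e J c' ξ := by
  refine forall₂_congr fun j hj => ?_
  rw [Finset.sum_congr rfl fun a _ => by rw [h ⟨j, a⟩ hj]]

/-- No nonzero polynomial in the coefficients outside the slot `i` vanishes on all systems with a
common root. -/
def IsFreeOff (e : ∀ j, α j → κ → ℤ) (i : ι) : Prop :=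
  ∀ Q : MvPolynomial (Off α i) ℤ, VanishesOnRoots e (rename Subtype.val Q) → Q = 0

variable {p : ∀ j, α j} {e : ∀ j, α j → κ → ℤ} {i : ι} {u : (Σ j, α j) → ℂ} {ξ : κ → ℂˣ}

theorem isGeneric_off_rootParam (hfree : IsFreeOff e i)
    (hθ : IsGeneric (Sum.elim u fun l => (ξ l : ℂ))) :
    IsGeneric fun s : Off α i => rootParam p e u ξ s.1 := by
  intro Q hQ
  apply hfree
  rw [vanishesOnRoots_iff_aeval_rootParam p e hθ, aeval_rename]
  exact hQ

theorem isGeneric_slot_freeCoords (hθ : IsGeneric (Sum.elim u fun l => (ξ l : ℂ))) :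
    IsGeneric (Sum.elim (fun a : α i => u ⟨i, a⟩) (freeCoords p i (rootParam p e u ξ) ξ)) := by
  let f : α i ⊕ ({s : Off α i // s.1.2 ≠ p s.1.1} ⊕ κ) → (Σ j, α j) ⊕ κ :=
    Sum.elim (fun a => Sum.inl ⟨i, a⟩) (Sum.elim (fun s => Sum.inl s.1.1) Sum.inr)
  have hf : Function.Injective f := by
    rintro (a | ⟨⟨s, hs⟩, h⟩ | l) (b | ⟨⟨t, ht⟩, h'⟩ | m) hab
    · simpa [f] using hab
    · simp only [f, Sum.elim_inl, Sum.elim_inr, Sum.inl.injEq] at hab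
      exact absurd (by rw [← hab]) ht
    · simp [f] at hab
    · simp only [f, Sum.elim_inl, Sum.elim_inr, Sum.inl.injEq] at hab
      exact absurd (by rw [hab]) hs
    · simpa [f] using hab
    · simp [f] at hab
    · simp [f] at hab
    · simp [f] at hab
    · simpa [f] using hab
  convert hθ.comp_injective hf using 1
  funext t
  rcases t with a | ⟨s, h⟩ | l
  · rfl
  · simp [f, freeCoords, rootParam_of_ne p e u ξ h]
  · rfl

theorem eq_zero_of_eval₂_slot (hcard : Fintype.card ι = Fintype.card κ + 1) (hfree : IsFreeOff e i)
    (hθ : IsGeneric (Sum.elim u fun l => (ξ l : ℂ))) {φ : OffField α i →+* ℂ}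
    (hφ : ∀ t, IsAlgebraic (Algebra.adjoin ℤ (Set.range fun s : Off α i => rootParam p e u ξ s.1)) t ↔
      t ∈ Set.range φ) {Q : MvPolynomial (α i) (OffField α i)}
    (hQ : eval₂ φ (fun a => u ⟨i, a⟩) Q = 0) : Q = 0 :=
  (isGeneric_slot_freeCoords (p := p) (e := e) hθ).eq_zero_of_eval₂ φ (fun t =>
    (isAlgebraic_off_iff hcard p (isGeneric_off_rootParam hfree hθ)
      (isSystemRoot_rootParam p e u ξ _) _).1 ((hφ _).2 ⟨t, rfl⟩)) hQ

theorem exists_lift_isSystemRoot (hcard : Fintype.card ι = Fintype.card κ + 1) (p : ∀ j, α j)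
    {K : Type*} [Field K] [CharZero K] {c : (Σ j, α j) → K}
    (hc : IsGeneric fun s : Off α i => c s.1) {φ : OffField α i →+* K}
    (hφ : ∀ t, IsAlgebraic (Algebra.adjoin ℤ (Set.range fun s : Off α i => c s.1)) t ↔
      t ∈ Set.range φ) {ζ : κ → Kˣ} (hζ : IsSystemRoot e {i}ᶜ c ζ) :
    ∃ η : κ → (OffField α i)ˣ, (fun l => Units.map (φ : OffField α i →* K) (η l)) = ζ := by
  have h : ∀ l, ∃ t, φ t = ζ l := fun l =>
    (hφ _).1 (isAlgebraic_of_isSystemRoot hcard p hc hζ l)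
  choose η hη using h
  have hη0 : ∀ l, η l ≠ 0 := fun l h0 => (ζ l).ne_zero (by rw [← hη l, h0, map_zero])
  exact ⟨fun l => Units.mk0 (η l) (hη0 l), by funext l; ext; exact hη l⟩

variable [DecidableEq ι]

theorem rootParam_update_off (K : ℕ) (s : Off α i) :
    rootParam p (Function.update e i (K • e i)) u ξ s.1 = rootParam p e u ξ s.1 := by
  rw [rootParam, rootParam, Function.update_of_ne s.2]

/-- The vanishing of polynomials on systems with a common root is governed by a linear form, and
remains so after scaling the exponents of a slot. -/
theorem vanishesOnRoots_update_iff (hcard : Fintype.card ι = Fintype.card κ + 1)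
    (hfree : IsFreeOff e i) (hθ : IsGeneric (Sum.elim u fun l => (ξ l : ℂ)))
    {φ : OffField α i →+* ℂ}
    (hφB : ∀ b : MvPolynomial (Off α i) ℤ, φ (algebraMap _ _ b) =
      aeval (fun s : Off α i => rootParam p e u ξ s.1) b)
    (hφ : ∀ t, IsAlgebraic (Algebra.adjoin ℤ (Set.range fun s : Off α i => rootParam p e u ξ s.1)) t ↔
      t ∈ Set.range φ) {η : κ → (OffField α i)ˣ}
    (hη : (fun l => Units.map (φ : OffField α i →* ℂ) (η l)) = ξ) (K : ℕ)
    (P : MvPolynomial (Σ j, α j) ℤ) :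
    VanishesOnRoots (Function.update e i (K • e i)) P ↔
      linForm ((fun a => (torusChar η (e i a - e i (p i)) : OffField α i)) ^ K) ∣
        map (algebraMap _ _) (slotSplit i P) := by
  classical
  have hz1 : ((fun a => (torusChar η (e i a - e i (p i)) : OffField α i)) ^ K) (p i) = 1 := by
    simp [torusChar_zero]
  rw [vanishesOnRoots_iff_aeval_rootParam p _ hθ, linForm_dvd_iff hz1]
  set x := rootParam p (Function.update e i (K • e i)) u ξ with hx
  have h1 : aeval x P = eval₂ (φ.comp (algebraMap _ _)) (fun a => x ⟨i, a⟩) (slotSplit i P) := by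
    rw [eval₂_slotSplit]
    congr 2
    conv_lhs => rw [← slotJoin_self i x]
    congr 1
    funext s
    rw [RingHom.comp_apply, hφB, aeval_X, hx, rootParam_update_off]
  have h2 : ∀ Q : MvPolynomial (α i) (OffField α i),
      eval₂ φ (fun a => u ⟨i, a⟩) (linSubst ((fun a => (torusChar η (e i a - e i (p i)) :
        OffField α i)) ^ K) (p i) Q) = eval₂ φ (fun a => x ⟨i, a⟩) Q := by
    intro Q
    have : (eval₂Hom φ (fun a => u ⟨i, a⟩)).comp (linSubst ((fun a =>
        (torusChar η (e i a - e i (p i)) : OffField α i)) ^ K) (p i)).toRingHom =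
        eval₂Hom φ (fun a => x ⟨i, a⟩) := by
      refine MvPolynomial.ringHom_ext (fun k => by simp) fun a => ?_
      by_cases ha : a = p i
      · subst ha
        simp only [linSubst, AlgHom.toRingHom_eq_coe, RingHom.comp_apply, RingHom.coe_coe, aeval_X,
          if_true, map_neg, map_sum, map_mul, coe_eval₂Hom, eval₂_X, eval₂_C]
        rw [hx, rootParam_pivot]
        congr 1
        refine Finset.sum_congr (by congr!) fun a ha => ?_
        rw [mul_comm]
        congr 1
        rw [Function.update_self, Pi.smul_apply, Pi.smul_apply, ← smul_sub, torusChar_nsmul, ← hη,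
          torusChar_map]
        simp
      · rw [hx]
        simp [linSubst, ha, rootParam_of_ne p _ u ξ (s := ⟨i, a⟩) ha]
    exact congrArg (fun f => f Q) this
  rw [h1, ← eval₂_map, ← h2]
  refine ⟨fun h => eq_zero_of_eval₂_slot hcard hfree hθ hφ h, fun h => by rw [h]; simp⟩

theorem exists_linForm_dvd_iff (hcard : Fintype.card ι = Fintype.card κ + 1) (p : ∀ j, α j)
    (hfree : IsFreeOff e i) : ∃ z : α i → OffField α i, z (p i) = 1 ∧ ∀ K P,
      VanishesOnRoots (Function.update e i (K • e i)) P ↔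
        linForm (z ^ K) ∣ map (algebraMap _ _) (slotSplit i P) := by
  obtain ⟨θ, hθ⟩ := (dense_isGeneric ((Σ j, α j) ⊕ κ) ℂ).nonempty
  have hne : ∀ l, θ (Sum.inr l) ≠ 0 := by
    intro l h0
    have := hθ (X (Sum.inr l)) (by simpa using h0)
    exact X_ne_zero _ this
  let u : (Σ j, α j) → ℂ := fun s => θ (Sum.inl s)
  let ξ : κ → ℂˣ := fun l => Units.mk0 _ (hne l)
  have hθ' : IsGeneric (Sum.elim u fun l => (ξ l : ℂ)) := by
    convert! hθ using 1
    funext t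
    cases t <;> rfl
  have hw := isGeneric_off_rootParam (p := p) hfree hθ'
  obtain ⟨φ, hφB, hφ⟩ := hw.exists_lift
  obtain ⟨η, hη⟩ := exists_lift_isSystemRoot hcard p hw hφ (isSystemRoot_rootParam p e u ξ _)
  exact ⟨_, by simp [torusChar_zero], fun K P =>
    vanishesOnRoots_update_iff hcard hfree hθ' hφB hφ hη K P⟩

end GenericPoint

end

section

open MvPolynomial

theorem le_of_forall_pow_le {a b : ℕ} {C : ℝ} (h : ∀ R : ℝ, 1 ≤ R → R ^ a ≤ C * R ^ b) : a ≤ b := by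
  by_contra! hlt
  have h1 : ∀ R : ℝ, 1 ≤ R → R ≤ C := by
    intro R hR
    have h0 : 0 < R ^ b := by positivity
    have h2 : R * R ^ b ≤ C * R ^ b := by
      rw [← pow_succ']
      exact (pow_le_pow_right₀ hR hlt).trans (h R hR)
    exact le_of_mul_le_mul_right h2 h0
  have := h1 (max 1 (C + 1)) (le_max_left _ _)
  have := le_max_right 1 (C + 1)
  linarith

section SlotDegree

variable {ι : Type*} [Fintype ι] {α : ι → Type*} [∀ j, Fintype (α j)]

/-- The partial degree in the variables of a slot. -/
noncomputable def slotDeg (i : ι) (P : MvPolynomial (Σ j, α j) ℤ) : ℕ :=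
  P.support.sup fun m => ∑ a, m ⟨i, a⟩

variable [DecidableEq ι]

/-- Polyradius `R` in the slot `i` and `1` elsewhere. -/
def slotRadius (α : ι → Type*) (i : ι) (R : ℝ) (s : Σ j, α j) : ℝ := if s.1 = i then R else 1

theorem slotRadius_nonneg {R : ℝ} (hR : 0 ≤ R) (i : ι) (s : Σ j, α j) : 0 ≤ slotRadius α i R s := by
  rw [slotRadius]; split_ifs <;> positivity

theorem slotRadius_pos {R : ℝ} (hR : 0 < R) (i : ι) (s : Σ j, α j) : 0 < slotRadius α i R s := by
  rw [slotRadius]; split_ifs <;> positivity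

theorem prod_slotRadius_pow (i : ι) (R : ℝ) (m : (Σ j, α j) →₀ ℕ) :
    ∏ s, slotRadius α i R s ^ m s = R ^ ∑ a, m ⟨i, a⟩ := by
  rw [Fintype.prod_sigma, Finset.prod_eq_single i]
  · simp [slotRadius, Finset.prod_pow_eq_pow_sum]
  · intro j _ hj
    simp [slotRadius, hj]
  · simp

theorem pow_slotDeg_le_polydiscNorm (i : ι) {P : MvPolynomial (Σ j, α j) ℤ} (hP : P ≠ 0) {R : ℝ}
    (hR : 0 ≤ R) : R ^ slotDeg i P ≤ polydiscNorm (slotRadius α i R) P := by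
  obtain ⟨m, hm, hd⟩ := Finset.exists_mem_eq_sup P.support (support_nonempty.2 hP)
    fun m => ∑ a, m ⟨i, a⟩
  have h1 := natAbs_coeff_mul_le_polydiscNorm (slotRadius_nonneg hR i) P m
  rw [prod_slotRadius_pow, ← hd] at h1
  have h2 : (1 : ℝ) ≤ (coeff m P).natAbs := by
    exact_mod_cast Int.natAbs_pos.2 (mem_support_iff.1 hm)
  exact (le_mul_of_one_le_left (by positivity) h2).trans h1

theorem polydiscNorm_le_pow_slotDeg (i : ι) (P : MvPolynomial (Σ j, α j) ℤ) :
    ∃ C : ℝ, 0 ≤ C ∧ ∀ R : ℝ, 1 ≤ R → polydiscNorm (slotRadius α i R) P ≤ C * R ^ slotDeg i P := by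
  refine ⟨∑ m ∈ P.support, ‖((coeff m P : ℤ) : ℂ)‖, by positivity, fun R hR => ?_⟩
  refine polydiscNorm_le (slotRadius_nonneg (zero_le_one.trans hR) i) fun u hu => ?_
  rw [aeval_def, eval₂_eq', Finset.sum_mul]
  refine (norm_sum_le _ _).trans (Finset.sum_le_sum fun m hm => ?_)
  rw [norm_mul, norm_prod]
  refine mul_le_mul (le_of_eq (by simp)) ?_ (by positivity) (by positivity)
  calc ∏ s, ‖u s ^ m s‖ ≤ ∏ s, slotRadius α i R s ^ m s := by
        refine Finset.prod_le_prod (fun _ _ => by positivity) fun s _ => ?_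
        rw [norm_pow]
        exact pow_le_pow_left₀ (norm_nonneg _) (hu s) _
    _ = R ^ ∑ a, m ⟨i, a⟩ := prod_slotRadius_pow i R m
    _ ≤ R ^ slotDeg i P := pow_le_pow_right₀ hR
        (Finset.le_sup (f := fun m : (Σ j, α j) →₀ ℕ => ∑ a, m ⟨i, a⟩) hm)

theorem one_le_polydiscNorm {P : MvPolynomial (Σ j, α j) ℤ} (hP : P ≠ 0) : 1 ≤ polydiscNorm 1 P := by
  obtain ⟨m, hm⟩ := support_nonempty.2 hP
  have h1 := natAbs_coeff_mul_le_polydiscNorm (r := 1) (fun _ => zero_le_one) P m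
  simp only [Pi.one_apply, one_pow, Finset.prod_const_one, mul_one] at h1
  refine le_trans ?_ h1
  exact_mod_cast Int.natAbs_pos.2 (mem_support_iff.1 hm)

theorem slotDeg_eq_of_smul (i : ι) {P : MvPolynomial (Σ j, α j) ℤ} (hP : P ≠ 0) {D : ℕ}
    (h : ∀ (u : α i → ℂ) (w : Off α i → ℂ) (r : ℂ),
      aeval (slotJoin i (r • u) w) P = r ^ D * aeval (slotJoin i u w) P) : slotDeg i P = D := by
  have key : ∀ R : ℝ, 1 ≤ R → polydiscNorm (slotRadius α i R) P = R ^ D * polydiscNorm 1 P := by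
    intro R hR
    have hR0 : 0 < R := by positivity
    apply le_antisymm
    · refine polydiscNorm_le (slotRadius_nonneg hR0.le i) fun u hu => ?_
      have h1 := h ((R⁻¹ : ℂ) • fun a => u ⟨i, a⟩) (fun s => u s.1) R
      rw [smul_smul, mul_inv_cancel₀ (by exact_mod_cast hR0.ne'), one_smul, slotJoin_self] at h1
      rw [h1, norm_mul, norm_pow, Complex.norm_real, Real.norm_of_nonneg hR0.le]
      refine mul_le_mul_of_nonneg_left (norm_aeval_le_polydiscNorm P fun s => ?_) (by positivity)
      obtain ⟨t, rfl⟩ := (slotEquiv α i).surjective s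
      cases t with
      | inl a =>
        rw [slotEquiv_inl, slotJoin_slot]
        have := hu ⟨i, a⟩
        simp only [slotRadius, if_true] at this
        simp only [Pi.smul_apply, smul_eq_mul, norm_mul, norm_inv, Complex.norm_real,
          Real.norm_of_nonneg hR0.le, Pi.one_apply]
        rwa [inv_mul_le_iff₀ hR0, mul_one]
      | inr s =>
        rw [slotEquiv_inr, slotJoin_off]
        simpa [slotRadius, s.2] using hu s.1
    · obtain ⟨u, hu, he⟩ := exists_polydiscNorm_eq (r := (1 : (Σ j, α j) → ℝ)) (fun _ => zero_le_one) P
      have h1 := h (fun a => u ⟨i, a⟩) (fun s => u s.1) R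
      rw [slotJoin_self] at h1
      have h2 : R ^ D * polydiscNorm 1 P = ‖(R : ℂ) ^ D * aeval u P‖ := by
        rw [norm_mul, norm_pow, Complex.norm_real, Real.norm_of_nonneg hR0.le, he]
      rw [h2, ← h1]
      refine norm_aeval_le_polydiscNorm P fun s => ?_
      obtain ⟨t, rfl⟩ := (slotEquiv α i).surjective s
      cases t with
      | inl a =>
        rw [slotEquiv_inl, slotJoin_slot]
        simp only [Pi.smul_apply, smul_eq_mul, norm_mul, Complex.norm_real,
          Real.norm_of_nonneg hR0.le, slotRadius, if_true]
        simpa using mul_le_mul_of_nonneg_left (hu ⟨i, a⟩) hR0.le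
      | inr s =>
        rw [slotEquiv_inr, slotJoin_off]
        simpa [slotRadius, s.2] using hu s.1
  obtain ⟨C, hC, hle⟩ := polydiscNorm_le_pow_slotDeg i P
  have h1 := one_le_polydiscNorm hP
  apply le_antisymm
  · refine le_of_forall_pow_le (C := polydiscNorm 1 P) fun R hR => ?_
    rw [mul_comm, ← key R hR]
    exact pow_slotDeg_le_polydiscNorm i hP (zero_le_one.trans hR)
  · refine le_of_forall_pow_le (C := C) fun R hR => ?_
    refine le_trans ?_ (hle R hR)
    rw [key R hR]
    exact le_mul_of_one_le_right (by positivity) h1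

theorem slotDeg_eq_zero_of_dvd_rename {i : ι} {P : MvPolynomial (Σ j, α j) ℤ}
    {Q : MvPolynomial (Off α i) ℤ} (hQ : Q ≠ 0) (h : P ∣ rename Subtype.val Q) : slotDeg i P = 0 := by
  classical
  obtain ⟨P', hP'⟩ := h
  have hne : rename Subtype.val Q ≠ (0 : MvPolynomial (Σ j, α j) ℤ) := fun h0 =>
    hQ (rename_injective _ Subtype.val_injective (by rw [h0, map_zero]))
  have hP0 : P ≠ 0 := by rintro rfl; simp at hP'; exact hne (by simp [hP'])
  have hP0' : P' ≠ 0 := by rintro rfl; simp at hP'; exact hne (by simp [hP'])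
  have hd : ∀ a : α i, degreeOf ⟨i, a⟩ P = 0 := by
    intro a
    have h1 : degreeOf ⟨i, a⟩ (rename Subtype.val Q : MvPolynomial (Σ j, α j) ℤ) = 0 := by
      refine Nat.eq_zero_of_le_zero (degreeOf_le_iff.2 fun m hm => ?_)
      by_contra h0
      have h2 : (⟨i, a⟩ : Σ j, α j) ∈ (rename Subtype.val Q : MvPolynomial (Σ j, α j) ℤ).vars :=
        mem_vars_iff_mem_support _ |>.2 ⟨m, hm, by simpa using h0⟩
      obtain ⟨s, -, hs⟩ := Finset.mem_image.1 (vars_rename _ _ h2)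
      exact s.2 (by rw [hs])
    rw [hP', degreeOf_mul_eq hP0 hP0'] at h1
    omega
  refine Nat.eq_zero_of_le_zero (Finset.sup_le fun m hm => ?_)
  refine (Finset.sum_eq_zero fun a _ => ?_).le
  exact Nat.eq_zero_of_le_zero ((monomial_le_degreeOf _ hm).trans (hd a).le)

/-- `E` generates the ideal of polynomials vanishing on systems with a common root. -/
def IsElim {κ : Type*} [Fintype κ] (e : ∀ j, α j → κ → ℤ) (E : MvPolynomial (Σ j, α j) ℤ) : Prop :=
  Irreducible E ∧ ∀ P, VanishesOnRoots e P ↔ E ∣ P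

theorem IsElim.isFreeOff {κ : Type*} [Fintype κ] {e : ∀ j, α j → κ → ℤ}
    {E : MvPolynomial (Σ j, α j) ℤ} (hE : IsElim e E) {i : ι} (hi : slotDeg i E ≠ 0) :
    IsFreeOff e i := by
  intro Q hQ
  by_contra h0
  exact hi (slotDeg_eq_zero_of_dvd_rename h0 ((hE.2 _).1 hQ))

end SlotDegree

end

section

open MvPolynomial

section Comparison

variable {ι : Type*} [Fintype ι] {α : ι → Type*} [∀ j, Fintype (α j)]

theorem isUnit_int_mvPolynomial {τ : Type*} {b : MvPolynomial τ ℤ} (hb : IsUnit b) :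
    b = 1 ∨ b = -1 := by
  obtain ⟨k, hk, rfl⟩ := MvPolynomial.isUnit_iff_eq_C_of_isReduced.1 hb
  rcases Int.isUnit_iff.1 hk with rfl | rfl <;> simp

theorem continuous_slotJoin (i : ι) (u : α i → ℂ) :
    Continuous fun w : Off α i → ℂ => slotJoin i u w := by
  refine continuous_pi fun s => ?_
  obtain ⟨t, rfl⟩ := (slotEquiv α i).surjective s
  cases t with
  | inl a =>
    rw [slotEquiv_inl]; simp only [slotJoin_slot]; exact continuous_const
  | inr s =>
    rw [slotEquiv_inr]; simp only [slotJoin_off]; exact continuous_apply s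

theorem polydiscNorm_pow_le_of_isGeneric {i : ι} {P Q : MvPolynomial (Σ j, α j) ℤ} {K δ : ℕ} {C : ℝ}
    (hC : 0 ≤ C) {r : (Σ j, α j) → ℝ} (hr : ∀ s, 0 < r s) (hi : ∀ a, r ⟨i, a⟩ = 1)
    (h : ∀ w : Off α i → ℂ, IsGeneric w → ∀ u : α i → ℂ, (∀ a, ‖u a‖ ≤ 1) →
      ∃ u' : α i → ℂ, (∀ a, ‖u' a‖ ≤ 1) ∧
        ‖aeval (slotJoin i u w) P‖ ^ K ≤ C * ‖aeval (slotJoin i u' w) Q‖ ^ δ) :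
    polydiscNorm r P ^ K ≤ C * polydiscNorm r Q ^ δ := by
  obtain ⟨x, hx, he⟩ := exists_polydiscNorm_eq (fun s => (hr s).le) P
  let S : Set (Off α i → ℂ) := {w | ‖aeval (slotJoin i (fun a => x ⟨i, a⟩) w) P‖ ^ K ≤
    C * polydiscNorm r Q ^ δ}
  have hS : IsClosed S := isClosed_le
    (((continuous_aeval_int P).comp (continuous_slotJoin i _)).norm.pow K) continuous_const
  let U : Set (Off α i → ℂ) := Set.pi Set.univ fun s => Metric.ball 0 (r s.1)
  have hU : IsOpen U := isOpen_set_pi Set.finite_univ fun s _ => Metric.isOpen_ball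
  have h1 : U ∩ {w | IsGeneric w} ⊆ S := by
    rintro w ⟨hw, hg⟩
    obtain ⟨u', hu', hle⟩ := h w hg (fun a => x ⟨i, a⟩) fun a => (hx _).trans (hi a).le
    refine hle.trans (mul_le_mul_of_nonneg_left (pow_le_pow_left₀ (norm_nonneg _) ?_ _) hC)
    refine norm_aeval_le_polydiscNorm Q fun s => ?_
    obtain ⟨t, rfl⟩ := (slotEquiv α i).surjective s
    cases t with
    | inl a => rw [slotEquiv_inl, slotJoin_slot, hi]; exact hu' a
    | inr s =>
      rw [slotEquiv_inr, slotJoin_off]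
      have := hw s (Set.mem_univ _)
      rw [mem_ball_zero_iff] at this
      exact this.le
  have h2 : closure U ⊆ S := by
    refine closure_minimal ?_ hS
    exact ((dense_isGeneric (Off α i) ℂ).open_subset_closure_inter hU).trans
      (closure_minimal h1 hS)
  have h3 : (fun s : Off α i => x s.1) ∈ closure U := by
    rw [closure_pi_set]
    intro s _
    show x s.1 ∈ closure (Metric.ball 0 (r s.1))
    rw [closure_ball _ (hr _).ne']
    simpa using hx s.1
  have h4 := h2 h3
  simp only [S, Set.mem_ofPred_eq, slotJoin_self] at h4
  rwa [he]

theorem polydiscNorm_pow_le_iff_deg [DecidableEq ι] {P Q : MvPolynomial (Σ j, α j) ℤ} (hP : P ≠ 0)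
    {K δ : ℕ} {C : ℝ} (hC : 0 ≤ C) (j : ι)
    (h : ∀ R : ℝ, 1 ≤ R → polydiscNorm (slotRadius α j R) P ^ K ≤
      C * polydiscNorm (slotRadius α j R) Q ^ δ) : K * slotDeg j P ≤ δ * slotDeg j Q := by
  obtain ⟨C', hC', hle⟩ := polydiscNorm_le_pow_slotDeg j Q
  refine le_of_forall_pow_le (C := C * C' ^ δ) fun R hR => ?_
  have hR0 : 0 ≤ R := zero_le_one.trans hR
  calc R ^ (K * slotDeg j P) = (R ^ slotDeg j P) ^ K := by rw [← pow_mul, mul_comm]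
    _ ≤ polydiscNorm (slotRadius α j R) P ^ K :=
      pow_le_pow_left₀ (by positivity) (pow_slotDeg_le_polydiscNorm j hP hR0) _
    _ ≤ C * polydiscNorm (slotRadius α j R) Q ^ δ := h R hR
    _ ≤ C * (C' * R ^ slotDeg j Q) ^ δ := mul_le_mul_of_nonneg_left
      (pow_le_pow_left₀ (polydiscNorm_nonneg _ _) (hle R hR) _) hC
    _ = C * C' ^ δ * R ^ (δ * slotDeg j Q) := by rw [mul_pow, ← pow_mul, mul_comm δ]; ring

variable {κ : Type*} [Fintype κ] [DecidableEq ι]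

/-- Scaling the exponents of a slot changes the eliminant in a controlled way. -/
theorem IsElim.exists_update (hcard : Fintype.card ι = Fintype.card κ + 1) (p : ∀ j, α j)
    {e : ∀ j, α j → κ → ℤ} {E : MvPolynomial (Σ j, α j) ℤ} (hE : IsElim e E) {i : ι}
    (hi : slotDeg i E ≠ 0) (K : ℕ) :
    ∃ E' δ, IsElim (Function.update e i (K • e i)) E' ∧ 0 < δ ∧ slotDeg i E = δ * slotDeg i E' ∧
      (∀ j, j ≠ i → K * slotDeg j E = δ * slotDeg j E') ∧
      K * Real.log (polydiscNorm 1 E) ≤ slotDeg i E * (K * Real.log (Fintype.card (α i)) +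
        Fintype.card (α i) * Real.log 2) + δ * Real.log (polydiscNorm 1 E') := by
  classical
  have : Nonempty (α i) := ⟨p i⟩
  obtain ⟨z, hz, hzP⟩ := exists_linForm_dvd_iff hcard p (hE.isFreeOff hi)
  obtain ⟨S', c', -, hS', hS'P, -⟩ := exists_prime_dvd_iff_linForm_dvd
    (MvPolynomial (Off α i) ℤ) (FractionRing (MvPolynomial (Off α i) ℤ)) (z := z ^ K) (a₀ := p i)
    (by simp [hz])
  let E' : MvPolynomial (Σ j, α j) ℤ := (slotSplit i).symm S'
  have hSE' : slotSplit i E' = S' := (slotSplit i).apply_symm_apply S'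
  have hdvd : ∀ P Q : MvPolynomial (Σ j, α j) ℤ, slotSplit i P ∣ slotSplit i Q ↔ P ∣ Q :=
    fun P Q => map_dvd_iff (slotSplit i)
  have hE' : IsElim (Function.update e i (K • e i)) E' := by
    refine ⟨((MulEquiv.prime_iff (slotSplit i).toMulEquiv).1 (by
      show Prime (slotSplit i E'); rwa [hSE'])).irreducible, fun P => ?_⟩
    rw [hzP, ← hdvd, hSE', hS'P]
  have hE1 : ∀ P : MvPolynomial (α i) (MvPolynomial (Off α i) ℤ), slotSplit i E ∣ P ↔
      linForm z ∣ map (algebraMap _ (OffField α i)) P := by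
    intro P
    obtain ⟨P, rfl⟩ := (slotSplit i).surjective P
    have := hzP 1 P
    rw [pow_one, one_smul, Function.update_eq_self] at this
    rw [hdvd, ← hE.2, this]
  have hEirr : Irreducible (slotSplit i E) := (MulEquiv.irreducible_iff (slotSplit i).toMulEquiv).2 hE.1
  obtain ⟨δ, D, D', hδ, hDD, hmain⟩ := exists_norm_eval₂_comparison
    (FractionRing (MvPolynomial (Off α i) ℤ)) (L := OffField α i) hz K hEirr hS'.irreducible hE1 hS'P
  have hgen : ∀ w : Off α i → ℂ, IsGeneric w →
      (∀ (u : α i → ℂ) (r : ℂ), aeval (slotJoin i (r • u) w) E = r ^ D * aeval (slotJoin i u w) E) ∧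
      (∀ (u : α i → ℂ) (r : ℂ), aeval (slotJoin i (r • u) w) E' = r ^ D' * aeval (slotJoin i u w) E') ∧
      (∀ u : α i → ℂ, (∀ a, ‖u a‖ ≤ 1) → ∃ u' : α i → ℂ, (∀ a, ‖u' a‖ ≤ 1) ∧
        ‖aeval (slotJoin i u w) E‖ ^ K ≤ (Fintype.card (α i) : ℝ) ^ (K * D) *
          (2 ^ Fintype.card (α i)) ^ D * ‖aeval (slotJoin i u' w) E'‖ ^ δ) ∧
      (∀ u : α i → ℂ, (∀ a, ‖u a‖ ≤ 1) → ∃ u' : α i → ℂ, (∀ a, ‖u' a‖ ≤ 1) ∧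
        ‖aeval (slotJoin i u w) E'‖ ^ δ ≤ (Fintype.card (α i) : ℝ) ^ D *
          (2 ^ Fintype.card (α i)) ^ (K * D) * ‖aeval (slotJoin i u' w) E‖ ^ K) := by
    intro w hw
    obtain ⟨φ, hφ, -⟩ := hw.exists_lift
    have h1 := hmain φ (fun b hb => by
      rcases isUnit_int_mvPolynomial hb with rfl | rfl <;> simp)
    have h2 : ∀ (u : α i → ℂ) P, eval₂ (φ.comp (algebraMap _ _)) u (slotSplit i P) =
        aeval (slotJoin i u w) P := by
      intro u P
      rw [eval₂_slotSplit]
      simp only [RingHom.comp_apply, hφ, aeval_X]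
    rw [← hSE'] at h1
    simpa only [h2] using h1
  have hhom : ∀ (P : MvPolynomial (Σ j, α j) ℤ) (d : ℕ),
      (∀ w : Off α i → ℂ, IsGeneric w → ∀ (u : α i → ℂ) (r : ℂ),
        aeval (slotJoin i (r • u) w) P = r ^ d * aeval (slotJoin i u w) P) →
      ∀ (u : α i → ℂ) (w : Off α i → ℂ) (r : ℂ),
        aeval (slotJoin i (r • u) w) P = r ^ d * aeval (slotJoin i u w) P := by
    intro P d hP u w r
    have := Continuous.ext_on (dense_isGeneric (Off α i) ℂ)
      (f := fun w => aeval (slotJoin i (r • u) w) P)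
      (g := fun w => r ^ d * aeval (slotJoin i u w) P)
      ((continuous_aeval_int P).comp (continuous_slotJoin i _))
      (continuous_const.mul ((continuous_aeval_int P).comp (continuous_slotJoin i _)))
      (fun w hw => hP w hw u r)
    exact congrFun this w
  have hD : slotDeg i E = D :=
    slotDeg_eq_of_smul i hE.1.ne_zero (hhom E D fun w hw => (hgen w hw).1)
  have hD' : slotDeg i E' = D' :=
    slotDeg_eq_of_smul i hE'.1.ne_zero (hhom E' D' fun w hw => (hgen w hw).2.1)
  have hcmp : ∀ r : (Σ j, α j) → ℝ, (∀ s, 0 < r s) → (∀ a, r ⟨i, a⟩ = 1) →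
      polydiscNorm r E ^ K ≤ (Fintype.card (α i) : ℝ) ^ (K * D) *
          (2 ^ Fintype.card (α i)) ^ D * polydiscNorm r E' ^ δ ∧
      polydiscNorm r E' ^ δ ≤ (Fintype.card (α i) : ℝ) ^ D *
          (2 ^ Fintype.card (α i)) ^ (K * D) * polydiscNorm r E ^ K := fun r hr hri =>
    ⟨polydiscNorm_pow_le_of_isGeneric (by positivity) hr hri fun w hw => (hgen w hw).2.2.1,
      polydiscNorm_pow_le_of_isGeneric (by positivity) hr hri fun w hw => (hgen w hw).2.2.2⟩
  refine ⟨E', δ, hE', hδ, by rw [hD, hD', hDD], fun j hj => ?_, ?_⟩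
  · have hrad : ∀ R : ℝ, 1 ≤ R → (∀ s, 0 < slotRadius α j R s) ∧ ∀ a, slotRadius α j R ⟨i, a⟩ = 1 :=
      fun R hR => ⟨slotRadius_pos (by linarith) j, fun a => by simp [slotRadius, hj.symm]⟩
    apply le_antisymm
    · exact polydiscNorm_pow_le_iff_deg hE.1.ne_zero (by positivity) j fun R hR =>
        (hcmp _ (hrad R hR).1 (hrad R hR).2).1
    · exact polydiscNorm_pow_le_iff_deg hE'.1.ne_zero (by positivity) j fun R hR =>
        (hcmp _ (hrad R hR).1 (hrad R hR).2).2
  · have h1 := (hcmp 1 (fun _ => one_pos) fun _ => rfl).1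
    have hp1 := one_le_polydiscNorm hE.1.ne_zero
    have hp2 := one_le_polydiscNorm hE'.1.ne_zero
    have hc : (0 : ℝ) < Fintype.card (α i) := by exact_mod_cast Fintype.card_pos
    have h2 := Real.log_le_log (by positivity) h1
    rw [Real.log_mul (by positivity) (by positivity), Real.log_mul (by positivity) (by positivity),
      Real.log_pow, Real.log_pow, Real.log_pow, Real.log_pow, Real.log_pow] at h2
    rw [hD]
    push_cast at h2
    linarith

end Comparison

end

section

open MvPolynomial

section Chain

variable {ι : Type*} [Fintype ι] {α : ι → Type*} [∀ j, Fintype (α j)]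

theorem aeval_congr_of_slotDeg {P : MvPolynomial (Σ j, α j) ℤ} {c c' : (Σ j, α j) → ℂ}
    (h : ∀ s, slotDeg s.1 P ≠ 0 → c s = c' s) : aeval c P = aeval c' P := by
  rw [aeval_def, aeval_def, eval₂_eq', eval₂_eq']
  refine Finset.sum_congr rfl fun m hm => ?_
  congr 1
  refine Finset.prod_congr rfl fun s _ => ?_
  by_cases hs : m s = 0
  · rw [hs, pow_zero, pow_zero]
  · rw [h]
    intro h0
    have h1 := Finset.le_sup (f := fun m : (Σ j, α j) →₀ ℕ => ∑ a, m ⟨s.1, a⟩) hm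
    rw [← slotDeg, h0] at h1
    have h2 := Finset.single_le_sum (f := fun a => m ⟨s.1, a⟩) (fun _ _ => Nat.zero_le _)
      (Finset.mem_univ s.2)
    exact hs (by simpa using h2.trans h1)

variable [DecidableEq ι] {κ : Type*} [Fintype κ]

theorem IsElim.exists_slotDeg_ne_zero {e : ∀ j, α j → κ → ℤ} {E : MvPolynomial (Σ j, α j) ℤ}
    (hE : IsElim e E) : ∃ i, slotDeg i E ≠ 0 := by
  by_contra! h
  have h1 : ∀ c : (Σ j, α j) → ℂ, aeval c E = 0 := by
    intro c
    rw [aeval_congr_of_slotDeg (c' := 0) fun s hs => absurd (h _) hs]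
    exact (hE.2 E).2 dvd_rfl 0 1 fun j _ => by simp
  obtain ⟨w, hw⟩ := (dense_isGeneric (Σ j, α j) ℂ).nonempty
  exact hE.1.ne_zero (hw E (h1 w))

/-- Scale the exponents of the slots in `T`. -/
def scaleSlots (e : ∀ j, α j → κ → ℤ) (K : ℕ) (T : Finset ι) (j : ι) : α j → κ → ℤ :=
  if j ∈ T then K • e j else e j

theorem scaleSlots_insert (e : ∀ j, α j → κ → ℤ) (K : ℕ) {T : Finset ι} {i : ι} (hi : i ∉ T) :
    scaleSlots e K (insert i T) =
      Function.update (scaleSlots e K T) i (K • scaleSlots e K T i) := by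
  funext j
  by_cases hj : j = i
  · subst hj
    simp [scaleSlots, hi]
  · simp [scaleSlots, hj]

theorem IsElim.exists_scaleSlots (hcard : Fintype.card ι = Fintype.card κ + 1) (p : ∀ j, α j)
    {e : ∀ j, α j → κ → ℤ} {E : MvPolynomial (Σ j, α j) ℤ} (hE : IsElim e E) {K : ℕ} (hK : 0 < K)
    (T : Finset ι) (hT : ∀ i ∈ T, slotDeg i E ≠ 0) :
    ∃ E' : MvPolynomial (Σ j, α j) ℤ, ∃ μ : ℝ, IsElim (scaleSlots e K T) E' ∧ 0 < μ ∧
      (∀ j, j ∉ T → (slotDeg j E' : ℝ) = μ * slotDeg j E) ∧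
      (∀ j ∈ T, K * (slotDeg j E' : ℝ) = μ * slotDeg j E) ∧
      Real.log (polydiscNorm 1 E) ≤ ∑ j ∈ T, slotDeg j E * (Real.log (Fintype.card (α j)) +
        Fintype.card (α j) * Real.log 2 / K) + μ⁻¹ * Real.log (polydiscNorm 1 E') := by
  induction T using Finset.induction_on with
  | empty =>
    have h0 : scaleSlots e K ∅ = e := by funext j; simp [scaleSlots]
    exact ⟨E, 1, by rwa [h0], one_pos, by simp, by simp, by simp⟩
  | insert i T hiT ih =>
    obtain ⟨E₁, μ, hE₁, hμ, hout, hin, hlog⟩ := ih fun j hj => hT j (Finset.mem_insert_of_mem hj)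
    have hK' : (0 : ℝ) < K := by exact_mod_cast hK
    have hdi : (slotDeg i E₁ : ℝ) = μ * slotDeg i E := hout i hiT
    have hi0 : slotDeg i E₁ ≠ 0 := by
      have h1 : (slotDeg i E : ℝ) ≠ 0 := by exact_mod_cast hT i (Finset.mem_insert_self _ _)
      have h2 : (slotDeg i E₁ : ℝ) ≠ 0 := by rw [hdi]; positivity
      exact_mod_cast h2
    obtain ⟨E', δ, hE', hδ, hdegi, hdegj, hle⟩ := hE₁.exists_update hcard p hi0 K
    have hδ' : (0 : ℝ) < δ := by exact_mod_cast hδ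
    have hj' : ∀ j, j ≠ i → (slotDeg j E' : ℝ) = K / δ * slotDeg j E₁ := by
      intro j hj
      have : (K : ℝ) * slotDeg j E₁ = δ * slotDeg j E' := by exact_mod_cast hdegj j hj
      field_simp; linarith
    have hi' : (slotDeg i E' : ℝ) = slotDeg i E₁ / δ := by
      rw [hdegi]; push_cast; field_simp
    refine ⟨E', K / δ * μ, by rwa [scaleSlots_insert e K hiT], by positivity, ?_, ?_, ?_⟩
    · intro j hj
      rw [Finset.mem_insert, not_or] at hj
      rw [hj' j hj.1, hout j hj.2]; ring
    · intro j hj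
      by_cases hji : j = i
      · subst hji
        rw [hi', hdi]; field_simp
      · rw [hj' j hji, mul_left_comm, hin j ((Finset.mem_insert.1 hj).resolve_left hji)]; ring
    · rw [Finset.sum_insert hiT]
      have h1 : Real.log (polydiscNorm 1 E₁) ≤ slotDeg i E₁ * (Real.log (Fintype.card (α i)) +
          Fintype.card (α i) * Real.log 2 / K) + δ / K * Real.log (polydiscNorm 1 E') := by
        rw [← mul_le_mul_iff_right₀ hK']
        refine hle.trans (le_of_eq ?_)
        field_simp
      have h2 := mul_le_mul_of_nonneg_left h1 (inv_nonneg.2 hμ.le)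
      rw [hdi] at h2
      have h3 : μ⁻¹ * (μ * (slotDeg i E : ℝ) * (Real.log (Fintype.card (α i)) +
          Fintype.card (α i) * Real.log 2 / K) + δ / K * Real.log (polydiscNorm 1 E')) =
          slotDeg i E * (Real.log (Fintype.card (α i)) +
          Fintype.card (α i) * Real.log 2 / K) + (K / δ * μ)⁻¹ * Real.log (polydiscNorm 1 E') := by
        field_simp
      linarith

theorem polydiscNorm_neg (r : (Σ j, α j) → ℝ) (P : MvPolynomial (Σ j, α j) ℤ) :
    polydiscNorm r (-P) = polydiscNorm r P := by
  simp [polydiscNorm]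

theorem slotDeg_neg (i : ι) (P : MvPolynomial (Σ j, α j) ℤ) : slotDeg i (-P) = slotDeg i P := by
  simp [slotDeg, support_neg]

/-- The Mahler-type bound for the sup norm of an eliminant. -/
theorem IsElim.log_polydiscNorm_le (hcard : Fintype.card ι = Fintype.card κ + 1) (p : ∀ j, α j)
    {e : ∀ j, α j → κ → ℤ} {E : MvPolynomial (Σ j, α j) ℤ} (hE : IsElim e E) :
    Real.log (polydiscNorm 1 E) ≤ ∑ j, slotDeg j E * Real.log (Fintype.card (α j)) := by
  classical
  let T : Finset ι := Finset.univ.filter fun i => slotDeg i E ≠ 0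
  have hmem : ∀ j, j ∈ T ↔ slotDeg j E ≠ 0 := fun j => by simp [T]
  set X := Real.log (polydiscNorm 1 E) with hX
  set A := ∑ j, slotDeg j E * Real.log (Fintype.card (α j)) with hA
  let B : ℝ := ∑ j, slotDeg j E * (Fintype.card (α j) * Real.log 2)
  have key : ∀ K : ℕ, 0 < K → K * (X - A) ≤ X + B := by
    intro K hK
    have hK' : (0 : ℝ) < K := by exact_mod_cast hK
    obtain ⟨E', μ, hE', hμ, -, hin, hlog⟩ := hE.exists_scaleSlots hcard p hK T fun i hi => (hmem i).1 hi
    have hvan : VanishesOnRoots (scaleSlots e K T) E := by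
      intro c ξ hc
      rw [aeval_congr_of_slotDeg (c' := fun s => if s.1 ∈ T then c s else 0)
        fun s hs => by rw [if_pos ((hmem _).2 hs)]]
      refine (hE.2 E).2 dvd_rfl _ (ξ ^ K) fun j _ => ?_
      by_cases hj : j ∈ T
      · simp only [if_pos hj]
        rw [← hc j (Set.mem_univ _)]
        refine Finset.sum_congr rfl fun a _ => ?_
        rw [scaleSlots, if_pos hj, Pi.smul_apply, torusChar_nsmul, torusChar_pow]
      · simp [hj]
    have hass : Associated E' E := hE'.1.associated_of_dvd hE.1 ((hE'.2 E).1 hvan)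
    have hEE : E' = E ∨ E' = -E := by
      obtain ⟨v, hv⟩ := hass.symm
      rcases isUnit_int_mvPolynomial v.isUnit with h | h
      · left; rw [← hv, h, mul_one]
      · right; rw [← hv, h]; ring
    have hdeg : ∀ j, slotDeg j E' = slotDeg j E := by
      intro j; rcases hEE with rfl | rfl
      · rfl
      · exact slotDeg_neg j E
    have hnorm : polydiscNorm 1 E' = polydiscNorm 1 E := by
      rcases hEE with rfl | rfl
      · rfl
      · exact polydiscNorm_neg 1 E
    obtain ⟨i, hi⟩ := hE.exists_slotDeg_ne_zero
    have hμK : μ = K := by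
      have h1 := hin i ((hmem i).2 hi)
      rw [hdeg] at h1
      exact (mul_right_cancel₀ (by exact_mod_cast hi) h1).symm
    rw [hnorm, ← hX, hμK, Finset.sum_subset (Finset.subset_univ T) fun j _ hj => by
      have h0 : slotDeg j E = 0 := by
        by_contra h0
        exact hj ((hmem j).2 h0)
      rw [h0]; simp] at hlog
    have h3 : ∑ j, (slotDeg j E : ℝ) * (Real.log (Fintype.card (α j)) +
        Fintype.card (α j) * Real.log 2 / K) = A + B / K := by
      rw [hA, Finset.sum_div, ← Finset.sum_add_distrib]
      refine Finset.sum_congr rfl fun j _ => ?_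
      ring
    rw [h3] at hlog
    have h4 := mul_le_mul_of_nonneg_left hlog hK'.le
    have h5 : (K : ℝ) * (A + B / K + (K : ℝ)⁻¹ * X) = K * A + B + X := by field_simp
    linarith
  by_contra! hlt
  obtain ⟨K, hK⟩ := exists_nat_gt ((X + B) / (X - A))
  have h0 : 0 < X - A := by linarith
  have h1 : X + B < (K + 1 : ℕ) * (X - A) := by
    rw [div_lt_iff₀ h0] at hK
    push_cast
    linarith
  linarith [key (K + 1) (Nat.succ_pos K)]

end Chain

end

section

open MvPolynomial

section RootCount

variable {ι κ : Type*} [Fintype κ] [Fintype ι] {α : ι → Type*} [∀ j, Fintype (α j)]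

theorem exists_isGeneric_rootParam_mem (p : ∀ j, α j) (e : ∀ j, α j → κ → ℤ)
    {U : Set ((Σ j, α j) → ℂ)} (hU : IsOpen U) {c : (Σ j, α j) → ℂ} (hc : c ∈ U) {ξ₀ : κ → ℂˣ}
    (hξ₀ : IsSystemRoot e Set.univ c ξ₀) :
    ∃ (u : (Σ j, α j) → ℂ) (ξ : κ → ℂˣ), IsGeneric (Sum.elim u fun l => (ξ l : ℂ)) ∧
      rootParam p e u ξ ∈ U := by
  classical
  let G : ((Σ j, α j) ⊕ κ → ℂ) → (Σ j, α j) → ℂ := fun θ s =>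
    if s.2 = p s.1 then
      -∑ a ∈ Finset.univ.erase (p s.1), θ (Sum.inl ⟨s.1, a⟩) *
        ∏ l, θ (Sum.inr l) ^ (e s.1 a - e s.1 (p s.1)) l
    else θ (Sum.inl s)
  have hG : ∀ (u : (Σ j, α j) → ℂ) (ξ : κ → ℂˣ), G (Sum.elim u fun l => (ξ l : ℂ)) =
      rootParam p e u ξ := by
    intro u ξ
    funext s
    simp only [G, rootParam, torusChar, Sum.elim_inl, Sum.elim_inr, Units.coe_prod,
      Units.val_zpow_eq_zpow_val]
  let θ₀ : (Σ j, α j) ⊕ κ → ℂ := Sum.elim c fun l => (ξ₀ l : ℂ)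
  have hcont : ContinuousAt G θ₀ := by
    refine continuousAt_pi.2 fun s => ?_
    by_cases hs : s.2 = p s.1
    · simp only [G, if_pos hs]
      refine ContinuousAt.neg (tendsto_finsetSum _ fun a _ => ?_)
      refine ContinuousAt.mul (continuous_apply _).continuousAt (tendsto_finsetProd _ fun l _ => ?_)
      exact ContinuousAt.zpow₀ (continuous_apply (Sum.inr l)).continuousAt _ (Or.inl (ξ₀ l).ne_zero)
    · simp only [G, if_neg hs]
      exact (continuous_apply _).continuousAt
  have h1 : ∀ᶠ θ in nhds θ₀, G θ ∈ U ∧ ∀ l, θ (Sum.inr l) ≠ 0 := by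
    refine Filter.Eventually.and ?_ ?_
    · refine hcont.eventually (hU.mem_nhds ?_)
      rw [hG, rootParam_eq_of_isSystemRoot p e hξ₀]
      exact hc
    · rw [Filter.eventually_all]
      intro l
      exact (continuous_apply (Sum.inr l)).continuousAt.eventually_ne (ξ₀ l).ne_zero
  obtain ⟨θ, hθ, hgen⟩ := mem_closure_iff_nhds.1 ((dense_isGeneric ((Σ j, α j) ⊕ κ) ℂ) θ₀) _ h1
  refine ⟨fun s => θ (Sum.inl s), fun l => Units.mk0 _ (hθ.2 l), ?_, ?_⟩
  · convert! hgen using 1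
    funext t
    cases t <;> rfl
  · rw [← hG]
    convert! hθ.1 using 2
    funext t
    cases t <;> rfl

theorem slotDeg_eq_card_galFinset [DecidableEq ι] {i : ι} {z : α i → OffField α i} {a₀ : α i}
    (hz : z a₀ = 1) {E : MvPolynomial (Σ j, α j) ℤ} (hE0 : E ≠ 0)
    (hE : ∀ P, slotSplit i E ∣ P ↔ linForm z ∣ map (algebraMap _ (OffField α i)) P) :
    slotDeg i E = (galFinset (FractionRing (MvPolynomial (Off α i) ℤ)) z).card := by
  obtain ⟨c, -, hc⟩ := map_eq_C_mul_prod_of_dvd_iff (FractionRing (MvPolynomial (Off α i) ℤ)) hz hE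
  refine slotDeg_eq_of_smul i hE0 fun u w r => ?_
  have key : ∀ w : Off α i → ℂ, IsGeneric w → aeval (slotJoin i (r • u) w) E =
      r ^ (galFinset (FractionRing (MvPolynomial (Off α i) ℤ)) z).card *
        aeval (slotJoin i u w) E := by
    intro w hw
    obtain ⟨φ, hφ, -⟩ := hw.exists_lift
    have h2 : ∀ (u : α i → ℂ), eval₂ (φ.comp (algebraMap _ _)) u (slotSplit i E) =
        aeval (slotJoin i u w) E := by
      intro u
      rw [eval₂_slotSplit]
      simp only [RingHom.comp_apply, hφ, aeval_X]
    have := eval₂_smul_of_map_eq hc φ u r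
    rwa [h2, h2] at this
  exact congrFun (Continuous.ext_on (dense_isGeneric (Off α i) ℂ)
      (f := fun w => aeval (slotJoin i (r • u) w) E)
      ((continuous_aeval_int E).comp (continuous_slotJoin i _))
      (continuous_const.mul ((continuous_aeval_int E).comp (continuous_slotJoin i _)))
      fun w hw => key w hw) w

/-- The generic coefficients outside the slot `i`. -/
noncomputable def offCoeff (α : ι → Type*) (i : ι) : (Σ j, α j) → OffField α i :=
  slotJoin i 0 fun s => algebraMap (MvPolynomial (Off α i) ℤ) _ (X s)

theorem offCoeff_off {i : ι} (s : Off α i) : offCoeff α i s.1 =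
    algebraMap (MvPolynomial (Off α i) ℤ) _ (X s) := slotJoin_off i _ _ s

theorem isSystemRoot_offCoeff_iff {K : Type*} [Field K] {e : ∀ j, α j → κ → ℤ} {i : ι}
    {c : (Σ j, α j) → K} {φ : OffField α i →+* K}
    (hφ : ∀ s : Off α i, φ (algebraMap (MvPolynomial (Off α i) ℤ) _ (X s)) = c s.1)
    (η : κ → (OffField α i)ˣ) :
    IsSystemRoot e {i}ᶜ c (fun l => Units.map (φ : OffField α i →* K) (η l)) ↔
      IsSystemRoot e {i}ᶜ (offCoeff α i) η := by
  rw [← isSystemRoot_map_iff φ]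
  refine isSystemRoot_congr (fun s hs => ?_) _
  rw [offCoeff_off ⟨s, hs⟩, hφ]

theorem IsElim.exists_finset_roots [DecidableEq ι] (hcard : Fintype.card ι = Fintype.card κ + 1)
    (p : ∀ j, α j) {e : ∀ j, α j → κ → ℤ} {E : MvPolynomial (Σ j, α j) ℤ} (hE : IsElim e E) {i : ι}
    (hi : slotDeg i E ≠ 0) {U : Set ((Σ j, α j) → ℂ)} (hU : IsOpen U)
    (hne : ∃ c ∈ U, ∃ ξ, IsSystemRoot e Set.univ c ξ) {d : ℕ} (hd : 0 < d)
    (hUd : ∀ c ∈ U, (∃ ξ, IsSystemRoot e Set.univ c ξ) →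
      Nat.card {ξ // IsSystemRoot e Set.univ c ξ} = d) :
    ∃ H : Finset (κ → (OffField α i)ˣ), (∀ η ∈ H, IsSystemRoot e {i}ᶜ (offCoeff α i) η) ∧
      H.card = d * slotDeg i E := by
  classical
  have hfree := hE.isFreeOff hi
  obtain ⟨c, hcU, ξ₀, hξ₀⟩ := hne
  obtain ⟨u, ξ, hθ, hx⟩ := exists_isGeneric_rootParam_mem p e hU hcU hξ₀
  set x := rootParam p e u ξ with hxdef
  have hroot : IsSystemRoot e Set.univ x ξ := isSystemRoot_rootParam p e u ξ _
  have hd' := hUd x hx ⟨ξ, hroot⟩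
  have hw : IsGeneric fun s : Off α i => x s.1 := isGeneric_off_rootParam (p := p) hfree hθ
  obtain ⟨φ, hφB, hφ⟩ := hw.exists_lift
  have hφX : ∀ s : Off α i, φ (algebraMap (MvPolynomial (Off α i) ℤ) _ (X s)) = x s.1 := by
    intro s; rw [hφB, aeval_X]
  have hlift : ∀ ζ : {ξ // IsSystemRoot e Set.univ x ξ}, ∃ η : κ → (OffField α i)ˣ,
      (fun l => Units.map (φ : OffField α i →* ℂ) (η l)) = ζ.1 := fun ζ =>
    exists_lift_isSystemRoot (e := e) hcard p hw hφ fun j _ => ζ.2 j (Set.mem_univ _)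
  choose η hη using hlift
  have hηinj : Function.Injective η := by
    intro ζ ζ' h
    apply Subtype.ext
    rw [← hη, h, hη]
  let zz : (κ → (OffField α i)ˣ) → α i → OffField α i := fun η a =>
    torusChar η (e i a - e i (p i))
  have hzp : ∀ η, zz η (p i) = 1 := fun η => by simp [zz, torusChar_zero]
  let ζ₀ : {ξ // IsSystemRoot e Set.univ x ξ} := ⟨ξ, hroot⟩
  set z := zz (η ζ₀) with hzdef
  have hzeq : ∀ ζ, zz (η ζ) = z := by
    intro ζ
    have hval : ∀ ζ : {ξ // IsSystemRoot e Set.univ x ξ},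
        x ⟨i, p i⟩ = -∑ a ∈ Finset.univ.erase (p i), u ⟨i, a⟩ * φ (zz (η ζ) a) := by
      intro ζ
      rw [pivot_eq_of_isSystemRoot p ζ.2 (Set.mem_univ i)]
      congr 1
      refine Finset.sum_congr rfl fun a ha => ?_
      have hxa : x ⟨i, a⟩ = u ⟨i, a⟩ :=
        rootParam_of_ne p e u ξ (s := ⟨i, a⟩) (Finset.ne_of_mem_erase ha)
      have hζ : ((torusChar ζ.1 (e i a - e i (p i)) : ℂˣ) : ℂ) = φ (zz (η ζ) a) := by
        rw [← hη ζ, torusChar_map]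
        rfl
      rw [hxa, hζ]
    have h1 : eval₂ φ (fun a => u ⟨i, a⟩)
        (∑ a ∈ Finset.univ.erase (p i), C (zz (η ζ) a - z a) * X a) = 0 := by
      have h2 := (hval ζ).symm.trans (hval ζ₀)
      rw [neg_inj, ← sub_eq_zero, ← Finset.sum_sub_distrib] at h2
      rw [eval₂_sum, ← h2]
      refine Finset.sum_congr rfl fun a _ => ?_
      rw [eval₂_mul, eval₂_C, eval₂_X, map_sub, ← hzdef]
      ring
    have h3 := eq_zero_of_eval₂_slot hcard hfree hθ hφ h1
    funext a
    by_cases ha : a = p i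
    · rw [ha, hzp, hzdef, hzp]
    · have h4 := congrArg (coeff (Finsupp.single a 1)) h3
      simp only [coeff_sum, coeff_C_mul, coeff_X, coeff_zero] at h4
      rw [Finset.sum_eq_single a] at h4
      · simpa [sub_eq_zero] using h4
      · intro b _ hb
        rw [if_neg (by simpa [Finsupp.single_left_inj] using hb), mul_zero]
      · intro h; exact absurd (Finset.mem_erase.2 ⟨ha, Finset.mem_univ _⟩) h
  have hfin : Finite {ξ // IsSystemRoot e Set.univ x ξ} :=
    Nat.finite_of_card_ne_zero (by rw [hd']; exact hd.ne')
  have := Fintype.ofFinite {ξ // IsSystemRoot e Set.univ x ξ}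
  let H₀ : Finset (κ → (OffField α i)ˣ) := Finset.univ.image η
  have hH₀ : H₀.card = d := by
    rw [Finset.card_image_of_injective _ hηinj, Finset.card_univ, ← Nat.card_eq_fintype_card, hd']
  have hH₀root : ∀ η' ∈ H₀, IsSystemRoot e {i}ᶜ (offCoeff α i) η' ∧ zz η' = z := by
    intro η' hη'
    obtain ⟨ζ, -, rfl⟩ := Finset.mem_image.1 hη'
    refine ⟨?_, hzeq ζ⟩
    rw [← isSystemRoot_offCoeff_iff hφX, hη]
    exact fun j _ => ζ.2 j (Set.mem_univ _)
  let F := FractionRing (MvPolynomial (Off α i) ℤ)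
  let act : (OffField α i ≃ₐ[F] OffField α i) → (κ → (OffField α i)ˣ) → κ → (OffField α i)ˣ :=
    fun g η l => Units.map ((g : OffField α i →+* OffField α i) : OffField α i →* OffField α i) (η l)
  have hact_root : ∀ g η', IsSystemRoot e {i}ᶜ (offCoeff α i) η' →
      IsSystemRoot e {i}ᶜ (offCoeff α i) (act g η') := by
    intro g η' h
    refine (isSystemRoot_offCoeff_iff (φ := (g : OffField α i →+* OffField α i)) (fun s => ?_) η').2 h
    rw [offCoeff_off, IsScalarTower.algebraMap_apply _ F]
    exact g.commutes _
  have hact_zz : ∀ g η', zz (act g η') = fun a => g (zz η' a) := by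
    intro g η'
    funext a
    simp only [zz, act, torusChar_map]
    rfl
  have hact_inj : ∀ g, Function.Injective (act g) := by
    intro g η₁ η₂ h
    funext l
    ext
    exact g.injective (congrArg Units.val (congrFun h l))
  have hchoose : ∀ w : galFinset F z, ∃ g : OffField α i ≃ₐ[F] OffField α i,
      (fun a => g (z a)) = w.1 := fun w => mem_galFinset.1 w.2
  choose g hg using hchoose
  refine ⟨Finset.univ.biUnion fun w : galFinset F z => H₀.image (act (g w)), ?_, ?_⟩
  · intro η' hη'
    obtain ⟨w, -, hw'⟩ := Finset.mem_biUnion.1 hη'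
    obtain ⟨η₁, h1, rfl⟩ := Finset.mem_image.1 hw'
    exact hact_root _ _ (hH₀root _ h1).1
  · rw [Finset.card_biUnion]
    · have hsd : slotDeg i E = (galFinset F z).card := by
        refine slotDeg_eq_card_galFinset (a₀ := p i) (hzp _) hE.1.ne_zero fun P => ?_
        obtain ⟨P, rfl⟩ := (slotSplit i).surjective P
        have h5 := vanishesOnRoots_update_iff hcard hfree hθ hφB hφ (hη ζ₀) 1 P
        rw [pow_one, one_smul, Function.update_eq_self] at h5
        rw [map_dvd_iff (slotSplit i), ← hE.2]
        exact h5
      rw [hsd]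
      simp only [Finset.card_image_of_injective _ (hact_inj _), hH₀, Finset.sum_const,
        Finset.card_univ, Fintype.card_coe, smul_eq_mul]
      rw [mul_comm]
    · intro w _ w' _ hne
      rw [Function.onFun, Finset.disjoint_left]
      intro η' h1 h2
      obtain ⟨η₁, h1', rfl⟩ := Finset.mem_image.1 h1
      obtain ⟨η₂, h2', h3⟩ := Finset.mem_image.1 h2
      apply hne
      apply Subtype.ext
      have h4 := congrArg zz h3
      rw [hact_zz, hact_zz, (hH₀root _ h1').2, (hH₀root _ h2').2, hg, hg] at h4
      exact h4.symm

end RootCount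

end

section TropicalCells

variable {ι κ : Type*} [Fintype ι] [Fintype κ] {α : ι → Type*} [∀ j, Fintype (α j)]

/-- The exponent `e j a`, followed by the indicator of the slot `j`. -/
def cayleyCol [DecidableEq ι] (e : ∀ j, α j → κ → ℤ) (s : Σ j, α j) : κ ⊕ ι → ℝ :=
  Sum.elim (fun l => (e s.1 s.2 l : ℝ)) (Pi.single s.1 1)

/-- A weight `ω` is generic if the columns on which it is given by a linear form are independent. -/
def IsGenericWeight [DecidableEq ι] (e : ∀ j, α j → κ → ℤ) (ω : (Σ j, α j) → ℝ) : Prop :=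
  ∀ y : κ ⊕ ι → ℝ, LinearIndependent ℝ
    fun s : {s // ω s = ∑ t, y t * cayleyCol e s t} => cayleyCol e s.1

/-- The weight of a term after translation by `w`. -/
def tropCost (e : ∀ j, α j → κ → ℤ) (ω : (Σ j, α j) → ℝ) (w : κ → ℝ) (s : Σ j, α j) : ℝ :=
  ω s - ∑ l, w l * e s.1 s.2 l

open Classical in
/-- The terms of minimal weight within their slots. -/
noncomputable def tropArgmin (e : ∀ j, α j → κ → ℤ) (ω : (Σ j, α j) → ℝ) (w : κ → ℝ) :
    Finset (Σ j, α j) :=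
  Finset.univ.filter fun s => ∀ a, tropCost e ω w s ≤ tropCost e ω w ⟨s.1, a⟩

theorem mem_tropArgmin {e : ∀ j, α j → κ → ℤ} {ω : (Σ j, α j) → ℝ} {w : κ → ℝ} {s : Σ j, α j} :
    s ∈ tropArgmin e ω w ↔ ∀ a, tropCost e ω w s ≤ tropCost e ω w ⟨s.1, a⟩ := by
  simp [tropArgmin]

theorem exists_mem_tropArgmin (e : ∀ j, α j → κ → ℤ) (ω : (Σ j, α j) → ℝ) (w : κ → ℝ) (j : ι)
    [Nonempty (α j)] : ∃ a, (⟨j, a⟩ : Σ j, α j) ∈ tropArgmin e ω w := by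
  obtain ⟨a, ha⟩ := Finite.exists_min fun a : α j => tropCost e ω w ⟨j, a⟩
  exact ⟨a, mem_tropArgmin.2 ha⟩

variable [DecidableEq ι]

theorem sum_mul_cayleyCol (e : ∀ j, α j → κ → ℤ) (y : κ ⊕ ι → ℝ) (s : Σ j, α j) :
    ∑ t, y t * cayleyCol e s t = ∑ l, y (Sum.inl l) * e s.1 s.2 l + y (Sum.inr s.1) := by
  rw [Fintype.sum_sum_type]
  simp [cayleyCol, Pi.single_apply]

theorem sum_smul_cayleyCol_eq_iff (e : ∀ j, α j → κ → ℤ) (c : (Σ j, α j) → ℝ) (x : κ → ℝ)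
    (z : ι → ℝ) : ∑ s, c s • cayleyCol e s = Sum.elim x z ↔
      (∀ l, ∑ s : Σ j, α j, c s * e s.1 s.2 l = x l) ∧ ∀ j, ∑ a, c ⟨j, a⟩ = z j := by
  rw [funext_iff, Sum.forall]
  refine and_congr (forall_congr' fun l => ?_) (forall_congr' fun j => ?_)
  · simp [cayleyCol]
  · rw [Finset.sum_apply, ← Finset.univ_sigma_univ, Finset.sum_sigma, Finset.sum_eq_single j]
    · simp [cayleyCol]
    · intro b _ hb
      simp [cayleyCol, hb]
    · simp

theorem exists_of_not_linearIndepOn {e : ∀ j, α j → κ → ℤ} {B : Set (Σ j, α j)}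
    (hB : ¬ LinearIndepOn ℝ (cayleyCol e) B) : ∃ c : (Σ j, α j) → ℝ, c ≠ 0 ∧
      (∀ s, s ∉ B → c s = 0) ∧ ∑ s, c s • cayleyCol e s = 0 := by
  classical
  rw [linearIndepOn_iff] at hB
  push Not at hB
  obtain ⟨l, hl, h1, h2⟩ := hB
  refine ⟨l, fun h => h2 (DFunLike.coe_injective h), fun s hs => ?_, ?_⟩
  · by_contra h3
    exact hs (hl (Finsupp.mem_support_iff.2 h3))
  · rwa [Finsupp.linearCombination_apply, Finsupp.sum_fintype _ _ (by simp)] at h1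

theorem exists_isGenericWeight (e : ∀ j, α j → κ → ℤ) :
    ∃ ω : (Σ j, α j) → ℤ, IsGenericWeight e fun s => (ω s : ℝ) := by
  classical
  choose c hc0 hcB hc using fun B : {B : Set (Σ j, α j) // ¬ LinearIndepOn ℝ (cayleyCol e) B} =>
    exists_of_not_linearIndepOn B.2
  let q : MvPolynomial (Σ j, α j) ℝ := ∏ B, ∑ s, MvPolynomial.C (c B s) * MvPolynomial.X s
  have hq : q ≠ 0 := by
    refine Finset.prod_ne_zero_iff.2 fun B _ h => hc0 B (funext fun s => ?_)
    have h1 := congrArg (MvPolynomial.coeff (Finsupp.single s 1)) h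
    simpa [MvPolynomial.coeff_sum, MvPolynomial.coeff_C_mul, MvPolynomial.coeff_X,
      Finsupp.single_left_inj] using h1
  obtain ⟨x, hx, hxq⟩ : ∃ x ∈ Set.pi Set.univ fun _ : (Σ j, α j) => Set.range ((↑) : ℤ → ℝ),
      MvPolynomial.eval x q ≠ 0 := by
    by_contra! h
    exact hq (MvPolynomial.funext_set _ (fun _ => Set.infinite_range_of_injective Int.cast_injective)
      (by simpa using h))
  choose ω hω using fun s => hx s (Set.mem_univ s)
  refine ⟨ω, fun y => ?_⟩
  by_contra hdep
  let B : {B : Set (Σ j, α j) // ¬ LinearIndepOn ℝ (cayleyCol e) B} := ⟨_, hdep⟩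
  rw [map_prod, Finset.prod_ne_zero_iff] at hxq
  apply hxq B (Finset.mem_univ _)
  simp only [map_sum, map_mul, MvPolynomial.eval_C, MvPolynomial.eval_X]
  have h1 : ∀ s, c B s * x s = ∑ t, y t * (c B s • cayleyCol e s) t := by
    intro s
    by_cases hs : s ∈ B.1
    · rw [← hω s, show (ω s : ℝ) = _ from hs, Finset.mul_sum]
      refine Finset.sum_congr rfl fun t _ => ?_
      simp only [Pi.smul_apply, smul_eq_mul]
      ring
    · simp [hcB B s hs]
  simp only [h1]
  rw [Finset.sum_comm]
  refine Finset.sum_eq_zero fun t _ => ?_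
  rw [← Finset.mul_sum, ← Finset.sum_apply, hc, Pi.zero_apply, mul_zero]

/-- The nonnegative solutions of the system of the Cayley columns. -/
def cayleyFeasible (e : ∀ j, α j → κ → ℤ) (x : κ → ℝ) : Set ((Σ j, α j) → ℝ) :=
  {c | (∀ s, 0 ≤ c s) ∧ ∑ s, c s • cayleyCol e s = Sum.elim x 1}

theorem isCompact_cayleyFeasible (e : ∀ j, α j → κ → ℤ) (x : κ → ℝ) :
    IsCompact (cayleyFeasible e x) := by
  refine IsCompact.of_isClosed_subset (isCompact_Icc (a := (0 : (Σ j, α j) → ℝ)) (b := 1)) ?_ ?_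
  · refine IsClosed.inter ?_ ?_
    · have : IsClosed (⋂ s : Σ j, α j, {c : (Σ j, α j) → ℝ | 0 ≤ c s}) :=
        isClosed_iInter fun s => isClosed_le continuous_const (continuous_apply s)
      have h : {c : (Σ j, α j) → ℝ | ∀ s, 0 ≤ c s} = ⋂ s : Σ j, α j, {c | 0 ≤ c s} := by
        ext c
        simp
      change IsClosed {c : (Σ j, α j) → ℝ | ∀ s, 0 ≤ c s}
      rwa [h]
    · exact isClosed_eq (by fun_prop) continuous_const
  · rintro c ⟨h0, h1⟩
    refine ⟨fun s => h0 s, fun s => ?_⟩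
    have := ((sum_smul_cayleyCol_eq_iff e c x 1).1 h1).2 s.1
    refine le_trans ?_ this.le
    exact Finset.single_le_sum (f := fun a => c ⟨s.1, a⟩) (fun a _ => h0 _) (Finset.mem_univ s.2)

/-- An optimal solution of minimal support. -/
theorem exists_optimal_cayleyFeasible {e : ∀ j, α j → κ → ℤ} (ω : (Σ j, α j) → ℝ) {x : κ → ℝ}
    (hx : (cayleyFeasible e x).Nonempty) : ∃ c ∈ cayleyFeasible e x,
      (∀ c' ∈ cayleyFeasible e x, ∑ s, c s * ω s ≤ ∑ s, c' s * ω s) ∧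
      LinearIndepOn ℝ (cayleyCol e) {s | c s ≠ 0} := by
  classical
  obtain ⟨c₀, hc₀, hmin₀⟩ := (isCompact_cayleyFeasible e x).exists_isMinOn hx
    (f := fun c => ∑ s, c s * ω s) (by fun_prop)
  let S : Set ((Σ j, α j) → ℝ) := {c | c ∈ cayleyFeasible e x ∧
    ∀ c' ∈ cayleyFeasible e x, ∑ s, c s * ω s ≤ ∑ s, c' s * ω s}
  have hS : S.Nonempty := ⟨c₀, hc₀, fun c' hc' => hmin₀ hc'⟩
  let N : ((Σ j, α j) → ℝ) → ℕ := fun c => (Finset.univ.filter fun s => c s ≠ 0).card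
  obtain ⟨c, hcS, hcmin⟩ : ∃ c ∈ S, ∀ c' ∈ S, N c ≤ N c' :=
    ⟨Function.argminOn N S hS, Function.argminOn_mem N S hS,
      fun c' hc' => Function.argminOn_le N S hc'⟩
  refine ⟨c, hcS.1, hcS.2, ?_⟩
  by_contra hdep
  obtain ⟨m₀, hm₀, hm₀B, hm₀0⟩ := exists_of_not_linearIndepOn hdep
  obtain ⟨m, hm, hmB, hm0, hmω⟩ : ∃ m : (Σ j, α j) → ℝ, m ≠ 0 ∧ (∀ s, c s = 0 → m s = 0) ∧
      ∑ s, m s • cayleyCol e s = 0 ∧ ∑ s, m s * ω s ≤ 0 := by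
    rcases le_total (∑ s, m₀ s * ω s) 0 with h | h
    · exact ⟨m₀, hm₀, fun s hs => hm₀B s (by simpa using hs), hm₀0, h⟩
    · refine ⟨-m₀, neg_ne_zero.2 hm₀, fun s hs => ?_, ?_, ?_⟩
      · rw [Pi.neg_apply, hm₀B s (by simpa using hs), neg_zero]
      · simp [hm₀0]
      · simpa using h
  obtain ⟨s₀, hs₀⟩ : ∃ s, m s < 0 := by
    by_contra! h
    apply hm
    have h0 : Sum.elim (0 : κ → ℝ) (0 : ι → ℝ) = 0 := by ext t; cases t <;> rfl
    have h1 := ((sum_smul_cayleyCol_eq_iff e m 0 0).1 (hm0.trans h0.symm)).2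
    funext s
    exact (Finset.sum_eq_zero_iff_of_nonneg (fun a _ => h ⟨s.1, a⟩)).1 (h1 s.1) s.2
      (Finset.mem_univ _)
  obtain ⟨s₁, hs₁, hs₁min⟩ := Finset.exists_min_image (Finset.univ.filter fun s => m s < 0)
    (fun s => c s / (-m s)) ⟨s₀, by simpa using hs₀⟩
  simp only [Finset.mem_filter, Finset.mem_univ, true_and] at hs₁ hs₁min
  set t := c s₁ / (-m s₁) with ht
  have ht0 : 0 ≤ t := div_nonneg (hcS.1.1 _) (by linarith)
  have hc' : (fun s => c s + t * m s) ∈ S := by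
    refine ⟨⟨fun s => ?_, ?_⟩, fun c' hc' => ?_⟩
    · rcases le_or_gt 0 (m s) with h | h
      · exact add_nonneg (hcS.1.1 s) (mul_nonneg ht0 h)
      · have := (le_div_iff₀ (by linarith)).1 (hs₁min s h)
        change 0 ≤ c s + t * m s
        linarith
    · simp only [add_smul, mul_smul, Finset.sum_add_distrib]
      rw [← Finset.smul_sum, hm0, smul_zero, add_zero, hcS.1.2]
    · refine le_trans ?_ (hcS.2 c' hc')
      simp only [add_mul, mul_assoc, Finset.sum_add_distrib, ← Finset.mul_sum]
      nlinarith
  have hlt : N (fun s => c s + t * m s) < N c := by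
    refine Finset.card_lt_card (Finset.ssubset_iff_subset_ne.2 ⟨fun s hs => ?_, fun h => ?_⟩)
    · simp only [Finset.mem_filter, Finset.mem_univ, true_and] at hs ⊢
      intro h
      exact hs (by rw [h, hmB s h, mul_zero, add_zero])
    · have h1 : s₁ ∈ Finset.univ.filter fun s => c s ≠ 0 := by
        simp only [Finset.mem_filter, Finset.mem_univ, true_and]
        intro h
        exact hs₁.ne (hmB s₁ h)
      rw [← h] at h1
      simp only [Finset.mem_filter, Finset.mem_univ, true_and] at h1
      apply h1
      rw [ht]
      field_simp [hs₁.ne]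
      ring
  exact absurd (hcmin _ hc') (not_le.2 hlt)

end TropicalCells

section TropicalVolume

variable {ι κ : Type*} [Fintype ι] [Fintype κ] {α : ι → Type*} [∀ j, Fintype (α j)]

/-- The points where the columns of minimal weight form a basis. -/
def tropVertices (e : ∀ j, α j → κ → ℤ) (ω : (Σ j, α j) → ℝ) : Set (κ → ℝ) :=
  {w | (tropArgmin e ω w).card = Fintype.card κ + Fintype.card ι}

variable [DecidableEq ι]

/-- The open cell dual to `w` in the subdivision induced by `ω`. -/
def tropCell (e : ∀ j, α j → κ → ℤ) (ω : (Σ j, α j) → ℝ) (w : κ → ℝ) : Set (κ → ℝ) :=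
  {x | ∃ c : (Σ j, α j) → ℝ, (∀ s ∈ tropArgmin e ω w, 0 < c s) ∧
    (∀ s ∉ tropArgmin e ω w, c s = 0) ∧ ∑ s, c s • cayleyCol e s = Sum.elim x 1}

theorem tropCell_subset (e : ∀ j, α j → κ → ℤ) (ω : (Σ j, α j) → ℝ) (w : κ → ℝ) :
    tropCell e ω w ⊆ {x | (cayleyFeasible e x).Nonempty} := by
  rintro x ⟨c, h1, h2, h3⟩
  refine ⟨c, fun s => ?_, h3⟩
  by_cases hs : s ∈ tropArgmin e ω w
  · exact (h1 s hs).le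
  · exact (h2 s hs).ge

theorem convex_tropCell (e : ∀ j, α j → κ → ℤ) (ω : (Σ j, α j) → ℝ) (w : κ → ℝ) :
    Convex ℝ (tropCell e ω w) := by
  rintro x ⟨c, h1, h2, h3⟩ x' ⟨c', h1', h2', h3'⟩ a b ha hb hab
  refine ⟨a • c + b • c', fun s hs => ?_, fun s hs => ?_, ?_⟩
  · exact convex_Ioi (0 : ℝ) (h1 s hs) (h1' s hs) ha hb hab
  · simp [h2 s hs, h2' s hs]
  · simp only [Pi.add_apply, Pi.smul_apply, add_smul, Finset.sum_add_distrib, smul_assoc,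
      ← Finset.smul_sum, h3, h3']
    funext t
    cases t <;> simp [hab]

theorem LinearIndepOn.span_cayleyCol_eq_top {e : ∀ j, α j → κ → ℤ} {B : Finset (Σ j, α j)}
    (hB : LinearIndepOn ℝ (cayleyCol e) (B : Set (Σ j, α j)))
    (hcard : B.card = Fintype.card κ + Fintype.card ι) :
    Submodule.span ℝ (cayleyCol e '' B) = ⊤ := by
  have h := LinearIndependent.span_eq_top_of_card_eq_finrank' (K := ℝ) hB (by simp [hcard])
  rw [Set.range_comp'] at h
  simpa using h

theorem tropCost_eq (e : ∀ j, α j → κ → ℤ) (ω : (Σ j, α j) → ℝ) (w : κ → ℝ) (z : ι → ℝ)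
    (s : Σ j, α j) :
    ω s = ∑ t, Sum.elim w z t * cayleyCol e s t ↔ tropCost e ω w s = z s.1 := by
  rw [sum_mul_cayleyCol, tropCost, sub_eq_iff_eq_add']
  rfl

variable [∀ j, Nonempty (α j)]

theorem exists_tropCost_eq (e : ∀ j, α j → κ → ℤ) (ω : (Σ j, α j) → ℝ) (w : κ → ℝ) :
    ∃ z : ι → ℝ, (∀ s, z s.1 ≤ tropCost e ω w s) ∧
      ∀ s, s ∈ tropArgmin e ω w ↔ tropCost e ω w s = z s.1 := by
  choose a ha using exists_mem_tropArgmin e ω w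
  refine ⟨fun j => tropCost e ω w ⟨j, a j⟩, fun s => mem_tropArgmin.1 (ha s.1) s.2, fun s =>
    ⟨fun h => le_antisymm (mem_tropArgmin.1 h _) (mem_tropArgmin.1 (ha s.1) s.2), fun h => ?_⟩⟩
  refine mem_tropArgmin.2 fun b => h.trans_le (mem_tropArgmin.1 (ha s.1) b)

theorem IsGenericWeight.linearIndepOn {e : ∀ j, α j → κ → ℤ} {ω : (Σ j, α j) → ℝ}
    (hω : IsGenericWeight e ω) (w : κ → ℝ) :
    LinearIndepOn ℝ (cayleyCol e) (tropArgmin e ω w : Set (Σ j, α j)) := by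
  obtain ⟨z, -, hz⟩ := exists_tropCost_eq e ω w
  refine LinearIndepOn.mono (s := {s | ω s = ∑ t, Sum.elim w z t * cayleyCol e s t})
    (hω (Sum.elim w z)) fun s hs => ?_
  exact (tropCost_eq e ω w z s).2 ((hz s).1 hs)

theorem IsGenericWeight.card_tropArgmin_le {e : ∀ j, α j → κ → ℤ} {ω : (Σ j, α j) → ℝ}
    (hω : IsGenericWeight e ω) (w : κ → ℝ) :
    (tropArgmin e ω w).card ≤ Fintype.card κ + Fintype.card ι := by
  have := LinearIndependent.fintype_card_le_finrank (R := ℝ) (hω.linearIndepOn w)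
  simpa using this

theorem eq_of_subset_tropArgmin {e : ∀ j, α j → κ → ℤ} {ω : (Σ j, α j) → ℝ} {w w' : κ → ℝ}
    (hω : IsGenericWeight e ω) (hw : w ∈ tropVertices e ω)
    (h : tropArgmin e ω w ⊆ tropArgmin e ω w') : w = w' := by
  obtain ⟨z, -, hz⟩ := exists_tropCost_eq e ω w
  obtain ⟨z', -, hz'⟩ := exists_tropCost_eq e ω w'
  have hspan := (hω.linearIndepOn w).span_cayleyCol_eq_top hw
  let f : (κ ⊕ ι → ℝ) → (κ ⊕ ι → ℝ) →ₗ[ℝ] ℝ := fun y => Fintype.linearCombination ℝ y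
  have hf : ∀ y v, f y v = ∑ t, y t * v t := by
    intro y v
    simp [f, Fintype.linearCombination_apply, mul_comm]
  have hff : f (Sum.elim w z) = f (Sum.elim w' z') := by
    refine LinearMap.ext_on hspan ?_
    rintro _ ⟨s, hs, rfl⟩
    rw [hf, hf, ← (tropCost_eq e ω w z s).2 ((hz s).1 hs),
      ← (tropCost_eq e ω w' z' s).2 ((hz' s).1 (h hs))]
  funext l
  classical
  have := LinearMap.congr_fun hff (Pi.single (Sum.inl l) 1)
  simpa [hf, Pi.single_apply] using this

theorem finite_tropVertices {e : ∀ j, α j → κ → ℤ} {ω : (Σ j, α j) → ℝ}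
    (hω : IsGenericWeight e ω) : (tropVertices e ω).Finite :=
  Set.Finite.of_finite_image (Set.toFinite (tropArgmin e ω '' tropVertices e ω))
    fun _ hw _ _ h => eq_of_subset_tropArgmin hω hw h.le

theorem sum_mul_tropCost {e : ∀ j, α j → κ → ℤ} {ω : (Σ j, α j) → ℝ} {x w : κ → ℝ}
    {c : (Σ j, α j) → ℝ} (hc : ∑ s, c s • cayleyCol e s = Sum.elim x 1) :
    ∑ s, c s * tropCost e ω w s = ∑ s, c s * ω s - ∑ l, w l * x l := by
  simp only [tropCost, mul_sub, Finset.sum_sub_distrib]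
  congr 1
  simp only [Finset.mul_sum]
  rw [Finset.sum_comm]
  refine Finset.sum_congr rfl fun l _ => ?_
  rw [← ((sum_smul_cayleyCol_eq_iff e c x 1).1 hc).1 l, Finset.mul_sum]
  exact Finset.sum_congr rfl fun s _ => by ring

theorem sum_mul_slot {e : ∀ j, α j → κ → ℤ} {x : κ → ℝ}
    {c : (Σ j, α j) → ℝ} (hc : ∑ s, c s • cayleyCol e s = Sum.elim x 1) (z : ι → ℝ) :
    ∑ s : Σ j, α j, c s * z s.1 = ∑ j, z j := by
  rw [← Finset.univ_sigma_univ, Finset.sum_sigma]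
  refine Finset.sum_congr rfl fun j _ => ?_
  change ∑ a, c ⟨j, a⟩ * z j = z j
  rw [← Finset.sum_mul, ((sum_smul_cayleyCol_eq_iff e c x 1).1 hc).2 j, Pi.one_apply, one_mul]

/-- Complementary slackness. -/
theorem tropArgmin_subset_of_mem_tropCell {e : ∀ j, α j → κ → ℤ} {ω : (Σ j, α j) → ℝ}
    {w w' x : κ → ℝ} (h : x ∈ tropCell e ω w) (h' : x ∈ tropCell e ω w') :
    tropArgmin e ω w' ⊆ tropArgmin e ω w := by
  have key : ∀ {w₁ w₂ : κ → ℝ} {c₁ c₂ : (Σ j, α j) → ℝ},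
      (∀ s ∉ tropArgmin e ω w₁, c₁ s = 0) → ∑ s, c₁ s • cayleyCol e s = Sum.elim x 1 →
      ∑ s, c₂ s • cayleyCol e s = Sum.elim x 1 → ∀ z : ι → ℝ,
      (∀ s, s ∈ tropArgmin e ω w₁ ↔ tropCost e ω w₁ s = z s.1) →
      ∑ s, c₂ s * (tropCost e ω w₁ s - z s.1) = ∑ s, c₂ s * ω s - ∑ s, c₁ s * ω s := by
    intro w₁ w₂ c₁ c₂ h0 h1 h2 z hz
    have e1 : ∑ s, c₁ s * (tropCost e ω w₁ s - z s.1) = 0 := by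
      refine Finset.sum_eq_zero fun s _ => ?_
      by_cases hs : s ∈ tropArgmin e ω w₁
      · rw [(hz s).1 hs, sub_self, mul_zero]
      · rw [h0 s hs, zero_mul]
    simp only [mul_sub, Finset.sum_sub_distrib] at e1 ⊢
    rw [sum_mul_tropCost h1, sum_mul_slot h1] at e1
    rw [sum_mul_tropCost h2, sum_mul_slot h2]
    linarith
  obtain ⟨c, hc0, hc1, hc2⟩ := h
  obtain ⟨c', hc0', hc1', hc2'⟩ := h'
  obtain ⟨z, hzle, hz⟩ := exists_tropCost_eq e ω w
  obtain ⟨z', hzle', hz'⟩ := exists_tropCost_eq e ω w'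
  have k1 := key (w₂ := w) hc1 hc2 hc2' z hz
  have k2 := key (w₂ := w) hc1' hc2' hc2 z' hz'
  have hn : ∀ s, 0 ≤ c s := fun s => by
    by_cases hs : s ∈ tropArgmin e ω w
    · exact (hc0 s hs).le
    · exact (hc1 s hs).ge
  have hn' : ∀ s, 0 ≤ c' s := fun s => by
    by_cases hs : s ∈ tropArgmin e ω w'
    · exact (hc0' s hs).le
    · exact (hc1' s hs).ge
  have n1 : 0 ≤ ∑ s, c s * (tropCost e ω w' s - z' s.1) :=
    Finset.sum_nonneg fun s _ => mul_nonneg (hn s) (sub_nonneg.2 (hzle' s))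
  have n2 : ∀ s ∈ Finset.univ, 0 ≤ c' s * (tropCost e ω w s - z s.1) :=
    fun s _ => mul_nonneg (hn' s) (sub_nonneg.2 (hzle s))
  have e0 : ∑ s, c' s * (tropCost e ω w s - z s.1) = 0 :=
    le_antisymm (by linarith) (Finset.sum_nonneg n2)
  intro s hs
  have := (Finset.sum_eq_zero_iff_of_nonneg n2).1 e0 s (Finset.mem_univ s)
  rcases mul_eq_zero.1 this with h | h
  · exact absurd h (hc0' s hs).ne'
  · exact (hz s).2 (sub_eq_zero.1 h)

theorem volume_span_cayleyCol_eq_zero {e : ∀ j, α j → κ → ℤ} {B : Finset (Σ j, α j)}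
    (hB : ∀ j, ∃ a, (⟨j, a⟩ : Σ j, α j) ∈ B) (hcard : B.card < Fintype.card κ + Fintype.card ι) :
    MeasureTheory.volume {x : κ → ℝ | Sum.elim x (1 : ι → ℝ) ∈
      Submodule.span ℝ (cayleyCol e '' (B : Set (Σ j, α j)))} = 0 := by
  classical
  set V := Submodule.span ℝ (cayleyCol e '' (B : Set (Σ j, α j))) with hV
  rcases Set.eq_empty_or_nonempty {x : κ → ℝ | Sum.elim x (1 : ι → ℝ) ∈ V} with h | ⟨x₀, hx₀⟩
  · rw [h, MeasureTheory.measure_empty]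
  let L : (κ → ℝ) →ₗ[ℝ] (κ ⊕ ι → ℝ) :=
    { toFun := fun x => Sum.elim x 0
      map_add' := fun x y => by funext t; cases t <;> simp
      map_smul' := fun r x => by funext t; cases t <;> simp }
  have hset : {x : κ → ℝ | Sum.elim x (1 : ι → ℝ) ∈ V} = (fun x => x + -x₀) ⁻¹' (V.comap L) := by
    ext x
    have h1 : L (x + -x₀) = Sum.elim x 1 - Sum.elim x₀ (1 : ι → ℝ) := by
      funext t
      cases t <;> simp [L, sub_eq_add_neg]
    simp only [Set.mem_ofPred_eq, Set.mem_preimage, SetLike.mem_coe, Submodule.mem_comap, h1]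
    exact (V.sub_mem_iff_left hx₀).symm
  rw [hset, MeasureTheory.measure_preimage_add_right]
  refine MeasureTheory.Measure.addHaar_submodule _ _ fun htop => ?_
  have hVtop : V = ⊤ := by
    have hl : ∀ x : κ → ℝ, Sum.elim x (0 : ι → ℝ) ∈ V := fun x => by
      have : x ∈ V.comap L := htop ▸ Submodule.mem_top
      exact this
    have hr : ∀ j, Pi.single (Sum.inr j) 1 ∈ V := by
      intro j
      obtain ⟨a, ha⟩ := hB j
      have h1 : cayleyCol e ⟨j, a⟩ ∈ V := Submodule.subset_span ⟨_, ha, rfl⟩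
      have h2 := V.sub_mem h1 (hl fun l => (e j a l : ℝ))
      convert! h2 using 1
      funext t
      cases t <;> simp [cayleyCol, Pi.single_apply]
    rw [eq_top_iff]
    intro y _
    have : y = Sum.elim (fun l => y (Sum.inl l)) 0 +
        ∑ j, y (Sum.inr j) • (Pi.single (Sum.inr j) 1 : κ ⊕ ι → ℝ) := by
      funext t
      cases t <;> simp [Pi.single_apply, Finset.sum_apply]
    rw [this]
    exact V.add_mem (hl _) (V.sum_mem fun j _ => V.smul_mem _ (hr j))
  have h1 : Module.finrank ℝ V ≤ B.card := by
    have := finrank_span_finset_le_card (R := ℝ) (B.image (cayleyCol e))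
    rw [Finset.coe_image] at this
    exact this.trans Finset.card_image_le
  rw [hVtop, finrank_top] at h1
  simp at h1
  omega

/-- A nondegenerate optimal solution lies in the cell of a vertex. -/
theorem exists_mem_tropCell {e : ∀ j, α j → κ → ℤ} {ω : (Σ j, α j) → ℝ}
    (hω : IsGenericWeight e ω) {x : κ → ℝ} {c : (Σ j, α j) → ℝ} (hc : c ∈ cayleyFeasible e x)
    (hmin : ∀ c' ∈ cayleyFeasible e x, ∑ s, c s * ω s ≤ ∑ s, c' s * ω s)
    {B : Finset (Σ j, α j)} (hBc : ∀ s, s ∈ B ↔ c s ≠ 0)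
    (hB : LinearIndepOn ℝ (cayleyCol e) (B : Set (Σ j, α j)))
    (hcard : B.card = Fintype.card κ + Fintype.card ι) :
    ∃ w ∈ tropVertices e ω, x ∈ tropCell e ω w := by
  classical
  let b : Module.Basis B ℝ (κ ⊕ ι → ℝ) := Module.Basis.mk hB (by
    have := hB.span_cayleyCol_eq_top hcard
    rw [← this, Set.image_eq_range])
  have hb : ∀ s : B, b s = cayleyCol e s.1 := fun s => by simp [b]
  let f : (κ ⊕ ι → ℝ) →ₗ[ℝ] ℝ := b.constr ℝ fun s : B => ω s
  have hfB : ∀ s ∈ B, f (cayleyCol e s) = ω s := fun s hs => by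
    rw [← hb ⟨s, hs⟩]
    exact b.constr_basis ℝ _ _
  have hfle : ∀ s, f (cayleyCol e s) ≤ ω s := by
    intro s
    let m : (Σ j, α j) → ℝ := fun s' =>
      (if s' = s then 1 else 0) - if h : s' ∈ B then b.repr (cayleyCol e s) ⟨s', h⟩ else 0
    have hsum : ∀ g : (Σ j, α j) → ℝ,
        ∑ s', m s' * g s' = g s - ∑ s' : B, b.repr (cayleyCol e s) s' * g s' := by
      intro g
      simp only [m, sub_mul, Finset.sum_sub_distrib, ite_mul, one_mul, zero_mul,
        Finset.sum_ite_eq', Finset.mem_univ, if_true]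
      congr 1
      rw [← Finset.sum_subset (Finset.subset_univ B), ← Finset.sum_coe_sort B]
      · exact Finset.sum_congr rfl fun s' _ => by rw [dif_pos s'.2]
      · intro s' _ hs'
        rw [dif_neg hs', zero_mul]
    have hrepr : ∑ s' : B, b.repr (cayleyCol e s) s' • cayleyCol e s'.1 = cayleyCol e s := by
      simp only [← hb]
      exact b.sum_repr _
    have hm0 : ∑ s', m s' • cayleyCol e s' = 0 := by
      funext t
      have h1 := congrFun hrepr t
      simp only [Finset.sum_apply, Pi.smul_apply, smul_eq_mul] at h1
      simp only [Finset.sum_apply, Pi.smul_apply, smul_eq_mul, Pi.zero_apply]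
      rw [hsum fun s' => cayleyCol e s' t, h1, sub_self]
    have hmω : ∑ s', m s' * ω s' = ω s - f (cayleyCol e s) := by
      have h1 := congrArg f hrepr
      rw [map_sum] at h1
      rw [hsum, ← h1]
      congr 1
      refine Finset.sum_congr rfl fun s' _ => ?_
      rw [map_smul, hfB _ s'.2, smul_eq_mul]
    have hev : ∀ᶠ t in nhdsWithin (0 : ℝ) (Set.Ioi 0), ∀ s', 0 ≤ c s' + t * m s' := by
      rw [Filter.eventually_all]
      intro s'
      by_cases hs' : s' ∈ B
      · have hpos : 0 < c s' := lt_of_le_of_ne (hc.1 s') ((hBc s').1 hs').symm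
        have hcont : Filter.Tendsto (fun t : ℝ => c s' + t * m s') (nhds 0) (nhds (c s')) := by
          have h1 : Continuous fun t : ℝ => c s' + t * m s' := by fun_prop
          simpa using h1.tendsto 0
        exact ((hcont.eventually (lt_mem_nhds hpos)).filter_mono nhdsWithin_le_nhds).mono
          fun t ht => ht.le
      · filter_upwards [self_mem_nhdsWithin] with t ht
        refine add_nonneg (hc.1 s') (mul_nonneg (le_of_lt ht) ?_)
        simp only [m, dif_neg hs', sub_zero]
        split_ifs <;> norm_num
    obtain ⟨t, ht, ht0⟩ := (hev.and self_mem_nhdsWithin).exists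
    have h1 := hmin (fun s' => c s' + t * m s') ⟨ht, by
      simp only [add_smul, mul_smul, Finset.sum_add_distrib]
      rw [← Finset.smul_sum, hm0, smul_zero, add_zero, hc.2]⟩
    simp only [add_mul, mul_assoc, Finset.sum_add_distrib, ← Finset.mul_sum] at h1
    rw [hmω, le_add_iff_nonneg_right] at h1
    exact sub_nonneg.1 (nonneg_of_mul_nonneg_right h1 ht0)
  let w : κ → ℝ := fun l => f (Pi.single (Sum.inl l) 1)
  let z : ι → ℝ := fun j => f (Pi.single (Sum.inr j) 1)
  have hf : ∀ s, f (cayleyCol e s) = ∑ l, w l * e s.1 s.2 l + z s.1 := by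
    intro s
    have h1 := LinearMap.pi_apply_eq_sum_univ f (cayleyCol e s)
    have h2 : ∀ t : κ ⊕ ι, (fun t' : κ ⊕ ι => if t = t' then (1 : ℝ) else 0) = Pi.single t 1 := by
      intro t
      funext t'
      by_cases h : t = t'
      · subst h; simp
      · simp [h, Pi.single_apply, Ne.symm h]
    simp only [h2] at h1
    rw [h1, Fintype.sum_sum_type]
    simp [cayleyCol, Pi.single_apply, w, z, mul_comm]
  have hsub : B ⊆ tropArgmin e ω w := by
    intro s hs
    refine mem_tropArgmin.2 fun a => ?_
    have h1 := hfB s hs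
    have h2 := hfle ⟨s.1, a⟩
    rw [hf] at h1 h2
    simp only [tropCost]
    linarith
  have hBeq : B = tropArgmin e ω w :=
    Finset.eq_of_subset_of_card_le hsub (hcard ▸ hω.card_tropArgmin_le w)
  refine ⟨w, ?_, c, fun s hs => ?_, fun s hs => ?_, hc.2⟩
  · rw [tropVertices, Set.mem_ofPred_eq, ← hBeq, hcard]
  · rw [← hBeq, hBc] at hs
    exact lt_of_le_of_ne (hc.1 s) hs.symm
  · rw [← hBeq, hBc, not_not] at hs
    exact hs

theorem disjoint_tropCell {e : ∀ j, α j → κ → ℤ} {ω : (Σ j, α j) → ℝ}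
    (hω : IsGenericWeight e ω) {w w' : κ → ℝ} (hw' : w' ∈ tropVertices e ω) (h : w ≠ w') :
    Disjoint (tropCell e ω w) (tropCell e ω w') := by
  rw [Set.disjoint_left]
  intro x hx hx'
  exact h (eq_of_subset_tropArgmin hω hw' (tropArgmin_subset_of_mem_tropCell hx hx')).symm

/-- The volume of the sum of the polytopes is the total volume of the cells of the vertices. -/
theorem volume_cayleyFeasible {e : ∀ j, α j → κ → ℤ} {ω : (Σ j, α j) → ℝ}
    (hω : IsGenericWeight e ω) : MeasureTheory.volume {x : κ → ℝ | (cayleyFeasible e x).Nonempty} =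
      ∑ w ∈ (finite_tropVertices hω).toFinset, MeasureTheory.volume (tropCell e ω w) := by
  classical
  rw [← MeasureTheory.measure_biUnion_finset₀]
  · refine le_antisymm ?_ (MeasureTheory.measure_mono (Set.iUnion₂_subset fun w _ =>
      tropCell_subset e ω w))
    let Bs : Finset (Finset (Σ j, α j)) := Finset.univ.filter fun B =>
      (∀ j, ∃ a, (⟨j, a⟩ : Σ j, α j) ∈ B) ∧ B.card < Fintype.card κ + Fintype.card ι
    let N : Set (κ → ℝ) := ⋃ B ∈ Bs, {x : κ → ℝ | Sum.elim x (1 : ι → ℝ) ∈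
      Submodule.span ℝ (cayleyCol e '' (B : Set (Σ j, α j)))}
    have hN : MeasureTheory.volume N = 0 := by
      refine (MeasureTheory.measure_biUnion_null_iff Bs.countable_toSet).2 fun B hB => ?_
      have h1 := (Finset.mem_filter.1 hB).2
      exact volume_span_cayleyCol_eq_zero h1.1 h1.2
    refine le_trans (MeasureTheory.measure_mono 
      (t := N ∪ ⋃ w ∈ (finite_tropVertices hω).toFinset, tropCell e ω w) ?_)
      ((MeasureTheory.measure_union_le N _).trans (by rw [hN, zero_add]))
    intro x hx
    obtain ⟨c, hc, hmin, hind⟩ := exists_optimal_cayleyFeasible ω hx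
    let B : Finset (Σ j, α j) := Finset.univ.filter fun s => c s ≠ 0
    have hBc : ∀ s, s ∈ B ↔ c s ≠ 0 := fun s => by simp [B]
    have hB : LinearIndepOn ℝ (cayleyCol e) (B : Set (Σ j, α j)) := by
      convert! hind using 1
      ext s
      simp [B]
    have hle : B.card ≤ Fintype.card κ + Fintype.card ι := by
      have := LinearIndependent.fintype_card_le_finrank (R := ℝ) hB
      simpa using this
    rcases hle.lt_or_eq with hlt | heq
    · left
      refine Set.mem_biUnion (Finset.mem_filter.2 ⟨Finset.mem_univ B, fun j => ?_, hlt⟩) ?_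
      · by_contra! h
        have h1 := ((sum_smul_cayleyCol_eq_iff e c x 1).1 hc.2).2 j
        rw [Finset.sum_eq_zero fun a _ => ?_] at h1
        · exact zero_ne_one h1
        · have := h a
          rwa [hBc, not_not] at this
      · rw [Set.mem_ofPred_eq, ← hc.2]
        refine Submodule.sum_mem _ fun s _ => ?_
        by_cases hs : s ∈ B
        · exact Submodule.smul_mem _ _ (Submodule.subset_span ⟨s, hs, rfl⟩)
        · rw [hBc, not_not] at hs
          rw [hs, zero_smul]
          exact Submodule.zero_mem _
    · right
      obtain ⟨w, hw, hxw⟩ := exists_mem_tropCell hω hc hmin hBc hB heq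
      exact Set.mem_biUnion ((finite_tropVertices hω).mem_toFinset.2 hw) hxw
  · intro w _ w' hw' h
    exact (disjoint_tropCell hω ((finite_tropVertices hω).mem_toFinset.1 hw') h).aedisjoint
  · exact fun w _ => (convex_tropCell e ω w).nullMeasurableSet MeasureTheory.volume

end TropicalVolume

section TropicalSubfamily

theorem mem_convexHull_range_iff {E β : Type*} [AddCommGroup E] [Module ℝ E] [Fintype β]
    (v : β → E) (x : E) : x ∈ convexHull ℝ (Set.range v) ↔
      ∃ c : β → ℝ, (∀ b, 0 ≤ c b) ∧ ∑ b, c b = 1 ∧ ∑ b, c b • v b = x := by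
  classical
  have h : Set.range v = Fintype.linearCombination ℝ v ''
      Set.range fun b b' : β => if b = b' then (1 : ℝ) else 0 := by
    rw [← Set.range_comp]
    congr 1
    funext b
    simp [Fintype.linearCombination_apply]
  rw [h, ← LinearMap.image_convexHull, convexHull_basis_eq_stdSimplex]
  simp only [Set.mem_image, stdSimplex, Set.mem_ofPred_eq, Fintype.linearCombination_apply,
    and_assoc]

variable {ι κ : Type*} [Fintype ι] [Fintype κ] {α : ι → Type*} [∀ j, Fintype (α j)]

/-- The inclusion of the terms of a subfamily. -/
def subTerm (s : Finset ι) (t : Σ j : s, α j.1) : Σ j, α j := ⟨t.1.1, t.2⟩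

/-- The exponents of a subfamily. -/
def subExp (s : Finset ι) (e : ∀ j, α j → κ → ℤ) : ∀ j : s, α j.1 → κ → ℤ := fun j => e j.1

open Classical in
/-- The number of terms of minimal weight in the slot `j`. -/
noncomputable def slotCount (e : ∀ j, α j → κ → ℤ) (ω : (Σ j, α j) → ℝ) (w : κ → ℝ) (j : ι) : ℕ :=
  (Finset.univ.filter fun a => (⟨j, a⟩ : Σ j, α j) ∈ tropArgmin e ω w).card

theorem card_tropArgmin (e : ∀ j, α j → κ → ℤ) (ω : (Σ j, α j) → ℝ) (w : κ → ℝ) :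
    (tropArgmin e ω w).card = ∑ j, slotCount e ω w j := by
  classical
  have : tropArgmin e ω w = Finset.univ.sigma fun j =>
      Finset.univ.filter fun a => (⟨j, a⟩ : Σ j, α j) ∈ tropArgmin e ω w := by
    ext ⟨j, a⟩
    simp
  rw [this, Finset.card_sigma]
  rfl

theorem subTerm_mem_tropArgmin {e : ∀ j, α j → κ → ℤ} {ω : (Σ j, α j) → ℝ} {w : κ → ℝ}
    {s : Finset ι} {t : Σ j : s, α j.1} :
    t ∈ tropArgmin (subExp s e) (ω ∘ subTerm s) w ↔ subTerm s t ∈ tropArgmin e ω w := by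
  rw [mem_tropArgmin, mem_tropArgmin]
  rfl

theorem slotCount_sub (e : ∀ j, α j → κ → ℤ) (ω : (Σ j, α j) → ℝ) (w : κ → ℝ) (s : Finset ι)
    (j : s) : slotCount (subExp s e) (ω ∘ subTerm s) w j = slotCount e ω w j.1 := by
  classical
  unfold slotCount
  congr 1
  ext a
  simp only [Finset.mem_filter, Finset.mem_univ, true_and]
  exact subTerm_mem_tropArgmin

theorem mem_tropVertices_sub {e : ∀ j, α j → κ → ℤ} {ω : (Σ j, α j) → ℝ} {w : κ → ℝ}
    {s : Finset ι} : w ∈ tropVertices (subExp s e) (ω ∘ subTerm s) ↔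
      ∑ j ∈ s, slotCount e ω w j = Fintype.card κ + s.card := by
  rw [tropVertices, Set.mem_ofPred_eq, card_tropArgmin]
  simp only [slotCount_sub]
  rw [Finset.sum_coe_sort s (fun j => slotCount e ω w j), Fintype.card_coe]

variable [DecidableEq ι]

open Pointwise in
theorem sum_convexHull_eq (e : ∀ j, α j → κ → ℤ) (s : Finset ι) :
    ∑ j ∈ s, convexHull ℝ (Set.range fun (a : α j) l => (e j a l : ℝ)) =
      {x : κ → ℝ | (cayleyFeasible (subExp s e) x).Nonempty} := by
  ext x
  rw [Set.mem_finsetSum, Set.mem_ofPred_eq]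
  constructor
  · rintro ⟨g, hg, rfl⟩
    have h1 : ∀ j : s, ∃ c : α j.1 → ℝ, (∀ b, 0 ≤ c b) ∧ ∑ b, c b = 1 ∧
        ∑ b, c b • (fun l => (e j.1 b l : ℝ)) = g j.1 := fun j =>
      (mem_convexHull_range_iff _ _).1 (hg j.2)
    choose c h0 h1 h2 using h1
    refine ⟨fun t => c t.1 t.2, fun t => h0 _ _, (sum_smul_cayleyCol_eq_iff _ _ _ _).2
      ⟨fun l => ?_, fun j => h1 j⟩⟩
    rw [← Finset.univ_sigma_univ, Finset.sum_sigma, Finset.sum_apply,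
      ← Finset.sum_coe_sort s (fun j => g j l)]
    refine Finset.sum_congr rfl fun j _ => ?_
    rw [← h2 j]
    simp [subExp]
  · rintro ⟨c, h0, hc⟩
    obtain ⟨h1, h2⟩ := (sum_smul_cayleyCol_eq_iff _ _ _ _).1 hc
    refine ⟨fun j => if h : j ∈ s then
      ∑ a, c ⟨⟨j, h⟩, a⟩ • (fun l => (e j a l : ℝ)) else 0, fun {j} hj => ?_, ?_⟩
    · beta_reduce
      rw [dif_pos hj]
      exact (mem_convexHull_range_iff _ _).2 ⟨fun a => c ⟨⟨j, hj⟩, a⟩, fun a => h0 _,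
        h2 ⟨j, hj⟩, rfl⟩
    · rw [← Finset.sum_coe_sort]
      funext l
      rw [← h1 l, ← Finset.univ_sigma_univ, Finset.sum_sigma, Finset.sum_apply]
      refine Finset.sum_congr rfl fun j _ => ?_
      rw [dif_pos j.2]
      simp [subExp]

variable [∀ j, Nonempty (α j)]

theorem slotCount_pos (e : ∀ j, α j → κ → ℤ) (ω : (Σ j, α j) → ℝ) (w : κ → ℝ) (j : ι) :
    0 < slotCount e ω w j := by
  classical
  obtain ⟨a, ha⟩ := exists_mem_tropArgmin e ω w j
  exact Finset.card_pos.2 ⟨a, by simpa using ha⟩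

theorem IsGenericWeight.sub {e : ∀ j, α j → κ → ℤ} {ω : (Σ j, α j) → ℝ}
    (hω : IsGenericWeight e ω) (s : Finset ι) :
    IsGenericWeight (subExp s e) (ω ∘ subTerm s) := by
  intro y
  let y' : κ ⊕ ι → ℝ := Sum.elim (fun l => y (Sum.inl l))
    fun j => if h : j ∈ s then y (Sum.inr ⟨j, h⟩) else 0
  let L : (κ ⊕ s → ℝ) →ₗ[ℝ] (κ ⊕ ι → ℝ) :=
    { toFun := fun v => Sum.elim (fun l => v (Sum.inl l))
        fun j => if h : j ∈ s then v (Sum.inr ⟨j, h⟩) else 0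
      map_add' := fun v v' => by
        funext t
        rcases t with l | j
        · rfl
        · by_cases h : j ∈ s <;> simp [h]
      map_smul' := fun r v => by
        funext t
        rcases t with l | j
        · rfl
        · by_cases h : j ∈ s <;> simp [h] }
  have hL : ∀ t, L (cayleyCol (subExp s e) t) = cayleyCol e (subTerm s t) := by
    rintro ⟨⟨j₀, h₀⟩, a⟩
    funext t
    rcases t with l | j
    · rfl
    · by_cases h : j ∈ s
      · simp [L, cayleyCol, subTerm, h, Pi.single_apply]
      · have : j ≠ j₀ := fun h' => h (h' ▸ h₀)
        simp [L, cayleyCol, subTerm, h, Pi.single_apply, this]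
  have hmem : ∀ t : Σ j : s, α j.1, (ω ∘ subTerm s) t = ∑ i, y i * cayleyCol (subExp s e) t i →
      ω (subTerm s t) = ∑ i, y' i * cayleyCol e (subTerm s t) i := by
    intro t ht
    rw [sum_mul_cayleyCol] at ht ⊢
    rw [← Function.comp_apply (f := ω), ht]
    simp [y', subTerm, subExp]
  refine LinearIndependent.of_comp L ?_
  let g : {t : Σ j : s, α j.1 // (ω ∘ subTerm s) t = ∑ i, y i * cayleyCol (subExp s e) t i} →
      {t : Σ j, α j // ω t = ∑ i, y' i * cayleyCol e t i} :=
    fun t => ⟨subTerm s t.1, hmem t.1 t.2⟩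
  have hg : Function.Injective g := by
    rintro ⟨⟨⟨j, hj⟩, a⟩, _⟩ ⟨⟨⟨j', hj'⟩, a'⟩, _⟩ h
    simp only [g, subTerm, Subtype.mk.injEq, Sigma.mk.injEq] at h
    obtain ⟨rfl, h⟩ := h
    simp only [heq_eq_eq] at h
    subst h
    rfl
  convert! LinearIndependent.comp (hω y') g hg using 1
  funext t
  exact hL t.1

theorem mem_tropVertices_sub_iff {e : ∀ j, α j → κ → ℤ} {ω : (Σ j, α j) → ℝ}
    (hω : IsGenericWeight e ω) {w : κ → ℝ} {s : Finset ι} :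
    w ∈ tropVertices (subExp s e) (ω ∘ subTerm s) ↔
      w ∈ tropVertices e ω ∧ ∀ j, j ∉ s → slotCount e ω w j = 1 := by
  have hle := hω.card_tropArgmin_le w
  rw [mem_tropVertices_sub, tropVertices, Set.mem_ofPred_eq]
  rw [card_tropArgmin] at hle ⊢
  rw [← Finset.sum_add_sum_compl s] at hle ⊢
  have hc : s.card + sᶜ.card = Fintype.card ι := Finset.card_add_card_compl s
  have hge : sᶜ.card ≤ ∑ j ∈ sᶜ, slotCount e ω w j := by
    rw [Finset.card_eq_sum_ones]
    exact Finset.sum_le_sum fun j _ => slotCount_pos e ω w j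
  constructor
  · intro h
    refine ⟨by omega, fun j hj => ?_⟩
    have heq : ∑ j ∈ sᶜ, 1 = ∑ j ∈ sᶜ, slotCount e ω w j := by
      rw [← Finset.card_eq_sum_ones]
      omega
    exact ((Finset.sum_eq_sum_iff_of_le fun j _ => slotCount_pos e ω w j).1 heq j
      (Finset.mem_compl.2 hj)).symm
  · rintro ⟨h1, h2⟩
    have : ∑ j ∈ sᶜ, slotCount e ω w j = sᶜ.card := by
      rw [Finset.card_eq_sum_ones]
      exact Finset.sum_congr rfl fun j hj => h2 j (Finset.mem_compl.1 hj)
    omega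

theorem eq_of_slotCount_eq_one {e : ∀ j, α j → κ → ℤ} {ω : (Σ j, α j) → ℝ} {w : κ → ℝ} {j : ι}
    (h : slotCount e ω w j = 1) {a b : α j} (ha : (⟨j, a⟩ : Σ j, α j) ∈ tropArgmin e ω w)
    (hb : (⟨j, b⟩ : Σ j, α j) ∈ tropArgmin e ω w) : b = a := by
  classical
  exact Finset.card_le_one.1 h.le b (by simpa using hb) a (by simpa using ha)

theorem volume_tropCell_sub {e : ∀ j, α j → κ → ℤ} {ω : (Σ j, α j) → ℝ} {w : κ → ℝ}
    {s : Finset ι} (h : ∀ j, j ∉ s → slotCount e ω w j = 1) :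
    MeasureTheory.volume (tropCell (subExp s e) (ω ∘ subTerm s) w) =
      MeasureTheory.volume (tropCell e ω w) := by
  classical
  choose a ha using exists_mem_tropArgmin e ω w
  have huniq : ∀ j, j ∉ s → ∀ b, (⟨j, b⟩ : Σ j, α j) ∈ tropArgmin e ω w → b = a j :=
    fun j hj b hb => eq_of_slotCount_eq_one (h j hj) (ha j) hb
  let v : κ → ℝ := fun l => ∑ j ∈ sᶜ, (e j (a j) l : ℝ)
  suffices hset : tropCell (subExp s e) (ω ∘ subTerm s) w = (fun x => x + v) ⁻¹' tropCell e ω w by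
    rw [hset, MeasureTheory.measure_preimage_add_right]
  have hsplit : ∀ (c : (Σ j, α j) → ℝ) (l : κ), (∀ j, j ∉ s → ∀ b, b ≠ a j → c ⟨j, b⟩ = 0) →
      (∀ j, j ∉ s → c ⟨j, a j⟩ = 1) → ∑ t : Σ j, α j, c t * e t.1 t.2 l =
        ∑ t : Σ j : s, α j.1, c (subTerm s t) * subExp s e t.1 t.2 l + v l := by
    intro c l h0 h1
    rw [← Finset.univ_sigma_univ, Finset.sum_sigma, ← Finset.sum_add_sum_compl s,
      ← Finset.univ_sigma_univ, Finset.sum_sigma]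
    congr 1
    · exact (Finset.sum_coe_sort s fun j => ∑ b, c ⟨j, b⟩ * e j b l).symm
    · refine Finset.sum_congr rfl fun j hj => ?_
      have hj' := Finset.mem_compl.1 hj
      rw [Finset.sum_eq_single (a j)]
      · rw [h1 j hj', one_mul]
      · intro b _ hb
        rw [h0 j hj' b hb, zero_mul]
      · simp
  ext x
  constructor
  · rintro ⟨c, h0, h1, h2⟩
    obtain ⟨h2, h3⟩ := (sum_smul_cayleyCol_eq_iff _ _ _ _).1 h2
    let c' : (Σ j, α j) → ℝ := fun t =>
      if h : t.1 ∈ s then c ⟨⟨t.1, h⟩, t.2⟩ else if t.2 = a t.1 then 1 else 0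
    have hc' : ∀ t, c' (subTerm s t) = c t := fun t => dif_pos t.1.2
    have hc0 : ∀ j, j ∉ s → ∀ b, b ≠ a j → c' ⟨j, b⟩ = 0 := fun j hj b hb => by simp [c', hj, hb]
    have hc1 : ∀ j, j ∉ s → c' ⟨j, a j⟩ = 1 := fun j hj => by simp [c', hj]
    refine ⟨c', ?_, ?_, (sum_smul_cayleyCol_eq_iff _ _ _ _).2 ⟨fun l => ?_, fun j => ?_⟩⟩
    · rintro ⟨j, b⟩ hb
      by_cases hj : j ∈ s
      · rw [show c' ⟨j, b⟩ = c ⟨⟨j, hj⟩, b⟩ from hc' ⟨⟨j, hj⟩, b⟩]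
        exact h0 _ (subTerm_mem_tropArgmin.2 hb)
      · rw [huniq j hj b hb, hc1 j hj]
        exact one_pos
    · rintro ⟨j, b⟩ hb
      by_cases hj : j ∈ s
      · rw [show c' ⟨j, b⟩ = c ⟨⟨j, hj⟩, b⟩ from hc' ⟨⟨j, hj⟩, b⟩]
        exact h1 _ fun h => hb (subTerm_mem_tropArgmin.1 h)
      · exact hc0 j hj b fun h => hb (h ▸ ha j)
    · rw [hsplit c' l hc0 hc1]
      simp only [hc']
      rw [h2 l]
      rfl
    · by_cases hj : j ∈ s
      · exact (Finset.sum_congr rfl fun b _ => hc' ⟨⟨j, hj⟩, b⟩).trans (h3 ⟨j, hj⟩)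
      · rw [Finset.sum_eq_single (a j) (fun b _ hb => hc0 j hj b hb) (by simp), hc1 j hj,
          Pi.one_apply]
  · rintro ⟨c, h0, h1, h2⟩
    obtain ⟨h2, h3⟩ := (sum_smul_cayleyCol_eq_iff _ _ _ _).1 h2
    have hc0 : ∀ j, j ∉ s → ∀ b, b ≠ a j → c ⟨j, b⟩ = 0 := fun j hj b hb =>
      h1 _ fun h => hb (huniq j hj b h)
    have hc1 : ∀ j, j ∉ s → c ⟨j, a j⟩ = 1 := by
      intro j hj
      have := h3 j
      rwa [Finset.sum_eq_single (a j) (fun b _ hb => hc0 j hj b hb) (by simp)] at this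
    refine ⟨c ∘ subTerm s, fun t ht => h0 _ (subTerm_mem_tropArgmin.1 ht),
      fun t ht => h1 _ fun h => ht (subTerm_mem_tropArgmin.2 h),
      (sum_smul_cayleyCol_eq_iff _ _ _ _).2 ⟨fun l => ?_, fun j => h3 j.1⟩⟩
    have := h2 l
    rw [hsplit c l hc0 hc1] at this
    exact add_right_cancel this

open Pointwise in
theorem volume_sum_convexHull {e : ∀ j, α j → κ → ℤ} {ω : (Σ j, α j) → ℝ}
    (hω : IsGenericWeight e ω) (s : Finset ι) :
    MeasureTheory.volume (∑ j ∈ s, convexHull ℝ (Set.range fun (a : α j) l => (e j a l : ℝ))) =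
      ∑ w ∈ (finite_tropVertices hω).toFinset with ∀ j, j ∉ s → slotCount e ω w j = 1,
        MeasureTheory.volume (tropCell e ω w) := by
  classical
  rw [sum_convexHull_eq, volume_cayleyFeasible (hω.sub s)]
  refine Finset.sum_congr ?_ fun w hw => ?_
  · ext w
    simp only [Set.Finite.mem_toFinset, Finset.mem_filter]
    exact mem_tropVertices_sub_iff hω
  · exact volume_tropCell_sub (Finset.mem_filter.1 hw).2

end TropicalSubfamily

section MixedCells

variable {ι κ : Type*} [Fintype ι] [Fintype κ] {α : ι → Type*} [∀ j, Fintype (α j)]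

/-- A mixed cell: two terms `a j`, `b j` of minimal weight in each slot. -/
def IsMixedCell (e : ∀ j, α j → κ → ℤ) (ω : (Σ j, α j) → ℝ) (w : κ → ℝ) (a b : ∀ j, α j) : Prop :=
  ∀ j, a j ≠ b j ∧ ∀ x, (⟨j, x⟩ : Σ j, α j) ∈ tropArgmin e ω w ↔ x = a j ∨ x = b j

/-- The matrix of edge directions of a mixed cell. -/
def edgeMatrix (e : ∀ j, α j → κ → ℤ) (σ : κ ≃ ι) (a b : ∀ j, α j) : Matrix κ κ ℤ :=
  Matrix.of fun l k => e (σ l) (b (σ l)) k - e (σ l) (a (σ l)) k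

theorem exists_isMixedCell {e : ∀ j, α j → κ → ℤ} {ω : (Σ j, α j) → ℝ} {w : κ → ℝ}
    (h : ∀ j, slotCount e ω w j = 2) : ∃ a b, IsMixedCell e ω w a b := by
  classical
  have : ∀ j, ∃ a b : α j, a ≠ b ∧ ∀ x, (⟨j, x⟩ : Σ j, α j) ∈ tropArgmin e ω w ↔ x = a ∨ x = b := by
    intro j
    obtain ⟨a, b, hab, hs⟩ := Finset.card_eq_two.1 (h j)
    refine ⟨a, b, hab, fun x => ?_⟩
    have := Finset.ext_iff.1 hs x
    simpa using this
  choose a b hab using this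
  exact ⟨a, b, hab⟩

theorem slotCount_eq_two [∀ j, Nonempty (α j)] [DecidableEq ι] {e : ∀ j, α j → κ → ℤ}
    {ω : (Σ j, α j) → ℝ} {w : κ → ℝ}
    (hω : IsGenericWeight e ω) (hcard : Fintype.card κ = Fintype.card ι)
    (h : ∀ j, 2 ≤ slotCount e ω w j) :
    (∀ j, slotCount e ω w j = 2) ∧ w ∈ tropVertices e ω := by
  have hle := hω.card_tropArgmin_le w
  have h2 : ∑ j : ι, 2 = Fintype.card κ + Fintype.card ι := by simp [hcard]; ring
  have heq : ∑ j : ι, 2 = ∑ j, slotCount e ω w j := by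
    refine le_antisymm (Finset.sum_le_sum fun j _ => h j) ?_
    rw [h2, ← card_tropArgmin]
    exact hle
  refine ⟨fun j => ?_, ?_⟩
  · exact ((Finset.sum_eq_sum_iff_of_le fun j _ => h j).1 heq j (Finset.mem_univ j)).symm
  · rw [tropVertices, Set.mem_ofPred_eq, card_tropArgmin, ← heq, h2]

theorem IsMixedCell.sum_eq {e : ∀ j, α j → κ → ℤ} {ω : (Σ j, α j) → ℝ} {w : κ → ℝ} {a b : ∀ j, α j}
    (hab : IsMixedCell e ω w a b) {E : Type*} [AddCommMonoid E] (j : ι) (f : α j → E)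
    (hf : ∀ x, (⟨j, x⟩ : Σ j, α j) ∉ tropArgmin e ω w → f x = 0) :
    ∑ x, f x = f (a j) + f (b j) := by
  classical
  rw [← Finset.sum_pair (hab j).1]
  refine (Finset.sum_subset (Finset.subset_univ _) fun x _ hx => hf x fun h => hx ?_).symm
  simpa using ((hab j).2 x).1 h

variable [DecidableEq ι]

theorem IsMixedCell.det_ne_zero [DecidableEq κ] [∀ j, Nonempty (α j)] {e : ∀ j, α j → κ → ℤ}
    {ω : (Σ j, α j) → ℝ} {w : κ → ℝ}
    {a b : ∀ j, α j} (hω : IsGenericWeight e ω) (hab : IsMixedCell e ω w a b) (σ : κ ≃ ι) :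
    (edgeMatrix e σ a b).det ≠ 0 := by
  classical
  intro hdet
  have hdet' : ((edgeMatrix e σ a b).map (Int.castRingHom ℝ)).det = 0 := by
    rw [← RingHom.mapMatrix_apply, ← RingHom.map_det, hdet, map_zero]
  obtain ⟨t, ht0, ht⟩ := Matrix.exists_vecMul_eq_zero_iff.2 hdet'
  have hli := hω.linearIndepOn w
  let g : (Σ j, α j) → ℝ := fun s =>
    if s.2 = b s.1 then t (σ.symm s.1) else if s.2 = a s.1 then - t (σ.symm s.1) else 0
  have hga : ∀ j, g ⟨j, a j⟩ = - t (σ.symm j) := fun j => by simp [g, (hab j).1]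
  have hgb : ∀ j, g ⟨j, b j⟩ = t (σ.symm j) := fun j => by simp [g]
  have hg0 : ∀ s ∉ tropArgmin e ω w, g s = 0 := by
    rintro ⟨j, x⟩ hx
    have := mt ((hab j).2 x).2 hx
    push Not at this
    simp [g, this.1, this.2]
  have hsum : ∑ s ∈ tropArgmin e ω w, g s • cayleyCol e s = 0 := by
    rw [Finset.sum_subset (Finset.subset_univ _) fun s _ hs => by rw [hg0 s hs, zero_smul]]
    have := (sum_smul_cayleyCol_eq_iff e g (0 : κ → ℝ) (0 : ι → ℝ)).2 ⟨fun l => ?_, fun j => ?_⟩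
    · rw [this]
      ext (l | j) <;> rfl
    · rw [← Finset.univ_sigma_univ, Finset.sum_sigma]
      have h1 : ∀ j, ∑ x, g ⟨j, x⟩ * (e j x l : ℝ) = t (σ.symm j) * (e j (b j) l - e j (a j) l) := by
        intro j
        rw [hab.sum_eq j _ fun x hx => by rw [hg0 _ hx, zero_mul], hga, hgb]
        ring
      rw [Finset.sum_congr rfl fun j _ => h1 j, ← σ.sum_comp]
      have := congrFun ht l
      simpa [Matrix.vecMul, dotProduct, edgeMatrix] using this
    · rw [hab.sum_eq j _ fun x hx => hg0 _ hx, hga, hgb]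
      simp
  have := linearIndepOn_finset_iff.1 hli g hsum
  refine ht0 (funext fun l => ?_)
  have h2 := this ⟨σ l, b (σ l)⟩ (((hab (σ l)).2 _).2 (Or.inr rfl))
  rw [hgb] at h2
  simpa using h2

theorem IsMixedCell.volume_tropCell [DecidableEq κ] {e : ∀ j, α j → κ → ℤ}
    {ω : (Σ j, α j) → ℝ} {w : κ → ℝ}
    {a b : ∀ j, α j} (hab : IsMixedCell e ω w a b) (σ : κ ≃ ι) :
    MeasureTheory.volume (tropCell e ω w) = ENNReal.ofReal |((edgeMatrix e σ a b).det : ℝ)| := by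
  classical
  set N : Matrix κ κ ℝ := ((edgeMatrix e σ a b).map (Int.castRingHom ℝ)).transpose with hN
  let v : κ → ℝ := fun l => ∑ j, (e j (a j) l : ℝ)
  have hset : tropCell e ω w = (fun x => x + v) ''
      (Matrix.toLin' N '' Set.univ.pi fun _ => Set.Ioo (0 : ℝ) 1) := by
    ext x
    constructor
    · rintro ⟨c, h0, h1, h2⟩
      obtain ⟨h2, h3⟩ := (sum_smul_cayleyCol_eq_iff _ _ _ _).1 h2
      have h4 : ∀ j, c ⟨j, a j⟩ + c ⟨j, b j⟩ = 1 := fun j => by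
        rw [← hab.sum_eq j (fun x => c ⟨j, x⟩) fun x hx => h1 _ hx]
        exact h3 j
      refine ⟨_, ⟨fun l => c ⟨σ l, b (σ l)⟩, fun l _ => ⟨?_, ?_⟩, rfl⟩, ?_⟩
      · exact h0 _ (((hab _).2 _).2 (Or.inr rfl))
      · have := h0 _ (((hab (σ l)).2 _).2 (Or.inl rfl))
        have := h4 (σ l)
        change c _ < 1
        linarith
      · ext k
        rw [← h2 k, ← Finset.univ_sigma_univ, Finset.sum_sigma]
        beta_reduce
        rw [Pi.add_apply, Matrix.toLin'_apply]
        simp only [v, Matrix.mulVec, dotProduct, hN, Matrix.transpose_apply, Matrix.map_apply,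
          edgeMatrix, Matrix.of_apply]
        rw [σ.sum_comp fun j => (Int.castRingHom ℝ) (e j (b j) k - e j (a j) k) * c ⟨j, b j⟩,
          ← Finset.sum_add_distrib]
        refine Finset.sum_congr rfl fun j _ => ?_
        rw [hab.sum_eq j _ fun x hx => by rw [h1 _ hx, zero_mul], eq_sub_of_add_eq (h4 j)]
        push_cast
        simp
        ring
    · rintro ⟨_, ⟨t, ht, rfl⟩, rfl⟩
      let c : (Σ j, α j) → ℝ := fun s =>
        if s.2 = b s.1 then t (σ.symm s.1) else if s.2 = a s.1 then 1 - t (σ.symm s.1) else 0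
      have hca : ∀ j, c ⟨j, a j⟩ = 1 - t (σ.symm j) := fun j => by simp [c, (hab j).1]
      have hcb : ∀ j, c ⟨j, b j⟩ = t (σ.symm j) := fun j => by simp [c]
      have hc0 : ∀ s ∉ tropArgmin e ω w, c s = 0 := by
        rintro ⟨j, x⟩ hx
        have := mt ((hab j).2 x).2 hx
        push Not at this
        simp [c, this.1, this.2]
      refine ⟨c, ?_, hc0, (sum_smul_cayleyCol_eq_iff _ _ _ _).2 ⟨fun k => ?_, fun j => ?_⟩⟩
      · rintro ⟨j, x⟩ hx
        have htj := ht (σ.symm j) trivial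
        rcases ((hab j).2 x).1 hx with rfl | rfl
        · rw [hca]
          linarith [htj.2]
        · rw [hcb]
          exact htj.1
      · rw [← Finset.univ_sigma_univ, Finset.sum_sigma]
        beta_reduce
        rw [Pi.add_apply, Matrix.toLin'_apply]
        simp only [v, Matrix.mulVec, dotProduct, hN, Matrix.transpose_apply, Matrix.map_apply,
          edgeMatrix, Matrix.of_apply]
        have hσ : ∑ l, (Int.castRingHom ℝ) (e (σ l) (b (σ l)) k - e (σ l) (a (σ l)) k) * t l =
            ∑ j, (Int.castRingHom ℝ) (e j (b j) k - e j (a j) k) * t (σ.symm j) := by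
          rw [← σ.sum_comp]
          simp
        rw [hσ, ← Finset.sum_add_distrib]
        refine Finset.sum_congr rfl fun j _ => ?_
        rw [hab.sum_eq j _ fun x hx => by rw [hc0 _ hx, zero_mul], hca, hcb]
        simp
        ring
      · rw [hab.sum_eq j _ fun x hx => hc0 _ hx, hca, hcb]
        simp
  rw [hset, Set.image_add_right, MeasureTheory.measure_preimage_add_right,
    MeasureTheory.Measure.addHaar_image_linearMap, LinearMap.det_toLin', Real.volume_pi_Ioo]
  have : N.det = ((edgeMatrix e σ a b).det : ℝ) := by
    rw [hN, Matrix.det_transpose, ← RingHom.mapMatrix_apply, ← RingHom.map_det]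
    simp
  rw [this]
  simp

theorem volume_tropCell_ne_top (e : ∀ j, α j → κ → ℤ) (ω : (Σ j, α j) → ℝ) (w : κ → ℝ) :
    MeasureTheory.volume (tropCell e ω w) ≠ ⊤ := by
  let C : κ → ℝ := fun l => ∑ s : Σ j, α j, |(e s.1 s.2 l : ℝ)|
  have hsub : tropCell e ω w ⊆ Set.Icc (-C) C := by
    refine (tropCell_subset e ω w).trans ?_
    rintro x ⟨c, hc0, hc⟩
    obtain ⟨h2, h3⟩ := (sum_smul_cayleyCol_eq_iff _ _ _ _).1 hc
    have hc1 : ∀ s, c s ≤ 1 := by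
      rintro ⟨j, x⟩
      refine le_of_le_of_eq ?_ (h3 j)
      exact Finset.single_le_sum (f := fun a => c ⟨j, a⟩) (fun a _ => hc0 _) (Finset.mem_univ x)
    have hx : ∀ l, |x l| ≤ C l := by
      intro l
      rw [← h2 l]
      refine (Finset.abs_sum_le_sum_abs _ _).trans (Finset.sum_le_sum fun s _ => ?_)
      rw [abs_mul, abs_of_nonneg (hc0 s)]
      exact mul_le_of_le_one_left (abs_nonneg _) (hc1 s)
    exact ⟨fun l => (abs_le.1 (hx l)).1, fun l => (abs_le.1 (hx l)).2⟩
  exact (lt_of_le_of_lt (MeasureTheory.measure_mono hsub) isCompact_Icc.measure_lt_top).ne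

theorem sum_neg_one_pow_filter_superset (B : Finset ι) :
    ∑ s ∈ (Finset.univ : Finset ι).powerset with B ⊆ s, (-1 : ℝ) ^ (Fintype.card ι - s.card) =
      if B = Finset.univ then 1 else 0 := by
  have h := congrArg (Int.cast : ℤ → ℝ) (Finset.sum_powerset_neg_one_pow_card (x := Bᶜ))
  push_cast at h
  simp only [Finset.compl_eq_empty_iff] at h
  rw [← h]
  refine Finset.sum_bij' (fun s _ => sᶜ) (fun t _ => tᶜ) ?_ ?_ ?_ ?_ ?_
  · intro s hs
    simpa using (Finset.mem_filter.1 hs).2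
  · intro t ht
    rw [Finset.mem_powerset] at ht
    refine Finset.mem_filter.2 ⟨by simp, ?_⟩
    rwa [← Finset.compl_subset_compl, compl_compl]
  · simp
  · simp
  · intro s _
    rw [Finset.card_compl]

open Pointwise in
theorem sum_powerset_volume_convexHull [∀ j, Nonempty (α j)] {e : ∀ j, α j → κ → ℤ}
    {ω : (Σ j, α j) → ℝ} (hω : IsGenericWeight e ω) (hκ : 0 < Fintype.card κ) :
    (∑ s ∈ (Finset.univ : Finset ι).powerset,
      if s.Nonempty then
        (-1 : ℝ) ^ (Fintype.card ι - s.card) * (MeasureTheory.volume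
          (∑ j ∈ s, convexHull ℝ (Set.range fun (a : α j) l => (e j a l : ℝ)))).toReal
      else 0) =
    ∑ w ∈ (finite_tropVertices hω).toFinset with ∀ j, 2 ≤ slotCount e ω w j,
      (MeasureTheory.volume (tropCell e ω w)).toReal := by
  classical
  set W := (finite_tropVertices hω).toFinset with hW
  let B : (κ → ℝ) → Finset ι := fun w => Finset.univ.filter fun j => slotCount e ω w j ≠ 1
  have hB : ∀ w s, (∀ j, j ∉ s → slotCount e ω w j = 1) ↔ B w ⊆ s := by
    intro w s
    simp only [B, Finset.subset_iff, Finset.mem_filter, Finset.mem_univ, true_and]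
    exact forall_congr' fun j => not_imp_comm
  have hterm : ∀ s ∈ (Finset.univ : Finset ι).powerset, (if s.Nonempty then
        (-1 : ℝ) ^ (Fintype.card ι - s.card) * (MeasureTheory.volume
          (∑ j ∈ s, convexHull ℝ (Set.range fun (a : α j) l => (e j a l : ℝ)))).toReal
      else 0) = ∑ w ∈ W, if B w ⊆ s then (-1 : ℝ) ^ (Fintype.card ι - s.card) *
        (MeasureTheory.volume (tropCell e ω w)).toReal else 0 := by
    intro s _
    rw [← Finset.sum_filter, ← Finset.mul_sum]
    split_ifs with hs
    · rw [volume_sum_convexHull hω s,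
        ENNReal.toReal_sum fun w _ => volume_tropCell_ne_top e ω w]
      simp only [hB]
      rfl
    · rw [Finset.not_nonempty_iff_eq_empty] at hs
      subst hs
      rw [Finset.filter_false_of_mem, Finset.sum_empty, mul_zero]
      intro w hw h
      have h1 : (tropArgmin e ω w).card = Fintype.card κ + Fintype.card ι :=
        (finite_tropVertices hω).mem_toFinset.1 hw
      rw [card_tropArgmin, Finset.sum_congr rfl fun j _ => (hB w ∅).2 h j (Finset.notMem_empty j)] at h1
      simp at h1
      lia
  rw [Finset.sum_congr rfl hterm, Finset.sum_comm, Finset.sum_filter]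
  refine Finset.sum_congr rfl fun w _ => ?_
  rw [← Finset.sum_filter, ← Finset.sum_mul, sum_neg_one_pow_filter_superset, ite_mul, one_mul,
    zero_mul]
  refine if_congr ?_ rfl rfl
  simp only [B, Finset.filter_eq_self, Finset.mem_univ, true_imp_iff]
  refine forall_congr' fun j => ?_
  have := slotCount_pos e ω w j
  lia

open Pointwise in
/-- Bernstein's count of the mixed volume by mixed cells. -/
theorem exists_mixedCells [DecidableEq κ] [∀ j, Nonempty (α j)] {e : ∀ j, α j → κ → ℤ}
    {ω : (Σ j, α j) → ℝ} (hω : IsGenericWeight e ω) (hκ : 0 < Fintype.card κ) (σ : κ ≃ ι) :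
    ∃ (W : Finset (κ → ℝ)) (a b : (κ → ℝ) → ∀ j, α j),
      (∀ w, (∀ j, 2 ≤ slotCount e ω w j) → w ∈ W) ∧
      (∀ w ∈ W, IsMixedCell e ω w (a w) (b w)) ∧
      (∀ w ∈ W, (edgeMatrix e σ (a w) (b w)).det ≠ 0) ∧
      (∑ s ∈ (Finset.univ : Finset ι).powerset,
        if s.Nonempty then
          (-1 : ℝ) ^ (Fintype.card ι - s.card) * (MeasureTheory.volume
            (∑ j ∈ s, convexHull ℝ (Set.range fun (a : α j) l => (e j a l : ℝ)))).toReal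
        else 0) = ∑ w ∈ W, ((edgeMatrix e σ (a w) (b w)).det.natAbs : ℝ) := by
  classical
  have hcard : Fintype.card κ = Fintype.card ι := Fintype.card_congr σ
  have hex : ∀ w : κ → ℝ, ∃ a b : ∀ j, α j, (∀ j, 2 ≤ slotCount e ω w j) → IsMixedCell e ω w a b := by
    intro w
    by_cases h : ∀ j, 2 ≤ slotCount e ω w j
    · obtain ⟨a, b, hab⟩ := exists_isMixedCell (slotCount_eq_two hω hcard h).1
      exact ⟨a, b, fun _ => hab⟩
    · exact ⟨fun _ => Classical.arbitrary _, fun _ => Classical.arbitrary _, fun h' => absurd h' h⟩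
  choose a b hab using hex
  refine ⟨(finite_tropVertices hω).toFinset.filter fun w => ∀ j, 2 ≤ slotCount e ω w j, a, b,
    fun w hw => ?_, fun w hw => hab w (Finset.mem_filter.1 hw).2,
    fun w hw => (hab w (Finset.mem_filter.1 hw).2).det_ne_zero hω σ, ?_⟩
  · exact Finset.mem_filter.2 ⟨(Set.Finite.mem_toFinset _).2 (slotCount_eq_two hω hcard hw).2, hw⟩
  · rw [sum_powerset_volume_convexHull hω hκ]
    refine Finset.sum_congr rfl fun w hw => ?_
    rw [(hab w (Finset.mem_filter.1 hw).2).volume_tropCell σ, ENNReal.toReal_ofReal (abs_nonneg _)]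
    rw [Nat.cast_natAbs, Int.cast_abs]

end MixedCells

section CharacterCount

variable {κ k : Type*} [Fintype κ] [DecidableEq κ] [Field k]

/-- The characters of `ℤ^κ` trivial on the rows of `V` number at most `|det V|`. -/
theorem card_le_natAbs_det_of_torusChar_eq_one {V : Matrix κ κ ℤ} (hV : V.det ≠ 0)
    (S : Finset (κ → kˣ)) (hS : ∀ χ ∈ S, ∀ j, torusChar χ (V j) = 1) :
    S.card ≤ V.det.natAbs := by
  classical
  have hli : LinearIndependent ℤ V := Matrix.linearIndependent_rows_of_det_ne_zero hV
  set N : Submodule ℤ (κ → ℤ) := Submodule.span ℤ (Set.range V) with hN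
  let bN : Module.Basis κ ℤ N := Module.Basis.span hli
  have hcard : V.det.natAbs = Nat.card ((κ → ℤ) ⧸ N) := by
    rw [← Submodule.natAbs_det_basis_change (Pi.basisFun ℤ κ) N bN, Pi.basisFun_det]
    congr 2
    funext l
    exact (congrArg Subtype.val (Module.Basis.span_apply hli l)).symm
  have hfin : Finite ((κ → ℤ) ⧸ N) := Nat.finite_of_card_ne_zero (by
    rw [← hcard]
    exact Int.natAbs_ne_zero.2 hV)
  let f : (κ → kˣ) → (κ → ℤ) →+ Additive kˣ := fun χ =>
    { toFun := fun a => Additive.ofMul (torusChar χ a)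
      map_zero' := by rw [torusChar_zero]; rfl
      map_add' := fun a b => by rw [torusChar_add]; rfl }
  have hker : ∀ χ ∈ S, N.toAddSubgroup ≤ (f χ).ker := by
    intro χ hχ a ha
    refine Submodule.span_induction (p := fun a _ => a ∈ (f χ).ker) ?_ (zero_mem _)
      (fun _ _ _ _ => add_mem) (fun m _ _ h => zsmul_mem h m) ha
    rintro _ ⟨j, rfl⟩
    exact congrArg Additive.ofMul (hS χ hχ j)
  let G := Multiplicative ((κ → ℤ) ⧸ N)
  let g : S → (G →* k) := fun χ => (Units.coeHom k).comp
    (AddMonoidHom.toMultiplicativeLeft (QuotientAddGroup.lift N.toAddSubgroup (f χ.1) (hker χ.1 χ.2)))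
  have hginj : Function.Injective g := by
    intro χ χ' h
    refine Subtype.ext (funext fun l => Units.ext ?_)
    have := DFunLike.congr_fun h (Multiplicative.ofAdd (Submodule.Quotient.mk (Pi.single l 1)))
    have hval : ∀ χ : S, g χ (Multiplicative.ofAdd (Submodule.Quotient.mk (Pi.single l 1))) =
        ((χ.1 l : kˣ) : k) := by
      intro χ
      change ((torusChar χ.1 (Pi.single l 1) : kˣ) : k) = _
      rw [torusChar, Finset.prod_eq_single l]
      · simp
      · intro b _ hb
        simp [Pi.single_eq_of_ne hb]
      · simp
    rwa [hval, hval] at this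
  have : Fintype G := Fintype.ofFinite _
  have h1 := ((linearIndependent_monoidHom G k).comp g hginj).fintype_card_le_finrank
  rw [Module.finrank_fintype_fun_eq_card, Fintype.card_coe] at h1
  rw [hcard]
  refine h1.trans_eq ?_
  rw [← Nat.card_eq_fintype_card]
  rfl

end CharacterCount

section Ultrametric

variable {K : Type*} [NormedField K] [IsUltrametricDist K]

theorem exists_residueField.{u} (K : Type u) [NormedField K] [IsUltrametricDist K] :
    ∃ (O : Subring K) (k : Type u) (_ : Field k) (r : O →+* k),
      (∀ x, x ∈ O ↔ ‖x‖ ≤ 1) ∧ ∀ x : O, r x = 0 ↔ ‖(x : K)‖ < 1 := by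
  let A := (NormedField.valuation (K := K)).valuationSubring
  refine ⟨A.toSubring, IsLocalRing.ResidueField A, inferInstance, IsLocalRing.residue A,
    fun x => ?_, fun x => ?_⟩
  · change x ∈ A ↔ _
    rw [Valuation.mem_valuationSubring_iff]
    rfl
  · refine (IsLocalRing.residue_eq_zero_iff (R := A) x).trans
      ((ValuationSubring.valuation_lt_one_iff A x).trans ?_)
    rw [← ((NormedField.valuation (K := K)).isEquiv_valuation_valuationSubring).lt_one_iff_lt_one]
    rfl

/-- The units of norm one whose distance to `1` satisfies `p`. -/
def unitsNear (p : ℝ → Prop) (hp : ∀ x y, x ≤ y → p y → p x) (h0 : p 0) : Subgroup Kˣ where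
  carrier := {u | ‖(u : K)‖ = 1 ∧ p ‖(u : K) - 1‖}
  one_mem' := by simpa using h0
  mul_mem' := by
    rintro u v ⟨hu, hu'⟩ ⟨hv, hv'⟩
    refine ⟨by simp [hu, hv], hp _ (max ‖(v : K) - 1‖ ‖(u : K) - 1‖) ?_ ?_⟩
    · rw [Units.val_mul, show (u * v : K) - 1 = u * (v - 1) + (u - 1) by ring]
      refine (IsUltrametricDist.norm_add_le_max _ _).trans ?_
      rw [norm_mul, hu, one_mul]
    · rcases max_choice ‖(v : K) - 1‖ ‖(u : K) - 1‖ with h | h <;> rw [h] <;> assumption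
  inv_mem' := by
    rintro u ⟨hu, hu'⟩
    refine ⟨by simp [hu], ?_⟩
    have : ((u⁻¹ : Kˣ) : K) - 1 = (u⁻¹ : Kˣ) * (1 - u) := by
      rw [mul_sub, mul_one, Units.inv_mul]
    rw [this, norm_mul, norm_sub_rev (1 : K)]
    simpa [hu] using hu'

theorem torusChar_mem {κ : Type*} [Fintype κ] (H : Subgroup Kˣ) {ρ : κ → Kˣ} (h : ∀ l, ρ l ∈ H)
    (a : κ → ℤ) : torusChar ρ a ∈ H :=
  Subgroup.prod_mem _ fun l _ => Subgroup.zpow_mem _ (h l) _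

theorem norm_pow_sub_one {u : K} (hu : ‖u - 1‖ < 1) {D : ℕ} (hD : ‖(D : K)‖ = 1) :
    ‖u ^ D - 1‖ = ‖u - 1‖ := by
  rcases eq_or_ne u 1 with rfl | hu1
  · simp
  have hunorm : ‖u‖ = 1 := by
    have h := IsUltrametricDist.norm_add_eq_max_of_norm_ne_norm (x := u - 1) (y := 1)
      (by rw [norm_one]; exact hu.ne)
    rw [sub_add_cancel, norm_one, max_eq_right hu.le] at h
    exact h
  let U : Kˣ := Units.mk0 u (by rintro rfl; simp at hunorm)
  have hU : U ∈ unitsNear (K := K) (fun x => x < 1) (fun x y h h' => h.trans_lt h') one_pos :=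
    ⟨hunorm, hu⟩
  rw [← geom_sum_mul, norm_mul]
  suffices h : ‖∑ i ∈ Finset.range D, u ^ i‖ = 1 by rw [h, one_mul]
  have h1 : ‖∑ i ∈ Finset.range D, (u ^ i - 1)‖ < 1 := by
    rcases Nat.eq_zero_or_pos D with rfl | hDpos
    · simp
    obtain ⟨i, hi, hle⟩ := IsUltrametricDist.exists_norm_finsetSum_le (Finset.range D)
      fun i => u ^ i - 1
    exact hle.trans_lt (Subgroup.pow_mem _ hU i).2
  have h2 : ∑ i ∈ Finset.range D, u ^ i = ∑ i ∈ Finset.range D, (u ^ i - 1) + D := by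
    simp
  rw [h2, IsUltrametricDist.norm_add_eq_max_of_norm_ne_norm (by rw [hD]; exact h1.ne), hD,
    max_eq_right h1.le]

variable {κ : Type*} [Fintype κ] [DecidableEq κ]

theorem torusChar_edge_pow {V : Matrix κ κ ℤ} (ρ : κ → Kˣ) (H : Subgroup Kˣ)
    (h : ∀ j, torusChar ρ (V j) ∈ H) (l : κ) : ρ l ^ V.det.natAbs ∈ H := by
  have h1 : ρ l ^ V.det ∈ H := by
    have h2 : ∏ j, torusChar ρ (V j) ^ V.adjugate l j = ρ l ^ V.det := by
      have h3 : ∀ j, torusChar ρ (V j) ^ V.adjugate l j = ∏ m, ρ m ^ (V.adjugate l j * V j m) := by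
        intro j
        rw [torusChar, ← Finset.prod_zpow]
        refine Finset.prod_congr rfl fun m _ => ?_
        rw [← zpow_mul, mul_comm]
      have h5 : ∀ (m : κ) (s : Finset κ) (f : κ → ℤ), ∏ j ∈ s, ρ m ^ f j = ρ m ^ ∑ j ∈ s, f j := by
        intro m s f
        induction s using Finset.induction_on with
        | empty => simp
        | insert a s ha ih => rw [Finset.prod_insert ha, Finset.sum_insert ha, ih, zpow_add]
      rw [Finset.prod_congr rfl fun j _ => h3 j, Finset.prod_comm]
      simp only [h5]
      have h4 : ∀ m, ∑ j, V.adjugate l j * V j m = V.det * if l = m then 1 else 0 := by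
        intro m
        have := congrFun (congrFun V.adjugate_mul l) m
        rwa [Matrix.mul_apply, Matrix.smul_apply, Matrix.one_apply, smul_eq_mul] at this
      simp only [h4]
      rw [Finset.prod_eq_single l]
      · simp
      · intro b _ hb
        simp [hb.symm]
      · simp
    rw [← h2]
    exact Subgroup.prod_mem _ fun j _ => Subgroup.zpow_mem _ (h j) _
  rcases Int.natAbs_eq V.det with h2 | h2
  · rwa [h2, zpow_natCast] at h1
  · rw [h2, zpow_neg, zpow_natCast] at h1
    exact inv_mem_iff.1 h1

end Ultrametric

section UltrametricRoots

variable {K : Type*} [NormedField K] [IsUltrametricDist K]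

theorem exists_residueHom.{u} (K : Type u) [NormedField K] [IsUltrametricDist K] :
    ∃ (k : Type u) (_ : Field k)
      (φ : unitsNear (K := K) (fun x => x ≤ 1) (fun _ _ => le_trans) zero_le_one →* kˣ),
      ∀ u, φ u = 1 ↔ ‖((u : Kˣ) : K) - 1‖ < 1 := by
  obtain ⟨O, k, hk, r, hO, hr⟩ := exists_residueField K
  let f : unitsNear (K := K) (fun x => x ≤ 1) (fun _ _ => le_trans) zero_le_one →* O :=
    { toFun := fun u => ⟨((u : Kˣ) : K), (hO _).2 u.2.1.le⟩
      map_one' := rfl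
      map_mul' := fun _ _ => rfl }
  refine ⟨k, hk, ((r : O →* k).comp f).toHomUnits, fun u => ?_⟩
  rw [Units.ext_iff]
  change r (f u) = 1 ↔ _
  rw [← sub_eq_zero, ← map_one r, ← map_sub, hr]
  rfl

variable {ι κ : Type*} [Fintype ι] [Fintype κ] {α : ι → Type*} [∀ j, Fintype (α j)]

theorem norm_torusChar_edge_sub_one_lt {e : ∀ j, α j → κ → ℤ} {c : (Σ j, α j) → K} {ξ ρ : κ → Kˣ}
    {j : ι} {a b : α j} (hξ : ∑ x, c ⟨j, x⟩ * (torusChar ξ (e j x) : K) = 0)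
    (hξρ : ∑ x, c ⟨j, x⟩ * (torusChar (ξ * ρ) (e j x) : K) = 0) (hab : a ≠ b) {N : ℝ} (hN : 0 < N)
    (hb : ‖c ⟨j, b⟩ * (torusChar ξ (e j b) : K)‖ = N)
    (hx : ∀ x, x ≠ a → x ≠ b → ‖c ⟨j, x⟩ * (torusChar ξ (e j x) : K)‖ < N) {δ : ℝ} (hδ : 0 < δ)
    (hρ : ∀ m, ‖(torusChar ρ m : K) - 1‖ ≤ δ) :
    ‖(torusChar ρ (e j b - e j a) : K) - 1‖ < δ := by
  classical
  set t : α j → K := fun x => c ⟨j, x⟩ * (torusChar ξ (e j x) : K) with ht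
  have h1 : ∑ x, t x * ((torusChar ρ (e j x - e j a) : K) - 1) = 0 := by
    simp only [mul_sub, Finset.sum_sub_distrib, mul_one]
    rw [hξ, sub_zero]
    have h2 : ∀ x, t x * (torusChar ρ (e j x - e j a) : K) =
        c ⟨j, x⟩ * (torusChar (ξ * ρ) (e j x) : K) * ((torusChar ρ (e j a))⁻¹ : Kˣ) := by
      intro x
      rw [torusChar_sub, torusChar_mul, div_eq_mul_inv]
      push_cast
      ring
    rw [Finset.sum_congr rfl fun x _ => h2 x, ← Finset.sum_mul, hξρ, zero_mul]
  rw [← Finset.add_sum_erase _ _ (Finset.mem_univ b)] at h1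
  obtain ⟨i, hi, hle⟩ := @IsUltrametricDist.exists_norm_finsetSum_le _ _ _ _ (Finset.univ.erase b)
    ⟨a⟩ fun x => t x * ((torusChar ρ (e j x - e j a) : K) - 1)
  have hib := Finset.ne_of_mem_erase (hi ⟨a, Finset.mem_erase.2 ⟨hab, Finset.mem_univ _⟩⟩)
  have h3 : ‖t i * ((torusChar ρ (e j i - e j a) : K) - 1)‖ < N * δ := by
    rcases eq_or_ne i a with rfl | hia
    · simp [torusChar_zero]
      positivity
    · rw [norm_mul]
      exact (mul_le_mul_of_nonneg_left (hρ _) (norm_nonneg _)).trans_lt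
        (mul_lt_mul_of_pos_right (hx i hia hib) hδ)
  have h4 := hle.trans_lt h3
  rw [← norm_neg, ← eq_neg_of_add_eq_zero_left h1, norm_mul, hb] at h4
  exact lt_of_mul_lt_mul_left h4 hN.le

variable [DecidableEq κ]

/-- Over an ultrametric field, the roots of given valuation dual to a mixed cell number at most the
volume of the cell. -/
theorem IsMixedCell.card_fiber_le {e : ∀ j, α j → κ → ℤ} {ω : (Σ j, α j) → ℝ} {w : κ → ℝ}
    {a b : ∀ j, α j} (hab : IsMixedCell e ω w a b) (σ : κ ≃ ι)
    (hdet : (edgeMatrix e σ a b).det ≠ 0)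
    (hD : ‖((edgeMatrix e σ a b).det.natAbs : K)‖ = 1) {c : (Σ j, α j) → K}
    (T : Finset (κ → Kˣ)) (hT : ∀ ξ ∈ T, IsSystemRoot e Set.univ c ξ) {N : ι → ℝ}
    (hN : ∀ j, 0 < N j)
    (hb : ∀ ξ ∈ T, ∀ j, ‖c ⟨j, b j⟩ * (torusChar ξ (e j (b j)) : K)‖ = N j)
    (hx : ∀ ξ ∈ T, ∀ j x, x ≠ a j → x ≠ b j → ‖c ⟨j, x⟩ * (torusChar ξ (e j x) : K)‖ < N j)
    (hnorm : ∀ ξ ∈ T, ∀ ξ' ∈ T, ∀ l, ‖(ξ l : K)‖ = ‖(ξ' l : K)‖) :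
    T.card ≤ (edgeMatrix e σ a b).det.natAbs := by
  classical
  rcases T.eq_empty_or_nonempty with rfl | ⟨ξ₀, hξ₀⟩
  · simp
  set V := edgeMatrix e σ a b with hV
  have key : ∀ ξ ∈ T, ∀ ξ' ∈ T, ∀ δ : ℝ, 0 < δ →
      (∀ m, ‖(torusChar (ξ / ξ') m : K) - 1‖ ≤ δ) →
      ∀ l, ‖(torusChar (ξ / ξ') (V l) : K) - 1‖ < δ := by
    intro ξ hξ ξ' hξ' δ hδ hm l
    refine norm_torusChar_edge_sub_one_lt (ξ := ξ') (hT ξ' hξ' (σ l) trivial) ?_ (hab (σ l)).1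
      (hN (σ l)) (hb ξ' hξ' (σ l)) (hx ξ' hξ' (σ l)) hδ hm
    rw [mul_div_cancel]
    exact hT ξ hξ (σ l) trivial
  obtain ⟨k, hk, φ, hφ⟩ := exists_residueHom K
  have hmem : ∀ ξ ∈ T, ∀ ξ' ∈ T, ∀ l, (ξ / ξ') l ∈ unitsNear (K := K) (fun x => x ≤ 1)
      (fun _ _ => le_trans) zero_le_one := by
    intro ξ hξ ξ' hξ' l
    have h1 : ‖(((ξ / ξ') l : Kˣ) : K)‖ = 1 := by
      rw [Pi.div_apply, Units.val_div_eq_div_val, norm_div, hnorm ξ hξ ξ' hξ' l]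
      exact div_self (norm_ne_zero_iff.2 (Units.ne_zero _))
    refine ⟨h1, ?_⟩
    rw [sub_eq_add_neg]
    refine (IsUltrametricDist.norm_add_le_max _ _).trans ?_
    simp only [h1, norm_neg, norm_one, max_self, le_refl]
  have hone : ∀ ξ ∈ T, ∀ ξ' ∈ T, ∀ l, ‖(torusChar (ξ / ξ') (V l) : K) - 1‖ < 1 :=
    fun ξ hξ ξ' hξ' => key ξ hξ ξ' hξ' 1 one_pos fun m => (torusChar_mem _ (hmem ξ hξ ξ' hξ') m).2
  let χ : T → κ → kˣ := fun ξ l => φ ⟨(ξ.1 / ξ₀) l, hmem _ ξ.2 _ hξ₀ l⟩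
  have hχ : ∀ ξ : T, ∀ m, torusChar (χ ξ) m =
      φ ⟨torusChar (ξ.1 / ξ₀) m, torusChar_mem _ (hmem _ ξ.2 _ hξ₀) m⟩ := by
    intro ξ m
    simp only [torusChar, χ]
    simp only [← map_zpow, ← map_prod]
    congr 1
    refine Subtype.ext ?_
    simp
  have hinj : Function.Injective χ := by
    intro ξ ξ' h
    by_contra hne
    have hnear : ∀ l, ‖(((ξ.1 / ξ'.1) l : Kˣ) : K) - 1‖ < 1 := by
      intro l
      refine (hφ ⟨_, hmem _ ξ.2 _ ξ'.2 l⟩).1 ?_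
      have h1 : (⟨(ξ.1 / ξ'.1) l, hmem _ ξ.2 _ ξ'.2 l⟩ : unitsNear (K := K) (fun x => x ≤ 1)
          (fun _ _ => le_trans) zero_le_one) = ⟨(ξ.1 / ξ₀) l, hmem _ ξ.2 _ hξ₀ l⟩ /
          ⟨(ξ'.1 / ξ₀) l, hmem _ ξ'.2 _ hξ₀ l⟩ := by
        refine Subtype.ext ?_
        change ξ.1 l / ξ'.1 l = (ξ.1 l / ξ₀ l) / (ξ'.1 l / ξ₀ l)
        rw [div_div_div_cancel_right]
      rw [h1, map_div, div_eq_one]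
      exact congrFun h l
    have hne' : ∃ l, ξ.1 l ≠ ξ'.1 l := by
      by_contra! h'
      exact hne (Subtype.ext (funext h'))
    obtain ⟨l₀, hl₀⟩ := hne'
    obtain ⟨l, hl⟩ := @Finite.exists_max _ _ _ ⟨l₀⟩ _
      fun l => ‖(((ξ.1 / ξ'.1) l : Kˣ) : K) - 1‖
    set δ := ‖(((ξ.1 / ξ'.1) l : Kˣ) : K) - 1‖ with hδ
    have hδ0 : 0 < δ := by
      refine lt_of_lt_of_le (norm_pos_iff.2 ?_) (hl l₀)
      rw [sub_ne_zero]
      intro h'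
      exact hl₀ (div_eq_one.1 (Units.ext h'))
    have h1 : ∀ m, ‖(torusChar (ξ.1 / ξ'.1) m : K) - 1‖ ≤ δ := fun m =>
      (torusChar_mem (unitsNear (K := K) (fun x => x ≤ δ) (fun _ _ => le_trans) hδ0.le)
        (fun l => ⟨(hmem _ ξ.2 _ ξ'.2 l).1, hl l⟩) m).2
    have h2 := torusChar_edge_pow (V := V) (ξ.1 / ξ'.1)
      (unitsNear (K := K) (fun x => x < δ) (fun x y h h' => h.trans_lt h') hδ0)
      (fun j => ⟨(torusChar_mem _ (hmem _ ξ.2 _ ξ'.2) _).1, key _ ξ.2 _ ξ'.2 δ hδ0 h1 j⟩) l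
    have h3 : ‖(((ξ.1 / ξ'.1) l : Kˣ) : K) ^ V.det.natAbs - 1‖ < δ := by
      simpa using h2.2
    rw [norm_pow_sub_one (hnear l) hD] at h3
    exact lt_irrefl _ h3
  have h := card_le_natAbs_det_of_torusChar_eq_one hdet (Finset.univ.image χ) ?_
  · rwa [Finset.card_image_of_injective _ hinj, Finset.card_univ, Fintype.card_coe] at h
  · intro ψ hψ j
    obtain ⟨ξ, -, rfl⟩ := Finset.mem_image.1 hψ
    rw [hχ]
    exact (hφ _).2 (hone _ ξ.2 _ hξ₀ j)

end UltrametricRoots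

section MixedCellCount

variable {ι κ : Type*} [Fintype ι] [Fintype κ] {α : ι → Type*} [∀ j, Fintype (α j)]

section

variable {K : Type*} [NormedField K]

theorem norm_term_eq_rpow {e : ∀ j, α j → κ → ℤ} {ω : (Σ j, α j) → ℝ} {c : (Σ j, α j) → K} {q : ℝ}
    (hq : 1 < q) (hc : ∀ s, ‖c s‖ = q ^ (-ω s)) (ξ : κ → Kˣ) (s : Σ j, α j) :
    ‖c s * (torusChar ξ (e s.1 s.2) : K)‖ =
      q ^ (-tropCost e ω (fun l => Real.logb q ‖(ξ l : K)‖) s) := by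
  have hq0 : 0 < q := one_pos.trans hq
  have h1 : ‖(torusChar ξ (e s.1 s.2) : K)‖ =
      q ^ (∑ l, Real.logb q ‖(ξ l : K)‖ * e s.1 s.2 l) := by
    rw [torusChar, Units.coe_prod, norm_prod, Real.rpow_sum_of_pos hq0]
    refine Finset.prod_congr rfl fun l _ => ?_
    rw [Real.rpow_mul hq0.le, Real.rpow_logb hq0 hq.ne' (norm_pos_iff.2 (Units.ne_zero _)),
      Real.rpow_intCast, Units.val_zpow_eq_zpow_val, norm_zpow]
  rw [norm_mul, hc, h1, ← Real.rpow_add hq0, tropCost, neg_sub, sub_eq_neg_add]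

variable [IsUltrametricDist K]

theorem two_le_slotCount [∀ j, Nonempty (α j)] {e : ∀ j, α j → κ → ℤ} {ω : (Σ j, α j) → ℝ}
    {c : (Σ j, α j) → K} {q : ℝ}
    (hq : 1 < q) (hc : ∀ s, ‖c s‖ = q ^ (-ω s)) {ξ : κ → Kˣ} (hξ : IsSystemRoot e Set.univ c ξ)
    (j : ι) : 2 ≤ slotCount e ω (fun l => Real.logb q ‖(ξ l : K)‖) j := by
  classical
  set w : κ → ℝ := fun l => Real.logb q ‖(ξ l : K)‖ with hw
  by_contra! hlt
  have hone : slotCount e ω w j = 1 := le_antisymm (Nat.le_of_lt_succ hlt) (slotCount_pos e ω w j)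
  obtain ⟨a, ha⟩ := exists_mem_tropArgmin e ω w j
  have h0 := hξ j trivial
  rw [← Finset.add_sum_erase _ _ (Finset.mem_univ a)] at h0
  obtain ⟨x, hx, hle⟩ := @IsUltrametricDist.exists_norm_finsetSum_le _ _ _ _ (Finset.univ.erase a)
    ⟨a⟩ fun x => c ⟨j, x⟩ * (torusChar ξ (e j x) : K)
  rw [← norm_neg, ← eq_neg_of_add_eq_zero_left h0] at hle
  have hpos : 0 < ‖c ⟨j, a⟩ * (torusChar ξ (e j a) : K)‖ := by
    rw [norm_term_eq_rpow hq hc ξ ⟨j, a⟩]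
    exact Real.rpow_pos_of_pos (one_pos.trans hq) _
  have hne : (Finset.univ.erase a).Nonempty := by
    by_contra h
    rw [Finset.not_nonempty_iff_eq_empty] at h
    rw [h, Finset.sum_empty, add_zero] at h0
    rw [h0, norm_zero] at hpos
    exact lt_irrefl _ hpos
  have hxa := Finset.ne_of_mem_erase (hx hne)
  rw [norm_term_eq_rpow hq hc ξ ⟨j, a⟩, norm_term_eq_rpow hq hc ξ ⟨j, x⟩,
    Real.rpow_le_rpow_left_iff hq, neg_le_neg_iff] at hle
  refine hxa (eq_of_slotCount_eq_one hone ha (mem_tropArgmin.2 fun y => ?_))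
  exact hle.trans (mem_tropArgmin.1 ha y)

theorem card_roots_le_sum_natAbs_det [DecidableEq κ] [∀ j, Nonempty (α j)]
    {e : ∀ j, α j → κ → ℤ} {ω : (Σ j, α j) → ℝ} (σ : κ ≃ ι)
    {W : Finset (κ → ℝ)} {a b : (κ → ℝ) → ∀ j, α j}
    (hW : ∀ w, (∀ j, 2 ≤ slotCount e ω w j) → w ∈ W)
    (hab : ∀ w ∈ W, IsMixedCell e ω w (a w) (b w))
    (hdet : ∀ w ∈ W, (edgeMatrix e σ (a w) (b w)).det ≠ 0)
    (hD : ∀ w ∈ W, ‖((edgeMatrix e σ (a w) (b w)).det.natAbs : K)‖ = 1)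
    {c : (Σ j, α j) → K} {q : ℝ} (hq : 1 < q) (hc : ∀ s, ‖c s‖ = q ^ (-ω s))
    (S : Finset (κ → Kˣ)) (hS : ∀ ξ ∈ S, IsSystemRoot e Set.univ c ξ) :
    S.card ≤ ∑ w ∈ W, (edgeMatrix e σ (a w) (b w)).det.natAbs := by
  classical
  have hq0 : 0 < q := one_pos.trans hq
  let v : (κ → Kˣ) → κ → ℝ := fun ξ l => Real.logb q ‖(ξ l : K)‖
  rw [Finset.card_eq_sum_card_fiberwise (f := v) (t := W)
    fun ξ hξ => hW _ (two_le_slotCount hq hc (hS ξ hξ))]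
  refine Finset.sum_le_sum fun w hw => ?_
  have hv : ∀ ξ ∈ S.filter fun ξ => v ξ = w, v ξ = w := fun ξ hξ => (Finset.mem_filter.1 hξ).2
  refine (hab w hw).card_fiber_le σ (hdet w hw) (hD w hw) _
    (fun ξ hξ => hS ξ (Finset.mem_filter.1 hξ).1)
    (N := fun j => q ^ (-tropCost e ω w ⟨j, b w j⟩)) (fun j => Real.rpow_pos_of_pos hq0 _)
    (fun ξ hξ j => ?_) (fun ξ hξ j x hxa hxb => ?_) fun ξ hξ ξ' hξ' l => ?_
  · rw [norm_term_eq_rpow hq hc ξ ⟨j, b w j⟩]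
    change q ^ (-tropCost e ω (v ξ) ⟨j, b w j⟩) = _
    rw [hv ξ hξ]
  · rw [norm_term_eq_rpow hq hc ξ ⟨j, x⟩]
    change q ^ (-tropCost e ω (v ξ) ⟨j, x⟩) < _
    rw [hv ξ hξ, Real.rpow_lt_rpow_left_iff hq, neg_lt_neg_iff]
    have h1 : (⟨j, x⟩ : Σ j, α j) ∉ tropArgmin e ω w := by
      rw [((hab w hw) j).2]
      tauto
    rw [mem_tropArgmin] at h1
    push Not at h1
    obtain ⟨y, hy⟩ := h1
    have h2 := mem_tropArgmin.1 ((((hab w hw) j).2 (b w j)).2 (Or.inr rfl)) y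
    exact h2.trans_lt hy
  · have h1 := congrFun ((hv ξ hξ).trans (hv ξ' hξ').symm) l
    exact Real.logb_injOn_pos hq (norm_pos_iff.2 (Units.ne_zero _))
      (norm_pos_iff.2 (Units.ne_zero _)) h1

end

open MvPolynomial in
theorem IsGeneric.algebraMap_comp {τ F K : Type*} [Field F] [Field K] [Algebra F K] {w : τ → F}
    (hw : IsGeneric w) : IsGeneric fun t => algebraMap F K (w t) := by
  intro P hP
  refine hw P ((algebraMap F K).injective ?_)
  rw [map_zero, ← hP]
  exact comp_aeval_apply w (algebraMap F K).toIntAlgHom P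

open Pointwise MvPolynomial in
/-- The number of generic roots is at most the mixed volume. -/
theorem card_offField_roots_le [DecidableEq ι] [DecidableEq κ] [∀ j, Nonempty (α j)]
    {e : ∀ j, α j → κ → ℤ} (hκ : 0 < Fintype.card κ) (i : ι) (σ : κ ≃ {j // j ≠ i})
    (H : Finset (κ → (OffField α i)ˣ)) (hH : ∀ η ∈ H, IsSystemRoot e {i}ᶜ (offCoeff α i) η) :
    (H.card : ℝ) ≤ ∑ s ∈ (Finset.univ : Finset {j // j ≠ i}).powerset,
      if s.Nonempty then
        (-1 : ℝ) ^ (Fintype.card {j // j ≠ i} - s.card) * (MeasureTheory.volume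
          (∑ j ∈ s, convexHull ℝ (Set.range fun (a : α j.1) l => (e j.1 a l : ℝ)))).toReal
      else 0 := by
  classical
  set e' : ∀ j : {j // j ≠ i}, α j.1 → κ → ℤ := fun j => e j.1 with he'
  obtain ⟨ω, hω⟩ := exists_isGenericWeight e'
  obtain ⟨W, a, b, hW, hab, hdet, hsum⟩ := exists_mixedCells hω hκ σ
  obtain ⟨p, hpW, hp⟩ := Nat.exists_infinite_primes
    (∑ w ∈ W, (edgeMatrix e' σ (a w) (b w)).det.natAbs + 1)
  have : Fact p.Prime := ⟨hp⟩
  have hp1 : (1 : ℝ) < p := by exact_mod_cast hp.one_lt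
  let K := PadicAlgCl p
  have hD : ∀ w ∈ W, ‖((edgeMatrix e' σ (a w) (b w)).det.natAbs : K)‖ = 1 := by
    intro w hw
    set D := (edgeMatrix e' σ (a w) (b w)).det.natAbs with hDdef
    have hD0 : 0 < D := Int.natAbs_pos.2 (hdet w hw)
    have hDp : D < p := by
      have := Finset.single_le_sum (f := fun w => (edgeMatrix e' σ (a w) (b w)).det.natAbs)
        (fun _ _ => Nat.zero_le _) hw
      change D ≤ _ at this
      lia
    rw [← map_natCast (algebraMap ℚ_[p] K), PadicAlgCl.norm_extends]
    rw [Padic.norm_natCast_eq_one_iff]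
    exact (Nat.Prime.coprime_iff_not_dvd hp).2 (Nat.not_dvd_of_pos_of_lt hD0 hDp)
  let ω' : Off α i → ℤ := fun s => ω ⟨⟨s.1.1, s.2⟩, s.1.2⟩
  let U : Set (Off α i → ℚ_[p]) := Set.univ.pi fun s => Metric.sphere 0 ((p : ℝ) ^ (-ω' s))
  have hUo : IsOpen U := isOpen_set_pi Set.finite_univ fun s _ =>
    IsUltrametricDist.isOpen_sphere _ (zpow_ne_zero _ (by positivity))
  have hUne : U.Nonempty := ⟨fun s => (p : ℚ_[p]) ^ ω' s, fun s _ => by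
    rw [mem_sphere_zero_iff_norm, Padic.norm_p_zpow]⟩
  obtain ⟨c, hcU, hc⟩ := (dense_isGeneric (Off α i) ℚ_[p]).inter_open_nonempty U hUo hUne
  have hcK : IsGeneric fun s => algebraMap ℚ_[p] K (c s) := hc.algebraMap_comp
  obtain ⟨φ, hφ, -⟩ := hcK.exists_lift
  let cK : (Σ j, α j) → K := fun s => if h : s.1 ≠ i then algebraMap ℚ_[p] K (c ⟨s, h⟩) else 0
  have hφc : ∀ s : Off α i, φ (algebraMap (MvPolynomial (Off α i) ℤ) _ (X s)) = cK s.1 := by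
    intro s
    rw [hφ, aeval_X]
    have h : s.1.1 ≠ i := s.2
    simp only [cK, dif_pos h]
  let c' : (Σ j : {j // j ≠ i}, α j.1) → K := fun s => cK ⟨s.1.1, s.2⟩
  have hc' : ∀ s, ‖c' s‖ = (p : ℝ) ^ (-(ω s : ℝ)) := by
    intro s
    have h1 : c' s = algebraMap ℚ_[p] K (c ⟨⟨s.1.1, s.2⟩, s.1.2⟩) := dif_pos s.1.2
    rw [h1, PadicAlgCl.norm_extends, ← Int.cast_neg, Real.rpow_intCast]
    exact mem_sphere_zero_iff_norm.1 (hcU _ trivial)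
  let f : (κ → (OffField α i)ˣ) → κ → Kˣ := fun η l => Units.map (φ : OffField α i →* K) (η l)
  have hf : Function.Injective f := by
    intro η η' h
    funext l
    exact Units.map_injective φ.injective (congrFun h l)
  have hle := card_roots_le_sum_natAbs_det σ hW hab hdet hD hp1 hc' (H.image f) ?_
  · rw [Finset.card_image_of_injective _ hf] at hle
    rw [hsum]
    exact_mod_cast hle
  · intro ξ hξ
    obtain ⟨η, hη, rfl⟩ := Finset.mem_image.1 hξ
    have h1 := (isSystemRoot_offCoeff_iff hφc η).2 (hH η hη)
    exact fun j _ => h1 j.1 j.2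

end MixedCellCount

section

open MvPolynomial

section Nullstellensatz

theorem Polynomial.dvd_of_forall_eval₂_eq_zero {R K : Type*} [CommRing R] [IsDomain R]
    [UniqueFactorizationMonoid R] [Field K] [IsAlgClosed K] {g : R →+* K}
    (hg : Function.Injective g) {p q : Polynomial R} (hp : Irreducible p) (hdeg : p.natDegree ≠ 0)
    (h : ∀ t, p.eval₂ g t = 0 → q.eval₂ g t = 0) : p ∣ q := by
  let _ : NormalizedGCDMonoid R :=
    Nonempty.some inferInstance
  have hprim : p.IsPrimitive := hp.isPrimitive hdeg
  let F := FractionRing R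
  let φ : F →+* K := IsFractionRing.lift hg
  have hφ : φ.comp (algebraMap R F) = g := RingHom.ext fun x => IsFractionRing.lift_algebraMap hg x
  have hirrF := (hprim.irreducible_iff_irreducible_map_fraction_map (K := F)).1 hp
  refine hprim.dvd_of_fraction_map_dvd_fraction_map (K := F) ?_
  by_contra hn
  have hco := ((hirrF.coprime_iff_not_dvd).2 hn).map (Polynomial.mapRingHom φ)
  simp only [Polynomial.coe_mapRingHom, Polynomial.map_map, hφ] at hco
  obtain ⟨t, ht⟩ : ∃ t, (p.map g).IsRoot t := by
    refine IsAlgClosed.exists_root _ ?_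
    rw [Polynomial.degree_map_eq_of_injective hg]
    exact fun h0 => hdeg (Polynomial.natDegree_eq_zero_iff_degree_le_zero.2 h0.le)
  have hq := h t ((Polynomial.eval_map _ _).symm.trans ht)
  rw [← Polynomial.eval_map] at hq
  obtain ⟨a, b, hab⟩ := hco
  have := congrArg (Polynomial.eval t) hab
  rw [Polynomial.eval_add, Polynomial.eval_mul, Polynomial.eval_mul, ht.eq_zero, hq] at this
  simp at this

/-- An irreducible integer polynomial with a complex zero divides every polynomial vanishing on its
complex zero set. -/
theorem dvd_of_forall_aeval_eq_zero {σ : Type*} [Finite σ] {E P : MvPolynomial σ ℤ}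
    (hE : Irreducible E) (hz : ∃ c : σ → ℂ, aeval c E = 0)
    (h : ∀ c : σ → ℂ, aeval c E = 0 → aeval c P = 0) : E ∣ P := by
  classical
  obtain ⟨s, hs⟩ : ∃ s, E.degreeOf s ≠ 0 := by
    by_contra! h0
    have h1 : E.vars = ∅ := by
      rw [Finset.eq_empty_iff_forall_notMem]
      intro s hs
      rw [mem_vars_iff_mem_support] at hs
      obtain ⟨m, hm, hms⟩ := hs
      exact Finsupp.mem_support_iff.1 hms
        (Nat.le_zero.1 ((monomial_le_degreeOf s hm).trans_eq (h0 s)))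
    obtain ⟨k, hk⟩ : ∃ k, E = C k := ⟨_, vars_eq_empty_iff_eq_C.1 h1⟩
    obtain ⟨c, hc⟩ := hz
    rw [hk, aeval_C] at hc
    have hk0 : k = 0 := by simpa using hc
    exact hE.ne_zero (by rw [hk, hk0, map_zero])
  let τ := {b // b ≠ s}
  let Φ : MvPolynomial σ ℤ ≃ₐ[ℤ] Polynomial (MvPolynomial τ ℤ) :=
    (renameEquiv ℤ (Equiv.optionSubtypeNe s).symm).trans (optionEquivLeft ℤ τ)
  have hΦdeg : (Φ E).natDegree ≠ 0 := by
    rw [degreeOf_eq_natDegree] at hs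
    exact hs
  have hΦirr : Irreducible (Φ E) := (MulEquiv.irreducible_iff Φ.toMulEquiv).2 hE
  have heval : ∀ (w : τ → ℂ) (t : ℂ) Q, (Φ Q).eval₂ (aeval w : MvPolynomial τ ℤ →ₐ[ℤ] ℂ).toRingHom t =
      aeval (fun b => if h : b = s then t else w ⟨b, h⟩) Q := by
    intro w t Q
    have : ((Polynomial.eval₂RingHom (aeval w : MvPolynomial τ ℤ →ₐ[ℤ] ℂ).toRingHom t).comp
        (Φ : MvPolynomial σ ℤ →+* Polynomial (MvPolynomial τ ℤ))) =
        (aeval (fun b => if h : b = s then t else w ⟨b, h⟩) : MvPolynomial σ ℤ →ₐ[ℤ] ℂ).toRingHom := by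
      refine MvPolynomial.ringHom_ext (fun k => by simp) fun b => ?_
      by_cases hb : b = s
      · subst hb
        simp [Φ]
      · simp [Φ, hb]
    exact RingHom.congr_fun this Q
  obtain ⟨w, hw⟩ := (dense_isGeneric τ ℂ).nonempty
  let g : MvPolynomial τ ℤ →+* ℂ := (aeval w : MvPolynomial τ ℤ →ₐ[ℤ] ℂ).toRingHom
  have hg : Function.Injective g := (injective_iff_map_eq_zero _).2 hw
  refine (map_dvd_iff Φ).1 (Polynomial.dvd_of_forall_eval₂_eq_zero hg hΦirr hΦdeg fun t ht => ?_)
  rw [heval] at ht ⊢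
  exact h _ ht

/-- A polynomial whose zero set is invariant under changing the coordinates outside the range of an
injective map only involves the coordinates in this range. -/
theorem exists_rename_eq_of_forall_aeval {σ τ : Type*} {f : σ → τ} (hf : Function.Injective f)
    {E : MvPolynomial τ ℤ} (h : ∀ c c' : τ → ℂ, c ∘ f = c' ∘ f → aeval c E = 0 → aeval c' E = 0) :
    ∃ E' : MvPolynomial σ ℤ, rename f E' = E := by
  classical
  have key : ∀ c c' : τ → ℂ, c ∘ f = c' ∘ f → aeval c E = aeval c' E := by
    intro c c' hcc
    let p : Polynomial ℂ := aeval (fun t => Polynomial.C (c t) + Polynomial.C (c' t - c t) *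
      Polynomial.X) E
    have hp : ∀ z, p.eval z = aeval (fun t => c t + (c' t - c t) * z) E := by
      intro z
      have := comp_aeval_apply (fun t => Polynomial.C (c t) + Polynomial.C (c' t - c t) *
        Polynomial.X) (Polynomial.evalRingHom z).toIntAlgHom E
      refine this.trans ?_
      congr 2
      funext t
      simp
    have hp0 : p.natDegree = 0 := by
      by_contra h0
      obtain ⟨z, hz⟩ := IsAlgClosed.exists_root p fun h1 =>
        h0 (Polynomial.natDegree_eq_zero_iff_degree_le_zero.2 h1.le)
      have hall : ∀ z', p.eval z' = 0 := by
        intro z'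
        rw [hp]
        refine h _ _ ?_ ((hp z).symm.trans hz)
        funext s
        have := congrFun hcc s
        simp only [Function.comp_apply] at this ⊢
        rw [this]; ring
      have hp0 : p = 0 := Polynomial.funext (by simpa using hall)
      exact h0 (by rw [hp0, Polynomial.natDegree_zero])
    have h1 := hp 0
    have h2 := hp 1
    rw [Polynomial.eq_C_of_natDegree_eq_zero hp0, Polynomial.eval_C] at h1 h2
    simpa using h1.symm.trans h2
  let k : τ → MvPolynomial σ ℤ := fun t => if ht : t ∈ Set.range f then X ht.choose else 0
  have hk : ∀ s, k (f s) = X s := by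
    intro s
    have hs : f s ∈ Set.range f := ⟨s, rfl⟩
    simp only [k, dif_pos hs]
    congr 1
    exact hf hs.choose_spec
  refine ⟨aeval k E, ?_⟩
  have hinj : Function.Injective (map (σ := τ) (Int.castRingHom ℂ)) :=
    map_injective _ Int.cast_injective
  refine hinj (MvPolynomial.funext fun c => ?_)
  have haev : ∀ Q : MvPolynomial τ ℤ, eval c (map (Int.castRingHom ℂ) Q) = aeval c Q := by
    intro Q
    rw [eval_map, aeval_def]; rfl
  rw [haev, haev, aeval_rename, comp_aeval_apply]
  refine key _ _ ?_
  funext s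
  simp [hk]

theorem Irreducible.of_rename {σ τ : Type*} {f : σ → τ} (hf : Function.Injective f)
    {E : MvPolynomial σ ℤ} (h : Irreducible (rename f E)) : Irreducible E := by
  have hunit : ∀ P : MvPolynomial σ ℤ, IsUnit (rename f P) → IsUnit P := by
    intro P hP
    have := hP.map (killCompl hf)
    rwa [killCompl_rename_app] at this
  refine ⟨fun hE => h.not_isUnit (hE.map (rename f)), fun a b hab => ?_⟩
  have := h.isUnit_or_isUnit (a := rename f a) (b := rename f b) (by rw [← map_mul, hab])
  exact this.imp (hunit a) (hunit b)

end Nullstellensatz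

end

section Resultant

variable (A : Fin (n + 1) → Finset (Fin n → ℤ))

/-- The exponents of the family of supports `A`. -/
def suppExp (j : Fin (n + 1)) (a : {a // a ∈ A j}) : Fin n → ℤ := a.1

/-- The coefficient variables that occur for the family of supports `A`. -/
def suppVar (s : Σ j, {a // a ∈ A j}) : Fin (n + 1) × (Fin n → ℤ) := (s.1, s.2.1)

theorem suppVar_injective : Function.Injective (suppVar A) := by
  rintro ⟨j, a, ha⟩ ⟨j', a', ha'⟩ h
  obtain ⟨rfl, rfl⟩ := Prod.mk.inj h
  rfl

variable {A}

theorem chEval_eq_torusChar (ξ : Fin n → ℂˣ) (a : Fin n → ℤ) : chEval ξ a = torusChar ξ a := by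
  rw [chEval, torusChar, Units.coe_prod]

theorem isRootOf_iff_isSystemRoot {c : Fin (n + 1) → (Fin n → ℤ) → ℂ} {ξ : Fin n → ℂˣ} :
    IsRootOf A c ξ ↔ IsSystemRoot (suppExp A) Set.univ (fun s => c s.1 s.2.1) ξ := by
  have h : ∀ i, ∑ a : {a // a ∈ A i}, c i a.1 * (torusChar ξ (suppExp A i a) : ℂ) =
      ∑ a ∈ A i, c i a * chEval ξ a := by
    intro i
    simp only [chEval_eq_torusChar]
    exact Finset.sum_coe_sort (A i) fun a => c i a * (torusChar ξ a : ℂ)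
  exact ⟨fun hc i _ => (h i).trans (hc i), fun hc i => (h i).symm.trans (hc i trivial)⟩

theorem hasRoot_zero : HasRoot A 0 := ⟨1, fun i => by simp⟩

theorem hasRoot_congr {c c' : Fin (n + 1) → (Fin n → ℤ) → ℂ}
    (h : ∀ s : Σ j, {a // a ∈ A j}, c s.1 s.2.1 = c' s.1 s.2.1) (hc : HasRoot A c) :
    HasRoot A c' := by
  obtain ⟨ξ, hξ⟩ := hc
  refine ⟨ξ, fun i => (Finset.sum_congr rfl fun a ha => ?_).trans (hξ i)⟩
  rw [h ⟨i, a, ha⟩]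

theorem mem_closure_hasRoot_congr {c c' : Fin (n + 1) → (Fin n → ℤ) → ℂ}
    (h : ∀ s : Σ j, {a // a ∈ A j}, c s.1 s.2.1 = c' s.1 s.2.1)
    (hc : c ∈ closure {c | HasRoot A c}) : c' ∈ closure {c | HasRoot A c} := by
  have hf : Continuous fun x : Fin (n + 1) → (Fin n → ℤ) → ℂ => x + (c' - c) :=
    continuous_id.add continuous_const
  have := hf.closure_preimage_subset {c | HasRoot A c}
  have hpre : (fun x => x + (c' - c)) ⁻¹' {c | HasRoot A c} = {c | HasRoot A c} := by
    ext x
    have hx : ∀ s : Σ j, {a // a ∈ A j}, x s.1 s.2.1 = (x + (c' - c)) s.1 s.2.1 := by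
      intro s
      simp [h s]
    exact ⟨hasRoot_congr fun s => (hx s).symm, hasRoot_congr hx⟩
  rw [hpre] at this
  simpa using this hc

theorem exists_isElim {E : MvPolynomial (Fin (n + 1) × (Fin n → ℤ)) ℤ} (hirr : Irreducible E)
    (hE : {c | evalCoeff E c = 0} = closure {c | HasRoot A c}) :
    ∃ E', MvPolynomial.rename (suppVar A) E' = E ∧ IsElim (suppExp A) E' := by
  have hzero : ∀ c : Fin (n + 1) × (Fin n → ℤ) → ℂ, MvPolynomial.aeval c E = 0 ↔
      (fun i a => c (i, a)) ∈ closure {c | HasRoot A c} := by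
    intro c
    rw [← hE]
    rfl
  obtain ⟨E', rfl⟩ := exists_rename_eq_of_forall_aeval (suppVar_injective A) (E := E) (by
    intro c c' hcc hc
    rw [hzero] at hc ⊢
    exact mem_closure_hasRoot_congr (fun s => congrFun hcc s) hc)
  refine ⟨E', rfl, hirr.of_rename (suppVar_injective A), fun P => ⟨fun hP => ?_, ?_⟩⟩
  · refine dvd_of_forall_aeval_eq_zero (hirr.of_rename (suppVar_injective A)) ⟨0, ?_⟩ fun c hc => ?_
    · have := (hzero 0).2 (subset_closure hasRoot_zero)
      rwa [MvPolynomial.aeval_rename] at this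
    · obtain ⟨c', rfl⟩ : ∃ c' : Fin (n + 1) × (Fin n → ℤ) → ℂ, c' ∘ suppVar A = c :=
        ⟨Function.extend (suppVar A) c 0, funext ((suppVar_injective A).extend_apply c 0)⟩
      rw [← MvPolynomial.aeval_rename, hzero] at hc
      have hcl : IsClosed {c : Fin (n + 1) → (Fin n → ℤ) → ℂ |
          MvPolynomial.aeval (fun s : Σ j, {a // a ∈ A j} => c s.1 s.2.1) P = 0} :=
        isClosed_eq ((continuous_aeval_int P).comp (by fun_prop)) continuous_const
      have hsub : {c | HasRoot A c} ⊆ {c : Fin (n + 1) → (Fin n → ℤ) → ℂ |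
          MvPolynomial.aeval (fun s : Σ j, {a // a ∈ A j} => c s.1 s.2.1) P = 0} := by
        rintro x ⟨ξ, hξ⟩
        exact hP _ ξ (isRootOf_iff_isSystemRoot.1 hξ)
      have hmem := closure_minimal hsub hcl hc
      rw [Set.mem_ofPred_eq] at hmem
      exact hmem
  · rintro ⟨Q, rfl⟩ c ξ hξ
    obtain ⟨c', rfl⟩ : ∃ c' : Fin (n + 1) × (Fin n → ℤ) → ℂ, c' ∘ suppVar A = c :=
      ⟨Function.extend (suppVar A) c 0, funext ((suppVar_injective A).extend_apply c 0)⟩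
    rw [map_mul, ← MvPolynomial.aeval_rename, (hzero c').2, zero_mul]
    exact subset_closure ⟨ξ, isRootOf_iff_isSystemRoot.2 hξ⟩

theorem card_le_mixedVolume (hA : ∀ i, (A i).Nonempty) (i : Fin (n + 1))
    (H : Finset (Fin n → (OffField (fun j => {a // a ∈ A j}) i)ˣ))
    (hH : ∀ η ∈ H, IsSystemRoot (suppExp A) {i}ᶜ (offCoeff _ i) η) :
    (H.card : ℝ) ≤ mixedVolume n (fun j : {j : Fin (n + 1) // j ≠ i} =>
      convexHull ℝ (castR n '' ↑(A j.1))) := by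
  rw [mixedVolume]
  split_ifs with hn
  · subst hn
    exact_mod_cast Finset.card_le_one_of_subsingleton H
  · have _ : ∀ j, Nonempty {a // a ∈ A j} := fun j => (hA j).to_subtype
    refine (card_offField_roots_le (by simpa using Nat.pos_of_ne_zero hn) i
      (finSuccAboveEquiv i) H hH).trans_eq ?_
    have hset : ∀ j : {j : Fin (n + 1) // j ≠ i},
        (Set.range fun (a : {a // a ∈ A j.1}) l => (suppExp A j.1 a l : ℝ)) =
          castR n '' ↑(A j.1) := by
      intro j
      rw [Set.image_eq_range]
      rfl
    simp only [hset]

/-- The degree bound for the resultant, in terms of mixed volumes. -/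
theorem mul_slotDeg_le_mixedVolume (hA : ∀ i, (A i).Nonempty)
    {E : MvPolynomial (Σ j, {a // a ∈ A j}) ℤ} (hE : IsElim (suppExp A) E) {d : ℕ}
    {U : Set (Fin (n + 1) → (Fin n → ℤ) → ℂ)} (hU : IsOpen U)
    (hcl : closure (U ∩ {c | HasRoot A c}) = closure {c | HasRoot A c})
    (hd : ∀ c ∈ U ∩ {c | HasRoot A c}, Nat.card {ξ // IsRootOf A c ξ} = d) (i : Fin (n + 1)) :
    ((d * slotDeg i E : ℕ) : ℝ) ≤ mixedVolume n (fun j : {j : Fin (n + 1) // j ≠ i} =>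
      convexHull ℝ (castR n '' ↑(A j.1))) := by
  by_cases h0 : d * slotDeg i E = 0
  · rw [h0]
    simpa using card_le_mixedVolume hA i ∅ (by simp)
  have hd0 : 0 < d := Nat.pos_of_ne_zero (left_ne_zero_of_mul h0)
  obtain ⟨c₀, hc₀U, hc₀⟩ : (U ∩ {c | HasRoot A c}).Nonempty := by
    rw [← closure_nonempty_iff, hcl]
    exact ⟨0, subset_closure hasRoot_zero⟩
  let ext : ((Σ j, {a // a ∈ A j}) → ℂ) → Fin (n + 1) → (Fin n → ℤ) → ℂ := fun c i a =>
    if h : a ∈ A i then c ⟨i, a, h⟩ else c₀ i a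
  have hext : Continuous ext := by
    refine continuous_pi fun i => continuous_pi fun a => ?_
    by_cases h : a ∈ A i
    · simp only [ext, dif_pos h]; fun_prop
    · simp only [ext, dif_neg h]; fun_prop
  have hres : ∀ c, (fun s : Σ j, {a // a ∈ A j} => ext c s.1 s.2.1) = c := by
    intro c
    funext s
    exact dif_pos s.2.2
  have hroot : ∀ c ξ, IsSystemRoot (suppExp A) Set.univ c ξ ↔ IsRootOf A (ext c) ξ := by
    intro c ξ
    rw [isRootOf_iff_isSystemRoot, hres]
  have hext₀ : ext (fun s => c₀ s.1 s.2.1) = c₀ := by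
    funext i a
    by_cases h : a ∈ A i
    · simp only [ext, dif_pos h]
    · simp only [ext, dif_neg h]
  obtain ⟨H, hH, hHcard⟩ := hE.exists_finset_roots (by simp) (fun j => ⟨_, (hA j).choose_spec⟩)
    (right_ne_zero_of_mul h0) (hU.preimage hext) (d := d)
    ⟨fun s => c₀ s.1 s.2.1, by rwa [Set.mem_preimage, hext₀], by
      obtain ⟨ξ, hξ⟩ := hc₀
      exact ⟨ξ, isRootOf_iff_isSystemRoot.1 hξ⟩⟩ hd0 fun c hc hcr => by
        simp only [hroot] at hcr ⊢
        exact hd _ ⟨hc, hcr⟩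
  rw [← hHcard]
  exact card_le_mixedVolume hA i H hH

end Resultant

theorem natAbs_coeff_rename_le {σ τ : Type*} {f : σ → τ} (hf : Function.Injective f) [Fintype σ]
    (P : MvPolynomial σ ℤ) (m : τ →₀ ℕ) :
    (((MvPolynomial.rename f P).coeff m).natAbs : ℝ) ≤ polydiscNorm 1 P := by
  by_cases h : (MvPolynomial.rename f P).coeff m = 0
  · rw [h]
    simpa using polydiscNorm_nonneg 1 P
  obtain ⟨u, rfl, -⟩ := MvPolynomial.coeff_rename_ne_zero f P m h
  rw [MvPolynomial.coeff_rename_mapDomain f hf]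
  simpa using natAbs_coeff_mul_le_polydiscNorm (r := 1) (fun _ => zero_le_one) P u

theorem polydiscNorm_pow_le {σ : Type*} [Fintype σ] (P : MvPolynomial σ ℤ) (d : ℕ) :
    polydiscNorm 1 (P ^ d) ≤ polydiscNorm 1 P ^ d := by
  refine polydiscNorm_le (fun _ => zero_le_one) fun u hu => ?_
  rw [map_pow, norm_pow]
  exact pow_le_pow_left₀ (norm_nonneg _) (norm_aeval_le_polydiscNorm P hu) d

theorem log_height_le {σ τ : Type*} {f : σ → τ} (hf : Function.Injective f) [Fintype σ]
    {P : MvPolynomial σ ℤ} (hP : 1 ≤ polydiscNorm 1 P) (d : ℕ) {R : MvPolynomial τ ℤ}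
    (hR : R = MvPolynomial.rename f P ^ d ∨ R = -MvPolynomial.rename f P ^ d) :
    Real.log ((R.support.sup fun m => (MvPolynomial.coeff m R).natAbs : ℕ) : ℝ) ≤
      d * Real.log (polydiscNorm 1 P) := by
  have hX : (((R.support.sup fun m => (MvPolynomial.coeff m R).natAbs : ℕ) : ℝ)) ≤
      polydiscNorm 1 P ^ d := by
    have h0 : (0 : ℝ) ≤ polydiscNorm 1 P ^ d := by positivity
    rw [← Nat.le_floor_iff h0]
    refine Finset.sup_le fun m _ => ?_
    rw [Nat.le_floor_iff h0]
    refine le_trans ?_ (polydiscNorm_pow_le P d)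
    have h1 := natAbs_coeff_rename_le hf (P ^ d) m
    rw [map_pow] at h1
    rcases hR with rfl | rfl
    · exact h1
    · rwa [MvPolynomial.coeff_neg, Int.natAbs_neg]
  rw [← Real.log_pow]
  rcases Nat.eq_zero_or_pos (R.support.sup fun m => (MvPolynomial.coeff m R).natAbs) with h | h
  · rw [h, Nat.cast_zero, Real.log_zero]
    exact Real.log_nonneg (one_le_pow₀ hP)
  · exact Real.log_le_log (by exact_mod_cast h) hX

/-- The height of the sparse resultant (the log of the maximum
absolute value of its integer coefficients) is bounded by
`∑_{i=0}^{n} MV(Δ_0,…,Δ_{i-1},Δ_{i+1},…,Δ_n) log #A_i`. -/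
theorem height_resultant_le
    (A : Fin (n + 1) → Finset (Fin n → ℤ)) (hA : ∀ i, (A i).Nonempty)
    (R : MvPolynomial (Fin (n + 1) × (Fin n → ℤ)) ℤ) (hR : IsResultant A R) :
    Real.log ((R.support.sup fun m => (MvPolynomial.coeff m R).natAbs : ℕ) : ℝ) ≤
      ∑ i : Fin (n + 1),
        mixedVolume n (fun j : {j : Fin (n + 1) // j ≠ i} =>
          convexHull ℝ (castR n '' ↑(A j.1))) * Real.log ((A i).card : ℝ) := by
  have hlog : ∀ i, 0 ≤ Real.log ((A i).card : ℝ) := fun i => Real.log_natCast_nonneg _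
  obtain ⟨E, d, hE, hRE, U, hU, hcl, hd⟩ := hR
  rcases hE with ⟨hirr, hz⟩ | ⟨rfl, -⟩
  · obtain ⟨E', rfl, hE'⟩ := exists_isElim hirr hz
    refine (log_height_le (suppVar_injective A) (one_le_polydiscNorm hE'.1.ne_zero) d hRE).trans ?_
    refine (mul_le_mul_of_nonneg_left (hE'.log_polydiscNorm_le (by simp) fun j =>
      ⟨_, (hA j).choose_spec⟩) d.cast_nonneg).trans ?_
    rw [Finset.mul_sum]
    refine Finset.sum_le_sum fun i _ => ?_
    rw [← mul_assoc, Fintype.card_coe, ← Nat.cast_mul]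
    exact mul_le_mul_of_nonneg_right (mul_slotDeg_le_mixedVolume hA hE' hU hcl hd i) (hlog i)
  · refine (log_height_le (P := (1 : MvPolynomial (Σ j, {a // a ∈ A j}) ℤ)) (suppVar_injective A)
      (one_le_polydiscNorm one_ne_zero) 0 (by simpa using hRE)).trans ?_
    rw [Nat.cast_zero, zero_mul]
    exact Finset.sum_nonneg fun i _ => mul_nonneg
      (by simpa using card_le_mixedVolume hA i ∅ (by simp)) (hlog i)
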